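/- Let P ⊆ ℝ³ be a full-dimensional strictly bipartite convex polytope. Then there exist a linear isometry T of ℝ³ and a real λ > 0 such that P = λ • T(Q), where Q is either the rhombic dodecahedron or the rhombic triacontahedron. -/

import Mathlib

open Set Pointwise

noncomputable section

/-- Euclidean space `ℝ^d`. -/
abbrev Euc (d : ℕ) := EuclideanSpace ℝ (Fin d)

/-- A convex polytope: the convex hull of a finite set of points. -/
def IsPolytope {d : ℕ} (P : Set (Euc d)) : Prop :=
  ∃ S : Finset (Euc d), P = convexHull ℝ (S : Set (Euc d))

/-- `P` is full-dimensional: its affine span is all of `ℝ^d`. -/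
def FullDim {d : ℕ} (P : Set (Euc d)) : Prop :=
  affineSpan ℝ P = ⊤

/-- `[v,w]` is an edge of `P`: an exposed face of `P` which is a segment with `v ≠ w`. -/
def IsEdge {d : ℕ} (P : Set (Euc d)) (v w : Euc d) : Prop :=
  v ≠ w ∧ IsExposed ℝ P (segment ℝ v w)

/-- `e` is an edge of `P`, as a set. -/
def IsEdgeSet {d : ℕ} (P e : Set (Euc d)) : Prop :=
  ∃ v w : Euc d, IsEdge P v w ∧ e = segment ℝ v w

/-- `T` is a symmetry of `P`: a linear isometry mapping `P` onto itself. -/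
def IsAut {d : ℕ} (P : Set (Euc d)) (T : Euc d ≃ₗᵢ[ℝ] Euc d) : Prop :=
  T '' P = P

/-- `P` is vertex-transitive: any vertex (extreme point) can be mapped onto any
other by a symmetry of `P`. -/
def VertexTransitive {d : ℕ} (P : Set (Euc d)) : Prop :=
  ∀ v ∈ Set.extremePoints ℝ P, ∀ w ∈ Set.extremePoints ℝ P,
    ∃ T : Euc d ≃ₗᵢ[ℝ] Euc d, IsAut P T ∧ T v = w

/-- `P` is edge-transitive: any edge can be mapped onto any other by a symmetry of `P`. -/
def EdgeTransitive {d : ℕ} (P : Set (Euc d)) : Prop :=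
  ∀ e e' : Set (Euc d), IsEdgeSet P e → IsEdgeSet P e' →
    ∃ T : Euc d ≃ₗᵢ[ℝ] Euc d, IsAut P T ∧ T '' e = e'

/-- `P` is bipartite with vertex partition `V1, V2`, radii `r1 ≤ r2` and edge length `ℓ`:
all edges have length `ℓ`, every edge joins `V1` to `V2`, where `V1 ⊔ V2` is a partition of
the vertex set, and vertices in `Vᵢ` have norm `rᵢ`. -/
def IsBipartiteWith {d : ℕ} (P V1 V2 : Set (Euc d)) (r1 r2 ℓ : ℝ) : Prop :=
  (0 < ℓ) ∧ (∀ v w : Euc d, IsEdge P v w → ‖v - w‖ = ℓ) ∧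
  (V1 ∪ V2 = Set.extremePoints ℝ P) ∧ Disjoint V1 V2 ∧
  (∀ v w : Euc d, IsEdge P v w → (v ∈ V1 ∧ w ∈ V2) ∨ (v ∈ V2 ∧ w ∈ V1)) ∧
  (0 < r1) ∧ (r1 ≤ r2) ∧ (∀ v ∈ V1, ‖v‖ = r1) ∧ (∀ v ∈ V2, ‖v‖ = r2)

/-- `P` is a bipartite polytope. -/
def IsBipartite {d : ℕ} (P : Set (Euc d)) : Prop :=
  ∃ (V1 V2 : Set (Euc d)) (r1 r2 ℓ : ℝ), IsBipartiteWith P V1 V2 r1 r2 ℓ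

/-- `P` is a strictly bipartite polytope (`r1 < r2`). -/
def IsStrictlyBipartite {d : ℕ} (P : Set (Euc d)) : Prop :=
  ∃ (V1 V2 : Set (Euc d)) (r1 r2 ℓ : ℝ), IsBipartiteWith P V1 V2 r1 r2 ℓ ∧ r1 < r2

/-- The point `(a,b,c) ∈ ℝ³`. -/
def pt3 (a b c : ℝ) : Euc 3 := (WithLp.equiv 2 (Fin 3 → ℝ)).symm ![a, b, c]

/-- The rhombic dodecahedron: the convex hull of the 14 points
`(±1,±1,±1)`, `(±2,0,0)`, `(0,±2,0)`, `(0,0,±2)`. -/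
def rhombicDodecahedron : Set (Euc 3) :=
  convexHull ℝ
    ({pt3 1 1 1, pt3 1 1 (-1), pt3 1 (-1) 1, pt3 1 (-1) (-1),
      pt3 (-1) 1 1, pt3 (-1) 1 (-1), pt3 (-1) (-1) 1, pt3 (-1) (-1) (-1),
      pt3 2 0 0, pt3 (-2) 0 0, pt3 0 2 0, pt3 0 (-2) 0, pt3 0 0 2, pt3 0 0 (-2)} :
      Set (Euc 3))

/-- The golden ratio `(1 + √5)/2`. -/
noncomputable def goldenR : ℝ := (1 + Real.sqrt 5) / 2

/-- All cyclic permutations of the coordinates of `(0, ±a, ±b)`. -/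
def cycSigns (a b : ℝ) : Set (Euc 3) :=
  {x | ∃ s t : ℝ, (s = 1 ∨ s = -1) ∧ (t = 1 ∨ t = -1) ∧
    (x = pt3 0 (s * a) (t * b) ∨ x = pt3 (t * b) 0 (s * a) ∨ x = pt3 (s * a) (t * b) 0)}

/-- The 8 points `(±1,±1,±1)`. -/
def cubeVerts : Set (Euc 3) :=
  {x | ∃ s t u : ℝ, (s = 1 ∨ s = -1) ∧ (t = 1 ∨ t = -1) ∧ (u = 1 ∨ u = -1) ∧
    x = pt3 s t u}

/-- The rhombic triacontahedron: the convex hull of the 32 points `(±1,±1,±1)`,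
the cyclic permutations of the coordinates of `(0, ±1/φ, ±φ)`, and
the cyclic permutations of the coordinates of `(0, ±φ, ±1)`, where `φ` is the
golden ratio. -/
noncomputable def rhombicTriacontahedron : Set (Euc 3) :=
  convexHull ℝ (cubeVerts ∪ cycSigns (1 / goldenR) goldenR ∪ cycSigns goldenR 1)

local notation "⟪" x "," y "⟫" => inner ℝ x y

lemma mem_convexHull_of_isMax {d : ℕ} {S : Set (Euc d)} {f : Euc d →ₗ[ℝ] ℝ} {m : ℝ}
    (hS : ∀ s ∈ S, f s ≤ m) {p : Euc d} (hp : p ∈ convexHull ℝ S) (hfp : f p = m) :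
    p ∈ convexHull ℝ {s ∈ S | f s = m} := by
  set T : Set (Euc d) := convexHull ℝ {s ∈ S | f s = m} with hT
  have hTm : ∀ t ∈ T, f t = m := by
    intro t ht
    have : T ⊆ {q | f q = m} :=
      convexHull_min (fun s hs => hs.2) (convex_hyperplane f.isLinear m)
    exact this ht
  have hconv : Convex ℝ ({q | f q < m} ∪ T) := by
    intro u hu v hv a b ha hb hab
    by_cases hUV : u ∈ T ∧ v ∈ T
    · exact Or.inr (convex_convexHull ℝ _ hUV.1 hUV.2 ha hb hab)
    · have hfu : f u ≤ m := hu.elim (fun h => le_of_lt h) (fun h => (hTm u h).le)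
      have hfv : f v ≤ m := hv.elim (fun h => le_of_lt h) (fun h => (hTm v h).le)
      rcases eq_or_lt_of_le ha with ha0 | ha0
      · have : b = 1 := by linarith
        subst this; rw [← ha0]; simpa using hv
      rcases eq_or_lt_of_le hb with hb0 | hb0
      · have : a = 1 := by linarith
        subst this; rw [← hb0]; simpa using hu
      left
      have hlt : f u < m ∨ f v < m := by
        rcases hu with hu | hu
        · exact Or.inl hu
        · rcases hv with hv | hv
          · exact Or.inr hv
          · exact absurd ⟨hu, hv⟩ hUV
      show f (a • u + b • v) < m
      rw [map_add, map_smul, map_smul, smul_eq_mul, smul_eq_mul]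
      have hm : a * m + b * m = m := by rw [← add_mul, hab, one_mul]
      rcases hlt with h | h
      · nlinarith [mul_lt_mul_of_pos_left h ha0, mul_le_mul_of_nonneg_left hfv hb]
      · nlinarith [mul_lt_mul_of_pos_left h hb0, mul_le_mul_of_nonneg_left hfu ha]
  have hsub : S ⊆ {q | f q < m} ∪ T := by
    intro s hs
    rcases lt_or_eq_of_le (hS s hs) with h | h
    · exact Or.inl h
    · exact Or.inr (subset_convexHull ℝ _ ⟨hs, h⟩)
  rcases convexHull_min hsub hconv hp with h | h
  · exact absurd hfp (ne_of_lt h)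
  · exact h

lemma IsPolytope.finite_extremePoints {d : ℕ} {P : Set (Euc d)} (hP : IsPolytope P) :
    (P.extremePoints ℝ).Finite := by
  obtain ⟨S, rfl⟩ := hP
  exact S.finite_toSet.subset extremePoints_convexHull_subset

lemma convexHull_extremePoints_eq {d : ℕ} {S : Set (Euc d)} (hS : S.Finite) :
    convexHull ℝ ((convexHull ℝ S).extremePoints ℝ) = convexHull ℝ S := by
  have h := closure_convexHull_extremePoints (hS.isCompact_convexHull ℝ) (convex_convexHull ℝ S)
  rwa [((hS.subset extremePoints_convexHull_subset).isClosed_convexHull ℝ).closure_eq] at h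

lemma IsPolytope.convexHull_extremePoints {d : ℕ} {P : Set (Euc d)} (hP : IsPolytope P) :
    convexHull ℝ (P.extremePoints ℝ) = P := by
  obtain ⟨S, rfl⟩ := hP
  exact convexHull_extremePoints_eq S.finite_toSet

/-- An extreme point of the hull of a finite set is strictly separated from the other points. -/
lemma exists_lt_of_mem_extremePoints {d : ℕ} {S : Set (Euc d)} (hS : S.Finite) {x : Euc d}
    (hx : x ∈ (convexHull ℝ S).extremePoints ℝ) :
    ∃ f : StrongDual ℝ (Euc d), ∀ v ∈ S, v ≠ x → f v < f x := by
  have h1 := ((convex_convexHull ℝ S).mem_extremePoints_iff_mem_sdiff_convexHull_sdiff.1 hx).2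
  have h2 : x ∉ convexHull ℝ (S \ {x}) := fun h =>
    h1 (convexHull_mono (sdiff_subset_sdiff_left (subset_convexHull ℝ S)) h)
  obtain ⟨f, u, hf, hu⟩ := geometric_hahn_banach_closed_point (convex_convexHull ℝ _)
    ((hS.subset sdiff_subset).isClosed_convexHull ℝ) h2
  exact ⟨f, fun v hv hvx => (hf v (subset_convexHull ℝ _ ⟨hv, hvx⟩)).trans hu⟩

lemma IsEdge.symm {d : ℕ} {P : Set (Euc d)} {x y : Euc d} (h : IsEdge P x y) : IsEdge P y x :=
  ⟨h.1.symm, segment_symm ℝ x y ▸ h.2⟩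

/-- The edges at a vertex generate the cone of the polytope at this vertex. -/
lemma sub_mem_span_edges {d : ℕ} {P : Set (Euc d)} (hP : IsPolytope P) {x : Euc d}
    (hx : x ∈ P.extremePoints ℝ) {p : Euc d} (hp : p ∈ P) :
    p - x ∈ Submodule.span NNReal ((fun n => n - x) '' {n | IsEdge P x n}) := by
  set C := Submodule.span NNReal ((fun n => n - x) '' {n | IsEdge P x n}) with hC
  have hCsmul : ∀ (t : ℝ) (v : Euc d), 0 ≤ t → v ∈ C → t • v ∈ C := fun t v ht hv =>
    C.smul_mem (⟨t, ht⟩ : NNReal) hv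
  set V := P.extremePoints ℝ with hV
  have hVf : V.Finite := hP.finite_extremePoints
  have hPV : convexHull ℝ V = P := hP.convexHull_extremePoints
  have hxP : x ∈ (convexHull ℝ V).extremePoints ℝ := by rw [hPV]; exact hx
  obtain ⟨f, hf⟩ := exists_lt_of_mem_extremePoints hVf hxP
  set q : Euc d → Euc d := fun v => (f x - f v)⁻¹ • (v - x) with hq
  have hg : ∀ v ∈ V \ {x}, 0 < f x - f v := fun v hv => sub_pos.2 (hf v hv.1 hv.2)
  have hvq : ∀ v ∈ V \ {x}, v - x = (f x - f v) • q v := fun v hv => by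
    rw [hq]; simp only; rw [smul_smul, mul_inv_cancel₀ (hg v hv).ne', one_smul]
  have hfq : ∀ v ∈ V \ {x}, f (q v) = -1 := fun v hv => by
    have := hg v hv
    rw [hq]; simp only [map_smul, map_sub, smul_eq_mul]
    field_simp; ring
  have hQf : (q '' (V \ {x})).Finite := (hVf.subset sdiff_subset).image q
  have key : ∀ e ∈ (convexHull ℝ (q '' (V \ {x}))).extremePoints ℝ, e ∈ C := by
    intro e he
    obtain ⟨f2, hf2⟩ := exists_lt_of_mem_extremePoints hQf he
    obtain ⟨v0, hv0, hqe⟩ := extremePoints_convexHull_subset he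
    set G : Euc d →L[ℝ] ℝ := f2 + (f2 e) • f with hG
    have hG0 : ∀ v ∈ V \ {x}, q v = e → G v = G x := by
      intro v hv hve
      have h1 : G (v - x) = 0 := by
        have hfe : f e = -1 := hve ▸ hfq v hv
        rw [hvq v hv, map_smul, hG, hve]
        simp only [add_apply, smul_apply, hfe, smul_eq_mul]; ring
      rw [map_sub] at h1; linarith
    have hG1 : ∀ v ∈ V \ {x}, q v ≠ e → G v < G x := by
      intro v hv hve
      have h2 := hf2 (q v) (mem_image_of_mem q hv) hve
      have h1 : G (v - x) < 0 := by
        rw [hvq v hv, map_smul, hG]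
        simp only [add_apply, smul_apply, hfq v hv, smul_eq_mul]
        have := hg v hv
        nlinarith
      rw [map_sub] at h1; linarith
    have hGV : ∀ v ∈ V, G v ≤ G x := by
      intro v hv
      by_cases hvx : v = x
      · rw [hvx]
      by_cases hve : q v = e
      · exact (hG0 v ⟨hv, hvx⟩ hve).le
      · exact (hG1 v ⟨hv, hvx⟩ hve).le
    have hGP : ∀ p ∈ P, G p ≤ G x := by
      intro p hp
      rw [← hPV] at hp
      have : convexHull ℝ V ⊆ {q | G q ≤ G x} :=
        convexHull_min hGV (convex_halfSpace_le G.toLinearMap.isLinear (G x))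
      exact this hp
    obtain ⟨n, hn, hmax⟩ := Set.exists_max_image {v ∈ V \ {x} | q v = e} (fun v => f x - f v)
      (hVf.subset (fun v hv => hv.1.1)) ⟨v0, hv0, hqe⟩
    have hnx : n - x = (f x - f n) • e := by rw [hvq n hn.1, hn.2]
    have hedge : IsEdge P x n := by
      refine ⟨fun h => hn.1.2 h.symm, fun _ => ⟨G, ?_⟩⟩
      apply Set.Subset.antisymm
      · have hseg : segment ℝ x n ⊆ P ∩ {q | G q = G x} := by
          apply Convex.segment_subset
          · exact (hPV ▸ convex_convexHull ℝ V).inter (convex_hyperplane G.toLinearMap.isLinear _)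
          · exact ⟨hx.1, rfl⟩
          · exact ⟨hn.1.1.1, hG0 n hn.1 hn.2⟩
        intro p hp
        refine ⟨(hseg hp).1, fun y hy => ?_⟩
        rw [show G p = G x from (hseg hp).2]
        exact hGP y hy
      · rintro p ⟨hp, hpm⟩
        have hGp : G p = G x := le_antisymm (hGP p hp) (hpm x hx.1)
        have h1 := mem_convexHull_of_isMax (f := G.toLinearMap) hGV (by rw [hPV]; exact hp) hGp
        refine (convexHull_min ?_ (convex_segment x n)) h1
        rintro v ⟨hv, hvG⟩
        by_cases hvx : v = x
        · rw [hvx]; exact left_mem_segment ℝ x n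
        have hvV : v ∈ V \ {x} := ⟨hv, hvx⟩
        have hqv : q v = e := by
          by_contra h
          exact absurd hvG (hG1 v hvV h).ne
        have h3 := hmax v ⟨hvV, hqv⟩
        have h4 := hg n hn.1
        rw [segment_eq_image']
        refine ⟨(f x - f v) / (f x - f n), ⟨?_, ?_⟩, ?_⟩
        · exact div_nonneg (hg v hvV).le h4.le
        · rw [div_le_one h4]; exact h3
        · simp only
          rw [hnx, smul_smul, div_mul_cancel₀ _ h4.ne', ← hqv, ← hvq v hvV]; abel
    have : e = (f x - f n)⁻¹ • (n - x) := by
      rw [hnx, smul_smul, inv_mul_cancel₀ (hg n hn.1).ne', one_smul]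
    rw [this]
    exact hCsmul _ _ (inv_nonneg.2 (hg n hn.1).le)
      (Submodule.subset_span ⟨n, hedge, rfl⟩)
  have hCconv : Convex ℝ (C : Set (Euc d)) := fun u hu v hv a b ha hb _ =>
    C.add_mem (hCsmul a u ha hu) (hCsmul b v hb hv)
  have hQC : convexHull ℝ (q '' (V \ {x})) ⊆ C := by
    rw [← convexHull_extremePoints_eq hQf]
    exact convexHull_min key hCconv
  have hVC : V ⊆ {v | v - x ∈ C} := by
    intro v hv
    by_cases hvx : v = x
    · simp [hvx]
    · show v - x ∈ C
      rw [hvq v ⟨hv, hvx⟩]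
      exact hCsmul _ _ (hg v ⟨hv, hvx⟩).le (hQC (subset_convexHull ℝ _ ⟨v, ⟨hv, hvx⟩, rfl⟩))
  have hconv : Convex ℝ {v | v - x ∈ C} := by
    intro u hu v hv a b ha hb hab
    show a • u + b • v - x ∈ C
    have : a • u + b • v - x = a • (u - x) + b • (v - x) := by
      have : x = (a + b) • x := by rw [hab, one_smul]
      nth_rewrite 1 [this]
      module
    rw [this]
    exact hCconv hu hv ha hb hab
  rw [← hPV] at hp
  exact convexHull_min hVC hconv hp

/-- If a linear functional attains a larger value on `P` than at the vertex `x`, it increases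
along an edge. -/
lemma exists_edge_lt {d : ℕ} {P : Set (Euc d)} (hP : IsPolytope P) {x : Euc d}
    (hx : x ∈ P.extremePoints ℝ) (f : Euc d →ₗ[ℝ] ℝ) {p : Euc d} (hp : p ∈ P) (h : f x < f p) :
    ∃ n, IsEdge P x n ∧ f x < f n := by
  by_contra! hcon
  have h1 := sub_mem_span_edges hP hx hp
  have h2 : f (p - x) ≤ 0 := by
    generalize p - x = w at h1 ⊢
    induction h1 using Submodule.span_induction with
    | mem v hv =>
      obtain ⟨n, hn, rfl⟩ := hv
      simpa using hcon n hn
    | zero => simp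
    | add u v _ _ hu hv => rw [map_add]; linarith
    | smul a v _ hv =>
      have : f (a • v) = (a : ℝ) * f v := by
        rw [NNReal.smul_def, map_smul, smul_eq_mul]
      rw [this]
      exact mul_nonpos_of_nonneg_of_nonpos a.2 hv
  rw [map_sub] at h2; linarith

lemma le_of_forall_edge {d : ℕ} {P : Set (Euc d)} (hP : IsPolytope P) {x : Euc d}
    (hx : x ∈ P.extremePoints ℝ) (f : Euc d →ₗ[ℝ] ℝ) (h : ∀ n, IsEdge P x n → f n ≤ f x)
    {p : Euc d} (hp : p ∈ P) : f p ≤ f x := by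
  by_contra! hlt
  obtain ⟨n, hn, hn'⟩ := exists_edge_lt hP hx f hp hlt
  exact absurd (h n hn) (not_le.2 hn')

/-- Restriction of the cone property to a face. -/
lemma exists_edge_in_face {d : ℕ} {P : Set (Euc d)} (hP : IsPolytope P) {x : Euc d}
    (hx : x ∈ P.extremePoints ℝ) (f g : Euc d →ₗ[ℝ] ℝ) (hf : ∀ n, IsEdge P x n → f n ≤ f x)
    {p : Euc d} (hp : p ∈ P) (hfp : f p = f x) (hg : g x < g p) :
    ∃ n, IsEdge P x n ∧ f n = f x ∧ g x < g n := by
  by_contra! hcon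
  have h1 := sub_mem_span_edges hP hx hp
  have h2 : f (p - x) ≤ 0 ∧ (f (p - x) = 0 → g (p - x) ≤ 0) := by
    generalize p - x = w at h1 ⊢
    induction h1 using Submodule.span_induction with
    | mem v hv =>
      obtain ⟨n, hn, rfl⟩ := hv
      refine ⟨by simpa using hf n hn, fun h0 => ?_⟩
      rw [map_sub] at h0
      simpa using hcon n hn (by linarith)
    | zero => simp
    | add u v _ _ hu hv =>
      rw [map_add, map_add]
      refine ⟨by linarith [hu.1, hv.1], fun h => ?_⟩
      have := hu.2 (by linarith [hu.1, hv.1])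
      have := hv.2 (by linarith [hu.1, hv.1])
      linarith
    | smul a v _ hv =>
      have e1 : f (a • v) = (a : ℝ) * f v := by
        rw [NNReal.smul_def, map_smul, smul_eq_mul]
      have e2 : g (a • v) = (a : ℝ) * g v := by
        rw [NNReal.smul_def, map_smul, smul_eq_mul]
      rw [e1, e2]
      refine ⟨mul_nonpos_of_nonneg_of_nonpos a.2 hv.1, fun h => ?_⟩
      rcases mul_eq_zero.1 h with h | h
      · rw [h]; simp
      · exact mul_nonpos_of_nonneg_of_nonpos a.2 (hv.2 h)
  have h3 := h2.2 (by rw [map_sub, hfp, sub_self])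
  rw [map_sub] at h3; linarith

/-- The edge graph of a polytope is connected. -/
lemma extremePoints_subset_of_edge_closed {d : ℕ} {P : Set (Euc d)} (hP : IsPolytope P)
    {W : Set (Euc d)} (hW : W ⊆ P.extremePoints ℝ) (hne : W.Nonempty)
    (hcl : ∀ x ∈ W, ∀ y, IsEdge P x y → y ∈ W) : P.extremePoints ℝ ⊆ W := by
  intro v hv
  have hv' : v ∈ (convexHull ℝ (P.extremePoints ℝ)).extremePoints ℝ := by
    rw [hP.convexHull_extremePoints]; exact hv
  obtain ⟨f, hf⟩ := exists_lt_of_mem_extremePoints hP.finite_extremePoints hv'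
  obtain ⟨m, hm, hmax⟩ := Set.exists_max_image W f (hP.finite_extremePoints.subset hW) hne
  by_cases hmv : m = v
  · rwa [← hmv]
  · obtain ⟨n, hn, hlt⟩ := exists_edge_lt hP (hW hm) f.toLinearMap hv.1 (hf m (hW hm) hmv)
    exact absurd (hmax n (hcl m hm n hn)) (not_le.2 hlt)

lemma inner_eq_sum_three (u v : Euc 3) : ⟪u, v⟫ = u 0 * v 0 + u 1 * v 1 + u 2 * v 2 := by
  simp [PiLp.inner_apply, Fin.sum_univ_three]; ring

/-- The triple product of three vectors. -/
def det3 (u v w : Euc 3) : ℝ :=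
  u 0 * (v 1 * w 2 - v 2 * w 1) - u 1 * (v 0 * w 2 - v 2 * w 0) + u 2 * (v 0 * w 1 - v 1 * w 0)

/-- The cross product. -/
def cross3 (u v : Euc 3) : Euc 3 :=
  !₂[u 1 * v 2 - u 2 * v 1, u 2 * v 0 - u 0 * v 2, u 0 * v 1 - u 1 * v 0]

lemma inner_cross3 (u v w : Euc 3) : ⟪cross3 u v, w⟫ = det3 u v w := by
  simp [inner_eq_sum_three, cross3, det3]; ring

lemma det3_add_right (u v w w' : Euc 3) : det3 u v (w + w') = det3 u v w + det3 u v w' := by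
  simp [det3]; ring

lemma det3_sub_right (u v w w' : Euc 3) : det3 u v (w - w') = det3 u v w - det3 u v w' := by
  simp [det3]; ring

lemma det3_swap (u v w : Euc 3) : det3 u w v = - det3 u v w := by
  simp [det3]; ring

lemma det3_self (u v : Euc 3) : det3 u v v = 0 := by
  simp [det3]; ring

/-- The Gram determinant identity. -/
lemma det3_mul_det3 (a b u v : Euc 3) :
    det3 a b u * det3 a b v =
      ⟪a, a⟫ * (⟪b, b⟫ * ⟪u, v⟫ - ⟪b, v⟫ * ⟪b, u⟫)
      - ⟪a, b⟫ * (⟪a, b⟫ * ⟪u, v⟫ - ⟪b, v⟫ * ⟪a, u⟫)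
      + ⟪a, v⟫ * (⟪a, b⟫ * ⟪b, u⟫ - ⟪b, b⟫ * ⟪a, u⟫) := by
  simp only [inner_eq_sum_three, det3]; ring

lemma det3_aux (n e u v : Euc 3) :
    ⟪e, u⟫ * det3 n e v - ⟪e, v⟫ * det3 n e u =
      ⟪n, e⟫ * det3 e v u + det3 n u v * ⟪e, e⟫ := by
  simp only [inner_eq_sum_three, det3]; ring

/-- A positively oriented orthonormal frame. -/
structure Frame (n e f : Euc 3) : Prop where
  ne : ⟪n, e⟫ = 0
  nf : ⟪n, f⟫ = 0
  ef : ⟪e, f⟫ = 0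
  nn : ⟪n, n⟫ = 1
  ee : ⟪e, e⟫ = 1
  ff : ⟪f, f⟫ = 1
  inner_eq : ∀ u v, ⟪u, v⟫ = ⟪n, u⟫ * ⟪n, v⟫ + ⟪e, u⟫ * ⟪e, v⟫ + ⟪f, u⟫ * ⟪f, v⟫
  det_eq : ∀ u v, det3 n u v = ⟪e, u⟫ * ⟪f, v⟫ - ⟪f, u⟫ * ⟪e, v⟫

lemma exists_frame {n u : Euc 3} (hn : ⟪n, n⟫ = 1) (hu : 0 < ⟪u, u⟫ - ⟪n, u⟫ ^ 2) :
    ∃ e f, Frame n e f ∧ ⟪f, u⟫ = 0 ∧ 0 < ⟪e, u⟫ := by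
  set ρ := Real.sqrt (⟪u, u⟫ - ⟪n, u⟫ ^ 2) with hρ
  have hρ0 : 0 < ρ := Real.sqrt_pos.2 hu
  have hρ2 : ρ ^ 2 = ⟪u, u⟫ - ⟪n, u⟫ ^ 2 := Real.sq_sqrt hu.le
  set e : Euc 3 := ρ⁻¹ • (u - ⟪n, u⟫ • n) with he
  have hne : ⟪n, e⟫ = 0 := by
    rw [he, inner_smul_right, inner_sub_right, inner_smul_right, hn]; ring
  have heu : ⟪e, u⟫ = ρ := by
    rw [he, real_inner_smul_left, inner_sub_left, real_inner_smul_left, ← pow_two, ← hρ2]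
    field_simp
  have hee : ⟪e, e⟫ = 1 := by
    nth_rewrite 2 [he]
    rw [inner_smul_right, inner_sub_right, inner_smul_right, heu, real_inner_comm n e, hne]
    field_simp; ring
  refine ⟨e, cross3 n e, ⟨hne, ?_, ?_, hn, hee, ?_, ?_, ?_⟩, ?_, by rw [heu]; exact hρ0⟩
  · rw [real_inner_comm, inner_cross3]; simp [det3]; ring
  · rw [real_inner_comm, inner_cross3]; simp [det3]; ring
  · rw [inner_cross3, show det3 n e (cross3 n e) = ⟪n, n⟫ * ⟪e, e⟫ - ⟪n, e⟫ ^ 2 by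
      simp only [inner_eq_sum_three]; simp [det3, cross3]; ring, hn, hee, hne]; ring
  · intro u v
    rw [inner_cross3, inner_cross3, det3_mul_det3, hn, hee, hne]; ring
  · intro u v
    rw [inner_cross3, inner_cross3]
    have := det3_aux n e u v
    rw [hne, hee] at this; linarith
  · rw [inner_cross3]
    have : u = ρ • e + ⟪n, u⟫ • n := by
      rw [he, smul_smul, mul_inv_cancel₀ hρ0.ne', one_smul]; abel
    rw [this]; simp [det3]; ring

lemma Frame.ext {n e f : Euc 3} (F : Frame n e f) {u v : Euc 3} (h1 : ⟪n, u⟫ = ⟪n, v⟫)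
    (h2 : ⟪e, u⟫ = ⟪e, v⟫) (h3 : ⟪f, u⟫ = ⟪f, v⟫) : u = v := by
  have h : ⟪u - v, u - v⟫ = 0 := by
    rw [F.inner_eq]; simp only [inner_sub_right, h1, h2, h3]; ring
  exact sub_eq_zero.1 (inner_self_eq_zero.1 h)

/-- `P` is a full-dimensional polytope with vertex classes `V`, `W` of squared norm `a`, `b`,
and the end points of every edge have inner product `c`. -/
structure Bip (P V W : Set (Euc 3)) (a b c : ℝ) : Prop where
  poly : IsPolytope P
  full : FullDim P
  union : V ∪ W = P.extremePoints ℝ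
  disj : Disjoint V W
  edge : ∀ x y, IsEdge P x y → (x ∈ V ∧ y ∈ W) ∨ (x ∈ W ∧ y ∈ V)
  inner_edge : ∀ x y, IsEdge P x y → ⟪x, y⟫ = c
  sqV : ∀ x ∈ V, ⟪x, x⟫ = a
  sqW : ∀ y ∈ W, ⟪y, y⟫ = b
  ca : c < a
  cb : c < b

namespace Bip

variable {P V W : Set (Euc 3)} {a b c : ℝ}

lemma symm (B : Bip P V W a b c) : Bip P W V b a c :=
  ⟨B.poly, B.full, by rw [union_comm]; exact B.union, B.disj.symm,
    fun x y h => (B.edge x y h).symm, B.inner_edge, B.sqW, B.sqV, B.cb, B.ca⟩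

lemma memV (B : Bip P V W a b c) {x : Euc 3} (hx : x ∈ V) : x ∈ P.extremePoints ℝ := by
  rw [← B.union]; exact Or.inl hx

lemma memW (B : Bip P V W a b c) {x : Euc 3} (hx : x ∈ W) : x ∈ P.extremePoints ℝ :=
  B.symm.memV hx

lemma edgeV (B : Bip P V W a b c) {x y : Euc 3} (hx : x ∈ V) (h : IsEdge P x y) : y ∈ W := by
  rcases B.edge x y h with h | h
  · exact h.2
  · exact absurd h.1 (Set.disjoint_left.1 B.disj hx)

end Bip

lemma FullDim.not_flat {P : Set (Euc 3)} (hP : FullDim P) {n : Euc 3} (hn : n ≠ 0) {h : ℝ}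
    (hh : ∀ p ∈ P, ⟪n, p⟫ = h) : False := by
  have h1 : vectorSpan ℝ P = ⊤ := by
    rw [← direction_affineSpan, hP, AffineSubspace.direction_top]
  have h2 : vectorSpan ℝ P ≤ LinearMap.ker (innerₛₗ ℝ n) := by
    rw [vectorSpan_def, Submodule.span_le]
    rintro _ ⟨p, hp, q, hq, rfl⟩
    simp [inner_sub_right, hh p hp, hh q hq]
  have h3 : n ∈ LinearMap.ker (innerₛₗ ℝ n) := h2 (by rw [h1]; trivial)
  simp at h3
  exact hn h3

lemma exists_perp (u v : Euc 3) : ∃ n : Euc 3, n ≠ 0 ∧ ⟪n, u⟫ = 0 ∧ ⟪n, v⟫ = 0 := by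
  have h := LinearMap.ker_ne_bot_of_finrank_lt (f := (innerₛₗ ℝ u).prod (innerₛₗ ℝ v)) (by simp)
  obtain ⟨n, hn, hn0⟩ := (Submodule.ne_bot_iff _).1 h
  simp at hn
  exact ⟨n, hn0, by rw [real_inner_comm]; exact hn.1, by rw [real_inner_comm]; exact hn.2⟩

/-- A vertex of a three-dimensional polytope is not covered by two edges. -/
lemma exists_third_edge {P : Set (Euc 3)} (hP : IsPolytope P) (hf : FullDim P) {x : Euc 3}
    (hx : x ∈ P.extremePoints ℝ) (y z : Euc 3) : ∃ n, IsEdge P x n ∧ n ≠ y ∧ n ≠ z := by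
  by_contra! hcon
  obtain ⟨n, hn, hy, hz⟩ := exists_perp (y - x) (z - x)
  rw [inner_sub_right] at hy hz
  have hN : ∀ m, IsEdge P x m → ⟪n, m⟫ = ⟪n, x⟫ := by
    intro m hm
    by_cases h : m = y
    · rw [h]; linarith
    · rw [hcon m hm h]; linarith
  refine hf.not_flat hn (h := ⟪n, x⟫) fun p hp => le_antisymm ?_ ?_
  · exact le_of_forall_edge hP hx (innerₛₗ ℝ n) (fun m hm => (hN m hm).le) hp
  · have := le_of_forall_edge hP hx (-innerₛₗ ℝ n) (fun m hm => by simp [hN m hm]) hp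
    simpa using this

lemma bip_of_isBipartiteWith {P V W : Set (Euc 3)} {r1 r2 l : ℝ} (hP : IsPolytope P)
    (hf : FullDim P) (h : IsBipartiteWith P V W r1 r2 l) (hr : r1 < r2) :
    Bip P V W (r1 ^ 2) (r2 ^ 2) ((r1 ^ 2 + r2 ^ 2 - l ^ 2) / 2) := by
  obtain ⟨hl, hlen, hun, hdis, hedge, h1, -, hV, hW⟩ := h
  have sqV : ∀ x ∈ V, ⟪x, x⟫ = r1 ^ 2 := fun x hx => by
    rw [real_inner_self_eq_norm_sq, hV x hx]
  have sqW : ∀ x ∈ W, ⟪x, x⟫ = r2 ^ 2 := fun x hx => by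
    rw [real_inner_self_eq_norm_sq, hW x hx]
  have hin : ∀ x y, IsEdge P x y → ⟪x, y⟫ = (r1 ^ 2 + r2 ^ 2 - l ^ 2) / 2 := by
    intro x y hxy
    have e1 := norm_sub_sq_real x y
    rw [hlen x y hxy] at e1
    rcases hedge x y hxy with ⟨hx, hy⟩ | ⟨hx, hy⟩
    · rw [hV x hx, hW y hy] at e1; linarith
    · rw [hW x hx, hV y hy] at e1; linarith
  have hne : V.Nonempty := by
    by_contra hVe
    rw [Set.not_nonempty_iff_eq_empty] at hVe
    have hex : (P.extremePoints ℝ).Nonempty := by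
      by_contra hE
      rw [Set.not_nonempty_iff_eq_empty] at hE
      have := hP.convexHull_extremePoints
      rw [hE, convexHull_empty] at this
      have h3 := hf.not_flat (n := EuclideanSpace.single 0 1) (h := 0) (by simp)
        (by rw [← this]; simp)
      exact h3
    obtain ⟨x, hx⟩ := hex
    obtain ⟨n, hn, -, -⟩ := exists_third_edge hP hf hx x x
    rcases hedge x n hn with h | h
    · rw [hVe] at h; exact h.1
    · rw [hVe] at h; exact h.2
  have hVx : ∀ x ∈ V, x ∈ P.extremePoints ℝ := fun x hx => hun ▸ Or.inl hx
  have hWx : ∀ x ∈ W, x ∈ P.extremePoints ℝ := fun x hx => hun ▸ Or.inr hx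
  obtain ⟨x, hx⟩ := hne
  obtain ⟨y, hxy, -, -⟩ := exists_third_edge hP hf (hVx x hx) x x
  have hcb : (r1 ^ 2 + r2 ^ 2 - l ^ 2) / 2 ≤ r1 * r2 := by
    rw [← hin x y hxy]
    have hy : y ∈ W := by
      rcases hedge x y hxy with h | h
      · exact h.2
      · exact absurd h.1 (Set.disjoint_left.1 hdis hx)
    rw [← hV x hx, ← hW y hy]
    exact real_inner_le_norm x y
  refine ⟨hP, hf, hun, hdis, hedge, hin, sqV, sqW, ?_, by nlinarith⟩
  by_contra! hca
  have key : ∀ w ∈ V, ∀ p ∈ V, p = w := by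
    intro w hw p hp
    have h2 := le_of_forall_edge hP (hVx w hw) (-innerₛₗ ℝ w) (fun m hm => by
      simp [hin w m hm, hV w hw]; linarith) (hVx p hp).1
    have h3 : r1 ^ 2 ≤ ⟪w, p⟫ := by
      have h4 := sqV w hw
      simp only [LinearMap.neg_apply, innerₛₗ_apply_apply] at h2
      linarith
    have h4 : ⟪p - w, p - w⟫ ≤ 0 := by
      rw [inner_sub_left, inner_sub_right, inner_sub_right, sqV p hp, sqV w hw, real_inner_comm w p]
      linarith
    exact sub_eq_zero.1 (inner_self_eq_zero.1 (le_antisymm h4 real_inner_self_nonneg))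
  have hy : y ∈ W := by
    rcases hedge x y hxy with h | h
    · exact h.2
    · exact absurd h.1 (Set.disjoint_left.1 hdis hx)
  obtain ⟨n, hn, hnx, -⟩ := exists_third_edge hP hf (hWx y hy) x x
  refine hnx (key x hx n ?_)
  rcases hedge y n hn with h | h
  · exact absurd h.1 (Set.disjoint_right.1 hdis hy)
  · exact h.2

/-- Two consecutive edges `x z`, `x y` of the facet with unit outer normal `n` and support
value `h`, in this cyclic order. -/
structure Corner (P : Set (Euc 3)) (x y z n : Euc 3) (h : ℝ) : Prop where
  exy : IsEdge P x y
  exz : IsEdge P x z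
  nn : ⟪n, n⟫ = 1
  nx : ⟪n, x⟫ = h
  ny : ⟪n, y⟫ = h
  nz : ⟪n, z⟫ = h
  sup : ∀ p ∈ P, ⟪n, p⟫ ≤ h
  det : 0 < det3 n (y - x) (z - x)

/-- A corner with unspecified normal. -/
def Cor (P : Set (Euc 3)) (x y z : Euc 3) (h : ℝ) : Prop := ∃ n, Corner P x y z n h

/-- The triple product as a linear map in its last argument. -/
def det3L (u v : Euc 3) : Euc 3 →ₗ[ℝ] ℝ := innerₛₗ ℝ (cross3 u v)

lemma det3L_apply (u v w : Euc 3) : det3L u v w = det3 u v w := by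
  simp [det3L, inner_cross3]

lemma Corner.next {P V W : Set (Euc 3)} {a b c : ℝ} (B : Bip P V W a b c) {x y z n : Euc 3} {h : ℝ}
    (C : Corner P x y z n h) (hy : y ∈ P.extremePoints ℝ) (hz : z ∈ P.extremePoints ℝ) :
    ∃ u, Corner P y u x n h := by
  obtain ⟨u, hu, h1, h2⟩ := exists_edge_in_face B.poly hy (innerₛₗ ℝ n) (-det3L n (x - y))
    (fun m hm => by
      simp only [innerₛₗ_apply_apply, C.ny]
      obtain ⟨f, hf⟩ := hm.2 ⟨y, left_mem_segment ℝ y m⟩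
      have : m ∈ segment ℝ y m := right_mem_segment ℝ y m
      rw [hf] at this
      exact C.sup m this.1) hz.1 (by simp [C.nz, C.ny])
    (by
      have := C.det
      simp only [LinearMap.neg_apply, det3L_apply]
      simp only [det3] at this ⊢
      simp at this ⊢; linarith)
  refine ⟨u, hu, C.exy.symm, C.nn, C.ny, ?_, C.nx, C.sup, ?_⟩
  · simpa [C.ny] using h1
  · simp only [LinearMap.neg_apply, det3L_apply] at h2
    simp only [det3] at h2 ⊢
    simp at h2 ⊢; linarith

lemma Corner.prev {P V W : Set (Euc 3)} {a b c : ℝ} (B : Bip P V W a b c) {x y z n : Euc 3} {h : ℝ}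
    (C : Corner P x y z n h) (hy : y ∈ P.extremePoints ℝ) (hz : z ∈ P.extremePoints ℝ) :
    ∃ u, Corner P z x u n h := by
  obtain ⟨u, hu, h1, h2⟩ := exists_edge_in_face B.poly hz (innerₛₗ ℝ n) (det3L n (x - z))
    (fun m hm => by
      simp only [innerₛₗ_apply_apply, C.nz]
      obtain ⟨f, hf⟩ := hm.2 ⟨z, left_mem_segment ℝ z m⟩
      have : m ∈ segment ℝ z m := right_mem_segment ℝ z m
      rw [hf] at this
      exact C.sup m this.1) hy.1 (by simp [C.nz, C.ny])
    (by
      have := C.det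
      simp only [det3L_apply]
      simp only [det3] at this ⊢
      simp at this ⊢; linarith)
  refine ⟨u, C.exz.symm, hu, C.nn, C.nz, C.nx, ?_, C.sup, ?_⟩
  · simpa [C.nz] using h1
  · simp only [det3L_apply] at h2
    simp only [det3] at h2 ⊢
    simp at h2 ⊢; linarith

/-- Relation between the Gram data and the triple products of three vectors `x`, `y`, `z` with
respect to a unit vector `n`. -/
lemma det3_relation {n : Euc 3} (hn : ⟪n, n⟫ = 1) (x y z : Euc 3) :
    (⟪x, x⟫ - ⟪n, x⟫ ^ 2) * det3 n y z =
      (⟪x, y⟫ - ⟪n, x⟫ * ⟪n, y⟫) * det3 n x z - det3 n x y * (⟪x, z⟫ - ⟪n, x⟫ * ⟪n, z⟫) := by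
  have h1 := det3_aux n x y z
  have h2 : ⟪n, y⟫ * det3 n x z - ⟪n, z⟫ * det3 n x y =
      ⟪n, x⟫ * det3 n y z - det3 x y z * ⟪n, n⟫ := by
    simp only [inner_eq_sum_three, det3]; ring
  have h3 : det3 x z y = - det3 x y z := by simp [det3]; ring
  rw [h3] at h1
  rw [hn] at h2
  linear_combination ⟪n, x⟫ * h2 - h1

lemma det3_sq {n : Euc 3} (hn : ⟪n, n⟫ = 1) (x y : Euc 3) :
    det3 n x y ^ 2 + (⟪x, y⟫ - ⟪n, x⟫ * ⟪n, y⟫) ^ 2 =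
      (⟪x, x⟫ - ⟪n, x⟫ ^ 2) * (⟪y, y⟫ - ⟪n, y⟫ ^ 2) := by
  have := det3_mul_det3 n x y y
  rw [hn] at this
  linear_combination this

/-- In the plane `⟪n, ·⟫ = h`, a point is determined by its inner product and triple product with
a given point off the normal line. -/
lemma eq_of_inner_det {n x u v : Euc 3} (hn : ⟪n, n⟫ = 1) (hx : 0 < ⟪x, x⟫ - ⟪n, x⟫ ^ 2)
    (h1 : ⟪n, u⟫ = ⟪n, v⟫) (h2 : ⟪x, u⟫ = ⟪x, v⟫) (h3 : det3 n x u = det3 n x v) : u = v := by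
  obtain ⟨e, f, F, hf, he⟩ := exists_frame hn hx
  refine F.ext h1 ?_ ?_
  · have e1 := F.inner_eq x u
    have e2 := F.inner_eq x v
    rw [hf] at e1 e2
    rw [h1] at e1
    have : ⟪e, x⟫ * ⟪e, u⟫ = ⟪e, x⟫ * ⟪e, v⟫ := by linarith
    exact mul_left_cancel₀ he.ne' this
  · rw [F.det_eq, F.det_eq, hf] at h3
    have : ⟪e, x⟫ * ⟪f, u⟫ = ⟪e, x⟫ * ⟪f, v⟫ := by linarith
    exact mul_left_cancel₀ he.ne' this

namespace Bip

variable {P V W : Set (Euc 3)} {a b c : ℝ}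

lemma corner_yW (B : Bip P V W a b c) {x y z n : Euc 3} {h : ℝ} (hx : x ∈ V)
    (C : Corner P x y z n h) : y ∈ W := B.edgeV hx C.exy

lemma corner_zW (B : Bip P V W a b c) {x y z n : Euc 3} {h : ℝ} (hx : x ∈ V)
    (C : Corner P x y z n h) : z ∈ W := B.edgeV hx C.exz

lemma height_lt (B : Bip P V W a b c) {x y n : Euc 3} {h : ℝ} (hx : x ∈ V) (hn : ⟪n, n⟫ = 1)
    (hnx : ⟪n, x⟫ = h) (hny : ⟪n, y⟫ = h) (hy : y ∈ W) (hxy : ⟪x, y⟫ = c) : h ^ 2 < a := by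
  have hxx := B.sqV x hx
  by_contra hcon
  have h1 := det3_sq hn x x
  have h2 := det3_sq hn x y
  rw [det3_self, hxx, hnx] at h1
  rw [hxx, hxy, hnx, hny, B.sqW y hy] at h2
  have e : ⟪x - h • n, x - h • n⟫ = a - h ^ 2 := by
    simp only [inner_sub_left, inner_sub_right, real_inner_smul_left, inner_smul_right, hxx, hnx,
      real_inner_comm n x, hn]; ring
  have e0 : a - h ^ 2 = 0 := le_antisymm (by linarith) (e ▸ real_inner_self_nonneg)
  rw [e0] at h2
  have : c - h ^ 2 = 0 := by nlinarith [sq_nonneg (det3 n x y), sq_nonneg (c - h * h)]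
  linarith [B.ca]

lemma corner_lt (B : Bip P V W a b c) {x y z n : Euc 3} {h : ℝ} (hx : x ∈ V)
    (C : Corner P x y z n h) : h ^ 2 < a :=
  B.height_lt hx C.nn C.nx C.ny (B.corner_yW hx C) (B.inner_edge _ _ C.exy)

lemma corner_lt' (B : Bip P V W a b c) {x y z n : Euc 3} {h : ℝ} (hx : x ∈ V)
    (C : Corner P x y z n h) : h ^ 2 < b :=
  B.symm.height_lt (B.corner_yW hx C) C.nn C.ny C.nx hx (B.inner_edge _ _ C.exy.symm)

lemma corner_det (B : Bip P V W a b c) {x y z n : Euc 3} {h : ℝ} (hx : x ∈ V)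
    (C : Corner P x y z n h) :
    0 < det3 n x y ∧ det3 n x z = - det3 n x y ∧
      det3 n x y ^ 2 = (a - h ^ 2) * (b - h ^ 2) - (c - h ^ 2) ^ 2 := by
  have h1 := det3_sq C.nn x y
  have h2 := det3_sq C.nn x z
  have h3 := det3_relation C.nn x y z
  rw [B.sqV x hx, B.inner_edge x y C.exy, C.nx, C.ny] at h1 h3
  rw [B.sqV x hx, C.nx, C.nz, B.inner_edge x z C.exz, B.sqW z (B.corner_zW hx C)] at h2
  rw [B.inner_edge x z C.exz, C.nz] at h3
  rw [B.sqW y (B.corner_yW hx C)] at h1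
  have hlt := B.corner_lt hx C
  have hd := C.det
  have e1 : det3 n (y - x) (z - x) = det3 n y z + det3 n x y - det3 n x z := by
    simp [det3]; ring
  rw [e1] at hd
  have hca := B.ca
  have hne : det3 n x y ≠ det3 n x z := by
    intro heq
    rw [← heq] at h3
    have : (a - h ^ 2) * det3 n y z = 0 := by linarith
    rcases mul_eq_zero.1 this with h' | h'
    · linarith
    · rw [h', heq] at hd; linarith
  have hsq : (det3 n x y - det3 n x z) * (det3 n x y + det3 n x z) = 0 := by linarith
  have hneg : det3 n x z = - det3 n x y := by
    rcases mul_eq_zero.1 hsq with h' | h'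
    · exact absurd (sub_eq_zero.1 h') hne
    · linarith
  refine ⟨?_, hneg, by linarith⟩
  rw [hneg] at h3 hd
  by_contra hs
  have h5 : 0 < (a - h ^ 2) * (det3 n y z + 2 * det3 n x y) := by
    apply mul_pos <;> linarith
  have h6 : (a - h ^ 2) * (det3 n y z + 2 * det3 n x y) = 2 * (a - c) * det3 n x y := by
    linear_combination h3
  rw [h6] at h5
  nlinarith

/-- The normal of a facet is determined by one of its edges and its side. -/
lemma normal_unique {P : Set (Euc 3)} (hf : FullDim P) {n n' e z z' : Euc 3} {h h' : ℝ}
    {x : Euc 3} (hn : ⟪n, n⟫ = 1) (hn' : ⟪n', n'⟫ = 1) (he : ⟪n, e⟫ = 0) (he' : ⟪n', e⟫ = 0)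
    (hnx : ⟪n, x⟫ = h) (hnx' : ⟪n', x⟫ = h') (hnz : ⟪n, z⟫ = h) (hnz' : ⟪n', z'⟫ = h')
    (hz : ⟪n', z⟫ ≤ h') (hz' : ⟪n, z'⟫ ≤ h) (hs : ∀ p ∈ P, ⟪n, p⟫ ≤ h)
    (hs' : ∀ p ∈ P, ⟪n', p⟫ ≤ h') (hd : 0 < det3 n e (z - x)) (hd' : 0 < det3 n' e (z' - x)) :
    n = n' := by
  have e1 := det3_mul_det3 n e (z - x) n'
  have e2 := det3_mul_det3 n' e (z' - x) n
  have he1 : ⟪e, n'⟫ = 0 := by rw [real_inner_comm]; exact he'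
  have he2 : ⟪e, n⟫ = 0 := by rw [real_inner_comm]; exact he
  have hee : 0 ≤ ⟪e, e⟫ := real_inner_self_nonneg
  rw [hn, he, he1, inner_sub_left, inner_sub_right n, hnx, hnz, real_inner_comm,
    real_inner_comm n' x,
    hnx'] at e1
  rw [hn', he', he2, inner_sub_left, inner_sub_right n', hnx', hnz', real_inner_comm,
    real_inner_comm n x, hnx] at e2
  have e3 : det3 n' e n = - det3 n e n' := by simp [det3]; ring
  have l1 : det3 n e n' ≤ 0 := by
    by_contra hc
    have := mul_pos hd (not_le.1 hc)
    rw [e1] at this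
    rw [real_inner_comm] at hz
    nlinarith [mul_nonneg hee (sub_nonneg.2 hz)]
  have l2 : 0 ≤ det3 n e n' := by
    by_contra hc
    have := mul_pos hd' (by rw [e3]; linarith : 0 < det3 n' e n)
    rw [e2] at this
    rw [real_inner_comm] at hz'
    nlinarith [mul_nonneg hee (sub_nonneg.2 hz')]
  have l0 := le_antisymm l1 l2
  have e4 := det3_mul_det3 n e n' n'
  rw [l0, hn, he, he1, hn'] at e4
  have he0 : ⟪e, e⟫ ≠ 0 := by
    intro h0
    rw [inner_self_eq_zero.1 h0] at hd
    simp [det3] at hd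
  have e5 : (⟪n, n'⟫ - 1) * (⟪n, n'⟫ + 1) = 0 := by
    have : ⟪e, e⟫ * ((⟪n, n'⟫ - 1) * (⟪n, n'⟫ + 1)) = 0 := by linarith
    exact (mul_eq_zero.1 this).resolve_left he0
  rcases mul_eq_zero.1 e5 with h0 | h0
  · have : ⟪n - n', n - n'⟫ = 0 := by
      rw [inner_sub_left, inner_sub_right, inner_sub_right, hn, hn', real_inner_comm n n']; linarith
    exact sub_eq_zero.1 (inner_self_eq_zero.1 this)
  · exfalso
    have : ⟪n + n', n + n'⟫ = 0 := by
      rw [inner_add_left, inner_add_right, inner_add_right, hn, hn', real_inner_comm n n']; linarith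
    have hnn : n' = -n := (neg_eq_of_add_eq_zero_right (inner_self_eq_zero.1 this)).symm
    have hh : h' = -h := by rw [← hnx', ← hnx, hnn, inner_neg_left]
    refine hf.not_flat (n := n) (h := h) (fun h0 => by rw [h0] at hn; simp at hn)
      fun p hp => le_antisymm (hs p hp) ?_
    have := hs' p hp
    rw [hnn, inner_neg_left, hh] at this
    linarith

lemma edge_mem {P : Set (Euc 3)} {x y : Euc 3} (h : IsEdge P x y) : x ∈ P ∧ y ∈ P := by
  obtain ⟨f, hf⟩ := h.2 ⟨x, left_mem_segment ℝ x y⟩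
  have h1 := left_mem_segment ℝ x y
  have h2 := right_mem_segment ℝ x y
  rw [hf] at h1 h2
  exact ⟨h1.1, h2.1⟩

lemma cor_unique_right (B : Bip P V W a b c) {x y z z' : Euc 3} {h h' : ℝ} (hx : x ∈ V)
    (C : Cor P x y z h) (C' : Cor P x y z' h') : z = z' ∧ h = h' := by
  obtain ⟨n, C⟩ := C
  obtain ⟨n', C'⟩ := C'
  have hnn : n = n' := normal_unique B.full (e := y - x) (x := x) (z := z) (z' := z') C.nn C'.nn
    (by rw [inner_sub_right, C.nx, C.ny, sub_self])
    (by rw [inner_sub_right, C'.nx, C'.ny, sub_self]) C.nx C'.nx C.nz C'.nz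
    (C'.sup z (edge_mem C.exz).2) (C.sup z' (edge_mem C'.exz).2) C.sup C'.sup C.det C'.det
  subst hnn
  have hh : h = h' := by rw [← C.nx, ← C'.nx]
  subst hh
  refine ⟨?_, rfl⟩
  refine eq_of_inner_det C.nn (x := x) ?_ (by rw [C.nz, C'.nz])
    (by rw [B.inner_edge _ _ C.exz, B.inner_edge _ _ C'.exz])
    (by rw [(B.corner_det hx C).2.1, (B.corner_det hx C').2.1])
  rw [C.nx, B.sqV x hx]; linarith [B.corner_lt hx C]

lemma cor_unique_left (B : Bip P V W a b c) {x y y' z : Euc 3} {h h' : ℝ} (hx : x ∈ V)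
    (C : Cor P x y z h) (C' : Cor P x y' z h') : y = y' ∧ h = h' := by
  obtain ⟨n, C⟩ := C
  obtain ⟨n', C'⟩ := C'
  have hneg : ∀ m w : Euc 3, det3 m (x - z) (w - x) = det3 m (w - x) (z - x) := by
    intro m w; simp [det3]; ring
  have hnn : n = n' := normal_unique B.full (e := x - z) (x := x) (z := y) (z' := y') C.nn C'.nn
    (by rw [inner_sub_right, C.nx, C.nz, sub_self])
    (by rw [inner_sub_right, C'.nx, C'.nz, sub_self]) C.nx C'.nx C.ny C'.ny
    (C'.sup y (edge_mem C.exy).2) (C.sup y' (edge_mem C'.exy).2) C.sup C'.sup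
    (by rw [hneg]; exact C.det) (by rw [hneg]; exact C'.det)
  subst hnn
  have hh : h = h' := by rw [← C.nx, ← C'.nx]
  subst hh
  refine ⟨?_, rfl⟩
  have e1 := (B.corner_det hx C).2.1
  have e2 := (B.corner_det hx C').2.1
  refine eq_of_inner_det C.nn (x := x) ?_ (by rw [C.ny, C'.ny])
    (by rw [B.inner_edge _ _ C.exy, B.inner_edge _ _ C'.exy]) (by linarith)
  rw [C.nx, B.sqV x hx]; linarith [B.corner_lt hx C]

lemma cor_next (B : Bip P V W a b c) {x y z : Euc 3} {h : ℝ} (hx : x ∈ V) (C : Cor P x y z h) :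
    ∃ u, Cor P y u x h := by
  obtain ⟨n, C⟩ := C
  obtain ⟨u, hu⟩ := C.next B (B.memW (B.corner_yW hx C)) (B.memW (B.corner_zW hx C))
  exact ⟨u, n, hu⟩

lemma cor_prev (B : Bip P V W a b c) {x y z : Euc 3} {h : ℝ} (hx : x ∈ V) (C : Cor P x y z h) :
    ∃ u, Cor P z x u h := by
  obtain ⟨n, C⟩ := C
  obtain ⟨u, hu⟩ := C.prev B (B.memW (B.corner_yW hx C)) (B.memW (B.corner_zW hx C))
  exact ⟨u, n, hu⟩

/-- A facet with `h² = c` is a rhombus. -/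
lemma corner_rhombus (B : Bip P V W a b c) {x y z n : Euc 3} {h : ℝ} (hx : x ∈ V)
    (C : Corner P x y z n h) (hc : h ^ 2 = c) : Corner P y (y + z - x) x n h := by
  obtain ⟨u, Cu⟩ := C.next B (B.memW (B.corner_yW hx C)) (B.memW (B.corner_zW hx C))
  have hy := B.corner_yW hx C
  have hlt := B.corner_lt hx C
  have hlt' := B.corner_lt' hx C
  obtain ⟨s0, s1, s2⟩ := B.corner_det hx C
  obtain ⟨t0, t1, t2⟩ := B.symm.corner_det hy Cu
  have hxx : ⟪x, x⟫ - ⟪n, x⟫ ^ 2 = a - h ^ 2 := by rw [B.sqV x hx, C.nx]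
  have hyy : ⟪y, y⟫ - ⟪n, y⟫ ^ 2 = b - h ^ 2 := by rw [B.sqW y hy, C.ny]
  have r1 := det3_relation C.nn x y z
  rw [hxx, B.inner_edge _ _ C.exy, B.inner_edge _ _ C.exz, C.nx, C.ny, C.nz, ← pow_two, hc,
    sub_self, zero_mul, mul_zero, sub_zero] at r1
  have dyz : det3 n y z = 0 := (mul_eq_zero.1 r1).resolve_left (by linarith)
  have h1 := det3_sq C.nn y z
  have iyz : ⟪y, z⟫ = 2 * c - b := by
    have q1 : ⟪n, z⟫ = h := C.nz
    obtain ⟨e, f, F, hf, he⟩ := exists_frame C.nn (u := x) (by rw [hxx]; linarith)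
    have d1 := F.det_eq x y
    have d2 := F.det_eq x z
    have i1 := F.inner_eq x y
    have i2 := F.inner_eq x z
    have i3 := F.inner_eq y y
    have i4 := F.inner_eq y z
    rw [B.inner_edge _ _ C.exy, C.nx, C.ny, hf, ← pow_two, hc] at i1
    rw [B.inner_edge _ _ C.exz, C.nx, C.nz, hf, ← pow_two, hc] at i2
    rw [hf] at d1 d2
    have z1 : ⟪e, y⟫ = 0 := by
      have : ⟪e, x⟫ * ⟪e, y⟫ = 0 := by linarith
      exact (mul_eq_zero.1 this).resolve_left he.ne'
    have z2 : ⟪f, z⟫ = - ⟪f, y⟫ := by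
      have : ⟪e, x⟫ * ⟪f, z⟫ = ⟪e, x⟫ * (- ⟪f, y⟫) := by linarith
      exact mul_left_cancel₀ he.ne' this
    rw [B.sqW y hy, C.ny, z1] at i3
    rw [C.ny, C.nz, z1, z2] at i4
    rw [i4]; linarith
  have hu : u = y + z - x := by
    refine eq_of_inner_det C.nn (x := y) (by rw [hyy]; linarith) ?_ ?_ ?_
    · rw [inner_sub_right, inner_add_right, C.ny, C.nz, C.nx, Cu.ny]; ring
    · rw [inner_sub_right, inner_add_right, B.sqW y hy, iyz, B.inner_edge _ _ Cu.exy,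
        B.inner_edge _ _ C.exy.symm]; ring
    · rw [det3_sub_right, det3_add_right, det3_self, dyz]
      linarith
  rw [← hu]; exact Cu

lemma cor_rhombus (B : Bip P V W a b c) {x y z : Euc 3} {h : ℝ} (hx : x ∈ V)
    (C : Cor P x y z h) (hc : h ^ 2 = c) :
    y + z - x ∈ V ∧ Cor P y (y + z - x) x h ∧ Cor P (y + z - x) z y h ∧
      Cor P z x (y + z - x) h := by
  obtain ⟨n, C⟩ := C
  have h1 := B.corner_rhombus hx C hc
  have hy := B.corner_yW hx C
  have hu : y + z - x ∈ V := B.symm.corner_yW hy h1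
  have h2 := B.symm.corner_rhombus hy h1 hc
  rw [show y + z - x + x - y = z by abel] at h2
  have h3 := B.corner_rhombus hu h2 hc
  rw [show z + y - (y + z - x) = x by abel] at h3
  exact ⟨hu, ⟨n, h1⟩, ⟨n, h2⟩, ⟨n, h3⟩⟩

end Bip

namespace Bip

variable {P V W : Set (Euc 3)} {a b c : ℝ}

/-- A vertex has exactly two neighbours in a facet containing it. -/
lemma eq_or_eq_of_edge (B : Bip P V W a b c) {x y z n m : Euc 3} {h : ℝ} (hx : x ∈ V)
    (C : Corner P x y z n h) (hm : IsEdge P x m) (hnm : ⟪n, m⟫ = h) : m = y ∨ m = z := by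
  have hxx : 0 < ⟪x, x⟫ - ⟪n, x⟫ ^ 2 := by
    rw [B.sqV x hx, C.nx]; linarith [B.corner_lt hx C]
  obtain ⟨s0, s1, s2⟩ := B.corner_det hx C
  have h1 := det3_sq C.nn x m
  rw [B.sqV x hx, B.inner_edge x m hm, C.nx, hnm, B.sqW m (B.edgeV hx hm)] at h1
  have h2 : (det3 n x m - det3 n x y) * (det3 n x m + det3 n x y) = 0 := by linarith
  rcases mul_eq_zero.1 h2 with h3 | h3
  · left
    refine eq_of_inner_det C.nn hxx (by rw [hnm, C.ny]) ?_ (by linarith)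
    rw [B.inner_edge x m hm, B.inner_edge x y C.exy]
  · right
    refine eq_of_inner_det C.nn hxx (by rw [hnm, C.nz]) ?_ (by linarith)
    rw [B.inner_edge x m hm, B.inner_edge x z C.exz]

/-- The facet lies on one side of each of its edges. -/
lemma det_nonneg (B : Bip P V W a b c) {x y z n q : Euc 3} {h : ℝ} (hx : x ∈ V)
    (C : Corner P x y z n h) (hq : q ∈ P) (hnq : ⟪n, q⟫ = h) :
    0 ≤ det3 n (y - x) (q - x) ∧ 0 ≤ det3 n (q - x) (z - x) := by
  have hle : ∀ m, IsEdge P x m → innerₛₗ ℝ n m ≤ innerₛₗ ℝ n x := fun m hm => by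
    simp only [innerₛₗ_apply_apply, C.nx]; exact C.sup m (edge_mem hm).2
  have hd := C.det
  constructor
  · by_contra! hcon
    rw [det3_sub_right] at hcon hd
    obtain ⟨m, hm, h1, h2⟩ := exists_edge_in_face B.poly (B.memV hx) (innerₛₗ ℝ n)
      (-det3L n (y - x)) hle hq (by simp [C.nx, hnq]) (by
        simp only [LinearMap.neg_apply, det3L_apply]; linarith)
    simp only [LinearMap.neg_apply, det3L_apply] at h2
    rcases B.eq_or_eq_of_edge hx C hm (by simpa [C.nx] using h1) with rfl | rfl
    · have := det3_self n (m - x)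
      rw [det3_sub_right] at this; linarith
    · linarith
  · by_contra! hcon
    rw [det3_swap, det3_sub_right] at hcon hd
    obtain ⟨m, hm, h1, h2⟩ := exists_edge_in_face B.poly (B.memV hx) (innerₛₗ ℝ n)
      (det3L n (z - x)) hle hq (by simp [C.nx, hnq]) (by
        simp only [det3L_apply]; linarith)
    simp only [det3L_apply] at h2
    rcases B.eq_or_eq_of_edge hx C hm (by simpa [C.nx] using h1) with rfl | rfl
    · linarith
    · have := det3_self n (m - x)
      rw [det3_sub_right] at this; linarith

end Bip

lemma Frame.polar_step {n e f u v : Euc 3} (F : Frame n e f) {r r' t θ : ℝ} (hr : 0 < r)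
    (h1 : ⟪e, u⟫ = r * Real.cos t) (h2 : ⟪f, u⟫ = r * Real.sin t)
    (h3 : ⟪u, v⟫ - ⟪n, u⟫ * ⟪n, v⟫ = r * r' * Real.cos θ)
    (h4 : det3 n u v = r * r' * Real.sin θ) :
    ⟪e, v⟫ = r' * Real.cos (t + θ) ∧ ⟪f, v⟫ = r' * Real.sin (t + θ) := by
  rw [F.inner_eq, h1, h2] at h3
  rw [F.det_eq, h1, h2] at h4
  have hs := Real.sin_sq_add_cos_sq t
  rw [Real.cos_add, Real.sin_add]
  have e3 : Real.cos t * ⟪e, v⟫ + Real.sin t * ⟪f, v⟫ = r' * Real.cos θ :=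
    mul_left_cancel₀ hr.ne' (by linarith)
  have e4 : Real.cos t * ⟪f, v⟫ - Real.sin t * ⟪e, v⟫ = r' * Real.sin θ :=
    mul_left_cancel₀ hr.ne' (by linarith)
  constructor
  · linear_combination Real.cos t * e3 - Real.sin t * e4 - ⟪e, v⟫ * hs
  · linear_combination Real.sin t * e3 + Real.cos t * e4 - ⟪f, v⟫ * hs

lemma arc_exclusion {r r' θ β : ℝ} (hr : 0 < r) (hrr : r < r') (hβ0 : 0 ≤ β) (hβ : β < θ)
    (hθ : θ < Real.pi) :
    r * r' * Real.sin θ - r * r' * Real.sin β - r' * r' * Real.sin (θ - β) < 0 := by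
  have e1 := Real.sin_sub_sin θ β
  have e2 : Real.sin (θ - β) = 2 * Real.sin ((θ - β) / 2) * Real.cos ((θ - β) / 2) := by
    rw [← Real.sin_two_mul]; congr 1; ring
  have hs : 0 < Real.sin ((θ - β) / 2) := Real.sin_pos_of_pos_of_lt_pi (by linarith) (by linarith)
  have hc : 0 < Real.cos ((θ - β) / 2) := Real.cos_pos_of_mem_Ioo ⟨by linarith, by linarith⟩
  have hle : Real.cos ((θ + β) / 2) ≤ Real.cos ((θ - β) / 2) :=
    Real.cos_le_cos_of_nonneg_of_le_pi (by linarith) (by linarith) (by linarith)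
  have h1 : r * Real.cos ((θ + β) / 2) < r' * Real.cos ((θ - β) / 2) := by nlinarith
  have h2 := mul_pos (mul_pos (hr.trans hrr) hs) (sub_pos.2 h1)
  calc _ = r * r' * (Real.sin θ - Real.sin β) - r' * r' * Real.sin (θ - β) := by ring
    _ = - (2 * (r' * Real.sin ((θ - β) / 2) *
        (r' * Real.cos ((θ - β) / 2) - r * Real.cos ((θ + β) / 2)))) := by rw [e1, e2]; ring
    _ < 0 := by linarith

namespace Bip

variable {P V W : Set (Euc 3)} {a b c : ℝ}

/-- The facet angle seen from the foot point of the facet normal is `π / k`. -/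
lemma cor_angle (B : Bip P V W a b c) (hab : a < b) {x y z : Euc 3} {h : ℝ} (hx : x ∈ V)
    (C : Cor P x y z h) :
    ∃ k : ℕ, 2 ≤ k ∧
      c - h ^ 2 = Real.sqrt ((a - h ^ 2) * (b - h ^ 2)) * Real.cos (Real.pi / k) := by
  obtain ⟨n, C⟩ := C
  have ha := B.corner_lt hx C
  have hb := B.corner_lt' hx C
  obtain ⟨s0, s1, s2⟩ := B.corner_det hx C
  set r := Real.sqrt (a - h ^ 2) with hr
  set r' := Real.sqrt (b - h ^ 2) with hr'
  have hr0 : 0 < r := Real.sqrt_pos.2 (by linarith)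
  have hr0' : 0 < r' := Real.sqrt_pos.2 (by linarith)
  have hrr : r < r' := Real.sqrt_lt_sqrt (by linarith) (by linarith)
  have r2 : r ^ 2 = a - h ^ 2 := Real.sq_sqrt (by linarith)
  have r2' : r' ^ 2 = b - h ^ 2 := Real.sq_sqrt (by linarith)
  have hrr' : Real.sqrt ((a - h ^ 2) * (b - h ^ 2)) = r * r' :=
    Real.sqrt_mul (by linarith) _
  rw [hrr']
  set q := (c - h ^ 2) / (r * r') with hq
  have hq1 : c - h ^ 2 = r * r' * q := by rw [hq]; field_simp
  have s3 : det3 n x y ^ 2 = (r * r') ^ 2 * (1 - q ^ 2) := by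
    rw [s2, hq1, ← r2, ← r2']; ring
  have hq2 : q ^ 2 < 1 := by
    have : 0 < (r * r') ^ 2 * (1 - q ^ 2) := s3 ▸ pow_pos s0 2
    have := pos_of_mul_pos_right this (by positivity)
    linarith
  have hqb := abs_lt.1 ((sq_lt_one_iff_abs_lt_one q).1 hq2)
  set θ := Real.arccos q with hθ
  have hθ0 : 0 < θ := Real.arccos_pos.2 hqb.2
  have hθπ : θ < Real.pi := by
    refine lt_of_le_of_ne (Real.arccos_le_pi q) fun h => ?_
    have := Real.arccos_eq_pi.1 h; linarith
  have hcos : Real.cos θ = q := Real.cos_arccos hqb.1.le hqb.2.le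
  have hsin0 : 0 < Real.sin θ := Real.sin_pos_of_pos_of_lt_pi hθ0 hθπ
  have hS : ∀ S, 0 < S → S ^ 2 = (a - h ^ 2) * (b - h ^ 2) - (c - h ^ 2) ^ 2 →
      S = r * r' * Real.sin θ := by
    intro S hS0 hS2
    have : S ^ 2 = (r * r' * Real.sin θ) ^ 2 := by
      rw [hS2, hq1, ← r2, ← r2', mul_pow _ (Real.sin θ), Real.sin_sq, hcos]; ring
    exact (pow_left_inj₀ hS0.le (by positivity) two_ne_zero).1 this
  have hc' : c - h * h = r * r' * Real.cos θ := by rw [hcos, ← hq1]; ring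
  obtain ⟨e, f, F, hf, he⟩ := exists_frame C.nn (u := x)
    (by rw [B.sqV x hx, C.nx]; linarith)
  have hex : ⟪e, x⟫ = r := by
    have h1 := F.inner_eq x x
    rw [B.sqV x hx, C.nx, hf] at h1
    exact (pow_left_inj₀ he.le hr0.le two_ne_zero).1 (by rw [r2]; linarith)
  -- polar coordinates of the neighbours in the facet
  have stepV : ∀ u v w t, u ∈ V → Corner P u v w n h → ⟪e, u⟫ = r * Real.cos t →
      ⟪f, u⟫ = r * Real.sin t → (⟪e, v⟫ = r' * Real.cos (t + θ) ∧ ⟪f, v⟫ = r' * Real.sin (t + θ)) ∧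
      (⟪e, w⟫ = r' * Real.cos (t + -θ) ∧ ⟪f, w⟫ = r' * Real.sin (t + -θ)) := by
    intro u v w t hu Cu h1 h2
    obtain ⟨t0, t1, t2⟩ := B.corner_det hu Cu
    refine ⟨F.polar_step hr0 h1 h2 ?_ (hS _ t0 t2), F.polar_step hr0 h1 h2 ?_ ?_⟩
    · rw [B.inner_edge _ _ Cu.exy, Cu.nx, Cu.ny, hc']
    · rw [B.inner_edge _ _ Cu.exz, Cu.nx, Cu.nz, hc', Real.cos_neg]
    · rw [t1, hS _ t0 t2, Real.sin_neg]; ring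
  have stepW : ∀ u v w t, u ∈ W → Corner P u v w n h → ⟪e, u⟫ = r' * Real.cos t →
      ⟪f, u⟫ = r' * Real.sin t → ⟪e, v⟫ = r * Real.cos (t + θ) ∧ ⟪f, v⟫ = r * Real.sin (t + θ) := by
    intro u v w t hu Cu h1 h2
    obtain ⟨t0, t1, t2⟩ := B.symm.corner_det hu Cu
    refine F.polar_step hr0' h1 h2 ?_ ?_
    · rw [B.inner_edge _ _ Cu.exy, Cu.nx, Cu.ny, hc']; ring
    · rw [hS _ t0 (by rw [t2]; ring)]; ring
  have walk : ∀ m : ℕ, ∃ u v w, u ∈ V ∧ Corner P u v w n h ∧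
      ⟪e, u⟫ = r * Real.cos (2 * m * θ) ∧ ⟪f, u⟫ = r * Real.sin (2 * m * θ) := by
    intro m
    induction m with
    | zero => exact ⟨x, y, z, hx, C, by simp [hex], by simp [hf]⟩
    | succ m ih =>
      obtain ⟨u, v, w, hu, Cu, h1, h2⟩ := ih
      have hv := B.corner_yW hu Cu
      obtain ⟨v', Cv⟩ := Cu.next B (B.memW hv) (B.memW (B.corner_zW hu Cu))
      have hv' := B.symm.corner_yW hv Cv
      obtain ⟨w', Cw⟩ := Cv.next B (B.memV hv') (B.memV (B.symm.corner_zW hv Cv))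
      obtain ⟨⟨p1, p2⟩, -⟩ := stepV _ _ _ _ hu Cu h1 h2
      obtain ⟨p3, p4⟩ := stepW _ _ _ _ hv Cv p1 p2
      have e1 : 2 * ((m + 1 : ℕ) : ℝ) * θ = 2 * m * θ + θ + θ := by push_cast; ring
      exact ⟨v', w', v, hv', Cw, by rw [p3, e1], by rw [p4, e1]⟩
  have excl : ∀ p ∈ W, ∀ β, ⟪n, p⟫ = h → ⟪e, p⟫ = r' * Real.cos β → ⟪f, p⟫ = r' * Real.sin β →
      -θ < β → β < θ → False := by
    intro p hp β hnp h1 h2 hβ hβ'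
    obtain ⟨d1, d2⟩ := B.det_nonneg hx C (B.memW hp).1 hnp
    obtain ⟨⟨p1, p2⟩, p3, p4⟩ := stepV _ _ _ 0 hx C (by simp [hex]) (by simp [hf])
    rw [F.det_eq] at d1 d2
    simp only [inner_sub_right, hex, hf, h1, h2, p1, p2, p3, p4, zero_add, Real.cos_neg,
      Real.sin_neg] at d1 d2
    rcases le_or_gt 0 β with h0 | h0
    · have := arc_exclusion hr0 hrr h0 hβ' hθπ
      rw [Real.sin_sub] at this
      linarith
    · have := arc_exclusion (β := -β) hr0 hrr (by linarith) (by linarith) hθπ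
      rw [Real.sin_sub, Real.cos_neg, Real.sin_neg] at this
      linarith
  set k := ⌈Real.pi / θ⌉₊ with hk
  have hk1 : Real.pi ≤ k * θ := (div_le_iff₀ hθ0).1 (Nat.le_ceil _)
  have hk0 : 1 ≤ k := Nat.one_le_iff_ne_zero.2 fun h0 => by
    rw [h0] at hk1; simp at hk1; linarith [Real.pi_pos]
  have hk2 : (k - 1 : ℝ) * θ < Real.pi := by
    rw [← lt_div_iff₀ hθ0]
    have := Nat.ceil_lt_add_one (div_pos Real.pi_pos hθ0).le
    rw [← hk] at this; linarith
  have hkθ : k * θ = Real.pi := by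
    by_contra hne
    have hlt := lt_of_le_of_ne hk1 (Ne.symm hne)
    obtain ⟨u, v, w, hu, Cu, h1, h2⟩ := walk k
    obtain ⟨-, p1, p2⟩ := stepV _ _ _ _ hu Cu h1 h2
    refine excl w (B.corner_zW hu Cu) (2 * k * θ + -θ - 2 * Real.pi) Cu.nz ?_ ?_ (by linarith)
      (by linarith)
    · rw [p1, Real.cos_sub_two_pi]
    · rw [p2, Real.sin_sub_two_pi]
  have hkpos : (0 : ℝ) < k := by exact_mod_cast hk0
  refine ⟨k, ?_, ?_⟩
  · by_contra hlt
    have : k = 1 := by omega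
    rw [this] at hkθ; simp at hkθ; linarith
  · rw [show Real.pi / k = θ by rw [← hkθ]; field_simp, hcos, hq1]

end Bip

/-- The dihedral angle at the ray through a vertex of squared norm `a` subtended by a facet with
support value `h`, where the neighbours have squared norm `b` and inner product `c` with it. -/
def vertexAngle (a b c h : ℝ) : ℝ :=
  2 * Real.arccos ((a - c) * h / Real.sqrt ((a * b - c ^ 2) * (a - h ^ 2)))

lemma Frame.rotate {n e f : Euc 3} (F : Frame n e f) (t : ℝ) :
    Frame n (Real.cos t • e + Real.sin t • f) (-Real.sin t • e + Real.cos t • f) := by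
  have hs := Real.sin_sq_add_cos_sq t
  have hfe : ⟪f, e⟫ = 0 := by rw [real_inner_comm]; exact F.ef
  constructor <;> try intro u v
  all_goals simp only [inner_add_left, inner_add_right, real_inner_smul_left, inner_smul_right,
    F.ne, F.nf, F.ef, F.nn, F.ee, F.ff, hfe]
  · ring
  · ring
  · ring
  · linear_combination hs
  · linear_combination hs
  · rw [F.inner_eq u v]
    linear_combination -(⟪e, u⟫ * ⟪e, v⟫ + ⟪f, u⟫ * ⟪f, v⟫) * hs
  · rw [F.det_eq u v]
    linear_combination -(⟪e, u⟫ * ⟪f, v⟫ - ⟪f, u⟫ * ⟪e, v⟫) * hs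

lemma exists_angle {p q : ℝ} (h : p ^ 2 + q ^ 2 = 1) :
    ∃ t, 0 ≤ t ∧ t < 2 * Real.pi ∧ Real.cos t = p ∧ Real.sin t = q := by
  have hp : -1 ≤ p ∧ p ≤ 1 := abs_le.1 ((sq_le_one_iff_abs_le_one p).1 (by nlinarith))
  have hc := Real.cos_arccos hp.1 hp.2
  have hs : Real.sin (Real.arccos p) = |q| := by
    rw [Real.sin_arccos, show 1 - p ^ 2 = q ^ 2 by linarith, Real.sqrt_sq_eq_abs]
  have hpi := Real.pi_pos
  rcases le_or_gt 0 q with hq | hq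
  · refine ⟨Real.arccos p, Real.arccos_nonneg p, ?_, hc, by rw [hs, abs_of_nonneg hq]⟩
    linarith [Real.arccos_le_pi p]
  · refine ⟨2 * Real.pi - Real.arccos p, by linarith [Real.arccos_le_pi p], ?_, ?_, ?_⟩
    · have : 0 < Real.arccos p := by
        refine Real.arccos_pos.2 (lt_of_le_of_ne hp.2 fun h1 => ?_)
        rw [h1] at h
        nlinarith
      linarith
    · rw [Real.cos_two_pi_sub, hc]
    · rw [Real.sin_two_pi_sub, hs, abs_of_neg hq, neg_neg]

namespace Bip

variable {P V W : Set (Euc 3)} {a b c : ℝ}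

lemma pos (B : Bip P V W a b c) {x : Euc 3} (hx : x ∈ V) : 0 < a := by
  have h := B.sqV x hx
  refine lt_of_le_of_ne (h ▸ real_inner_self_nonneg) fun h0 => ?_
  rw [← h0] at h
  obtain ⟨y, hy, -, -⟩ := exists_third_edge B.poly B.full (B.memV hx) x x
  have hc := B.inner_edge x y hy
  rw [inner_self_eq_zero.1 h, inner_zero_left] at hc
  linarith [B.ca]

lemma sq_lt (B : Bip P V W a b c) {x : Euc 3} (hx : x ∈ V) : c ^ 2 < a * b := by
  have ha := B.pos hx
  obtain ⟨y, hy, -, -⟩ := exists_third_edge B.poly B.full (B.memV hx) x x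
  obtain ⟨z, hz, hzy, -⟩ := exists_third_edge B.poly B.full (B.memV hx) y y
  have key : ∀ m, IsEdge P x m → ⟪a • m - c • x, a • m - c • x⟫ = a * (a * b - c ^ 2) := by
    intro m hm
    simp only [inner_sub_left, inner_sub_right, real_inner_smul_left, inner_smul_right,
      B.sqV x hx, B.sqW m (B.edgeV hx hm), B.inner_edge x m hm, real_inner_comm x m]
    ring
  by_contra hcon
  have key2 : ∀ m, IsEdge P x m → a • m = c • x := by
    intro m hm
    have h1 : 0 ≤ ⟪a • m - c • x, a • m - c • x⟫ := real_inner_self_nonneg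
    have h2 := key m hm
    have : ⟪a • m - c • x, a • m - c • x⟫ = 0 := by nlinarith
    exact sub_eq_zero.1 (inner_self_eq_zero.1 this)
  refine hzy (smul_right_injective _ ha.ne' ?_)
  simp only
  rw [key2 z hz, key2 y hy]

lemma cor_of_gap (B : Bip P V W a b c) {x y z m k : Euc 3} {R δ : ℝ} (hx : x ∈ V)
    (hR : R = Real.sqrt (b - c ^ 2 / a)) (F : Frame ((Real.sqrt a)⁻¹ • x) m k) (h0 : 0 < δ)
    (hpi : δ < Real.pi) (hxy : IsEdge P x y) (hxz : IsEdge P x z)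
    (hy : y = (c / a) • x + (R * Real.cos δ) • m - (R * Real.sin δ) • k)
    (hz : z = (c / a) • x + (R * Real.cos δ) • m + (R * Real.sin δ) • k)
    (hN : ∀ p, IsEdge P x p → ⟪m, p⟫ ≤ R * Real.cos δ) :
    ∃ h, Cor P x y z h ∧ vertexAngle a b c h = 2 * δ := by
  have ha := B.pos hx
  have hca := B.ca
  have hsa : 0 < Real.sqrt a := Real.sqrt_pos.2 ha
  have hR2pos : 0 < b - c ^ 2 / a := by
    rw [sub_pos, div_lt_iff₀ ha]; linarith [B.sq_lt hx]
  have hR0 : 0 < R := hR ▸ Real.sqrt_pos.2 hR2pos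
  have hR2 : R ^ 2 = b - c ^ 2 / a := by rw [hR]; exact Real.sq_sqrt hR2pos.le
  have hxm : ⟪x, m⟫ = 0 := by
    have := F.ne
    rw [real_inner_smul_left] at this
    exact (mul_eq_zero.1 this).resolve_left (inv_pos.2 hsa).ne'
  have hxk : ⟪x, k⟫ = 0 := by
    have := F.nf
    rw [real_inner_smul_left] at this
    exact (mul_eq_zero.1 this).resolve_left (inv_pos.2 hsa).ne'
  have hmx : ⟪m, x⟫ = 0 := by rw [real_inner_comm]; exact hxm
  have hxx := B.sqV x hx
  set g := R * Real.cos δ with hg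
  set s := R * Real.sin δ with hs
  have hs0 : 0 < s := mul_pos hR0 (Real.sin_pos_of_pos_of_lt_pi h0 hpi)
  set α := g / (a - c) with hα
  have hac : 0 < a - c := by linarith
  have hαg : α * (a - c) = g := div_mul_cancel₀ _ hac.ne'
  set D := α ^ 2 * a + 1 with hD
  have hD0 : 0 < D := by positivity
  set β := (Real.sqrt D)⁻¹ with hβ
  have hsD : 0 < Real.sqrt D := Real.sqrt_pos.2 hD0
  have hβ0 : 0 < β := inv_pos.2 hsD
  have hβ2 : β ^ 2 * D = 1 := by
    rw [hβ, inv_pow, Real.sq_sqrt hD0.le, inv_mul_cancel₀ hD0.ne']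
  set w : Euc 3 := α • x + m with hw
  have hwx : ⟪w, x⟫ = α * a := by
    rw [hw, inner_add_left, real_inner_smul_left, hxx, hmx, add_zero]
  have hwp : ∀ p, IsEdge P x p → ⟪w, p⟫ = α * c + ⟪m, p⟫ := fun p hp => by
    rw [hw, inner_add_left, real_inner_smul_left, B.inner_edge x p hp]
  have hmy : ⟪m, y⟫ = g := by
    rw [hy]
    simp only [inner_add_right, inner_sub_right, inner_smul_right, hmx, F.ee, F.ef]; ring
  have hmz : ⟪m, z⟫ = g := by
    rw [hz]
    simp only [inner_add_right, inner_smul_right, hmx, F.ee, F.ef]; ring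
  have hww : ⟪w, w⟫ = D := by
    rw [hw]
    simp only [inner_add_left, inner_add_right, real_inner_smul_left, inner_smul_right, hmx, F.ee,
      hxx, hxm]; ring
  refine ⟨β * (α * a), ⟨β • w, hxy, hxz, ?_, ?_, ?_, ?_, ?_, ?_⟩, ?_⟩
  · rw [real_inner_smul_left, inner_smul_right, hww, ← hβ2]; ring
  · rw [real_inner_smul_left, hwx]
  · rw [real_inner_smul_left, hwp y hxy, hmy, ← hαg]; ring
  · rw [real_inner_smul_left, hwp z hxz, hmz, ← hαg]; ring
  · intro p hp
    have h1 := le_of_forall_edge B.poly (B.memV hx) (innerₛₗ ℝ w) (fun q hq => by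
      simp only [innerₛₗ_apply_apply]
      rw [hwp q hq, hwx]
      linarith [hN q hq]) hp
    simp only [innerₛₗ_apply_apply, hwx] at h1
    rw [real_inner_smul_left]
    exact mul_le_mul_of_nonneg_left h1 hβ0.le
  · have e1 : det3 (β • w) (y - x) (z - x) =
        β * (2 * s * (α * g + (1 - c / a)) * det3 x m k) := by
      rw [hw, hy, hz]
      simp [det3]; ring
    have e2 : det3 x m k = Real.sqrt a := by
      have h1 := F.det_eq m k
      have h2 : ⟪k, m⟫ = 0 := by rw [real_inner_comm]; exact F.ef
      rw [F.ee, F.ff, F.ef, h2] at h1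
      have h3 : det3 ((Real.sqrt a)⁻¹ • x) m k = (Real.sqrt a)⁻¹ * det3 x m k := by
        simp [det3]; ring
      rw [h3] at h1
      field_simp at h1
      linarith
    rw [e1, e2]
    have e3 : 0 ≤ α * g := by rw [← hαg]; nlinarith [mul_nonneg (sq_nonneg α) hac.le]
    have e4 : 0 < 1 - c / a := by rw [sub_pos, div_lt_one ha]; exact hca
    positivity
  · rw [vertexAngle]
    congr 1
    have q1 : a - (β * (α * a)) ^ 2 = a * β ^ 2 := by
      have : a = a * (β ^ 2 * D) := by rw [hβ2, mul_one]
      nth_rewrite 1 [this]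
      rw [hD]; ring
    have q2 : (a * b - c ^ 2) = a * R ^ 2 := by rw [hR2]; field_simp
    rw [q1, q2, show a * R ^ 2 * (a * β ^ 2) = (a * R * β) ^ 2 by ring,
      Real.sqrt_sq (by positivity)]
    rw [show (a - c) * (β * (α * a)) = a * β * (α * (a - c)) by ring, hαg, hg,
      show a * β * (R * Real.cos δ) / (a * R * β) = Real.cos δ by field_simp]
    exact Real.arccos_cos h0.le hpi.le

end Bip

namespace Bip

variable {P V W : Set (Euc 3)} {a b c : ℝ}

/-- The cyclic sequence of facets around a vertex. -/
lemma vertex_cycle (B : Bip P V W a b c) {x y₀ : Euc 3} (hx : x ∈ V) (hy₀ : IsEdge P x y₀) :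
    ∃ (s : ℕ) (y : ℕ → Euc 3) (h : ℕ → ℝ), 3 ≤ s ∧ y 0 = y₀ ∧ y s = y₀ ∧
      (∀ j < s, IsEdge P x (y j)) ∧ (∀ m, IsEdge P x m → ∃ j < s, y j = m) ∧
      (∀ i < s, ∀ j < s, y i = y j → i = j) ∧
      (∀ j < s, Cor P x (y j) (y (j + 1)) (h j)) ∧
      ∑ j ∈ Finset.range s, vertexAngle a b c (h j) = 2 * Real.pi := by
  have ha := B.pos hx
  have hsa : 0 < Real.sqrt a := Real.sqrt_pos.2 ha
  have hssa : Real.sqrt a * Real.sqrt a = a := Real.mul_self_sqrt ha.le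
  have hR2pos : 0 < b - c ^ 2 / a := by
    rw [sub_pos, div_lt_iff₀ ha]; linarith [B.sq_lt hx]
  set R := Real.sqrt (b - c ^ 2 / a) with hR
  have hR0 : 0 < R := Real.sqrt_pos.2 hR2pos
  have hR2 : R ^ 2 = b - c ^ 2 / a := Real.sq_sqrt hR2pos.le
  set n : Euc 3 := (Real.sqrt a)⁻¹ • x with hn
  have hnn : ⟪n, n⟫ = 1 := by
    rw [hn, real_inner_smul_left, inner_smul_right, B.sqV x hx]
    field_simp; rw [pow_two, hssa]
  have hnp : ∀ p, IsEdge P x p → ⟪n, p⟫ = c / Real.sqrt a := fun p hp => by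
    rw [hn, real_inner_smul_left, B.inner_edge x p hp]; ring
  have hnp2 : (c / Real.sqrt a) ^ 2 = c ^ 2 / a := by rw [div_pow, Real.sq_sqrt ha.le]
  obtain ⟨e, f, F, hf, he⟩ := exists_frame hnn (u := y₀)
    (by rw [hnp _ hy₀, hnp2, B.sqW _ (B.edgeV hx hy₀)]; exact hR2pos)
  have hnx : ⟪n, x⟫ = Real.sqrt a := by
    rw [hn, real_inner_smul_left, B.sqV x hx, inv_mul_eq_div, Real.div_sqrt]
  have hex : ⟪e, x⟫ = 0 := by
    have := F.ne
    rw [hn, real_inner_smul_left] at this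
    rw [real_inner_comm]
    exact (mul_eq_zero.1 this).resolve_left (inv_pos.2 hsa).ne'
  have hfx : ⟪f, x⟫ = 0 := by
    have := F.nf
    rw [hn, real_inner_smul_left] at this
    rw [real_inner_comm]
    exact (mul_eq_zero.1 this).resolve_left (inv_pos.2 hsa).ne'
  have hfe : ⟪f, e⟫ = 0 := by rw [real_inner_comm]; exact F.ef
  set Y : ℝ → Euc 3 := fun t => (c / a) • x + (R * Real.cos t) • e + (R * Real.sin t) • f with hY
  have hsq : ∀ p, IsEdge P x p → ⟪e, p⟫ ^ 2 + ⟪f, p⟫ ^ 2 = R ^ 2 := fun p hp => by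
    have := F.inner_eq p p
    rw [B.sqW _ (B.edgeV hx hp), hnp p hp, ← pow_two, hnp2] at this
    rw [hR2]; linarith
  have hT : ∀ p, IsEdge P x p → ∃ t, 0 ≤ t ∧ t < 2 * Real.pi ∧ Y t = p ∧
      ⟪e, p⟫ = R * Real.cos t ∧ ⟪f, p⟫ = R * Real.sin t := by
    intro p hp
    obtain ⟨t, h0, h1, hc, hs⟩ := exists_angle (p := ⟪e, p⟫ / R) (q := ⟪f, p⟫ / R) (by
      rw [div_pow, div_pow, ← add_div, hsq p hp]; field_simp)
    have hc' : R * Real.cos t = ⟪e, p⟫ := by rw [hc]; field_simp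
    have hs' : R * Real.sin t = ⟪f, p⟫ := by rw [hs]; field_simp
    refine ⟨t, h0, h1, ?_, hc'.symm, hs'.symm⟩
    rw [hY]
    simp only [hc', hs']
    refine F.ext ?_ ?_ ?_
    · simp only [inner_add_right, inner_smul_right, F.ne, F.nf, hnx, hnp p hp]
      rw [show c / a = c / (Real.sqrt a * Real.sqrt a) by rw [hssa]]; field_simp; ring
    · simp only [inner_add_right, inner_smul_right, F.ee, F.ef, hex]; ring
    · simp only [inner_add_right, inner_smul_right, F.ff, hfe, hfx]; ring
  choose! T hT0 hT1 hTY hTe hTf using hT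
  set N : Set (Euc 3) := {p | IsEdge P x p} with hN
  have hNf : N.Finite := B.poly.finite_extremePoints.subset fun p hp => B.memW (B.edgeV hx hp)
  set A : Finset ℝ := hNf.toFinset.image T with hA
  have hmemA : ∀ t, t ∈ A ↔ ∃ p, IsEdge P x p ∧ T p = t := by
    intro t; simp [hA, hN]
  set s := A.card with hs
  set o := A.orderEmbOfFin hs.symm with ho
  set τ : ℕ → ℝ := fun j => if hj : j < s then o ⟨j, hj⟩ else 2 * Real.pi with hτ
  have hτo : ∀ j (hj : j < s), τ j = o ⟨j, hj⟩ := fun j hj => by simp [hτ, hj]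
  have hτs : τ s = 2 * Real.pi := by simp [hτ]
  have hoA : ∀ i, o i ∈ A := fun i => A.orderEmbOfFin_mem hs.symm i
  have hτp : ∀ j < s, ∃ p, IsEdge P x p ∧ T p = τ j := fun j hj => by
    rw [hτo j hj]; exact (hmemA _).1 (hoA _)
  have hpτ : ∀ p, IsEdge P x p → ∃ j < s, τ j = T p := fun p hp => by
    have h1 : T p ∈ A := (hmemA _).2 ⟨p, hp, rfl⟩
    have h2 : T p ∈ Set.range o := by rw [ho, A.range_orderEmbOfFin hs.symm]; exact h1
    obtain ⟨i, hi⟩ := h2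
    exact ⟨i, i.2, by rw [hτo i i.2]; exact hi⟩
  have hτmono : ∀ i j, i < j → j < s → τ i < τ j := fun i j hij hj => by
    rw [hτo i (hij.trans hj), hτo j hj]
    exact o.strictMono (Fin.mk_lt_mk.2 hij)
  have hτ0 : ∀ j < s, 0 ≤ τ j := fun j hj => by
    obtain ⟨p, hp, h1⟩ := hτp j hj
    rw [← h1]; exact hT0 p hp
  have hτ2 : ∀ j < s, τ j < 2 * Real.pi := fun j hj => by
    obtain ⟨p, hp, h1⟩ := hτp j hj
    rw [← h1]; exact hT1 p hp
  have hτY : ∀ j < s, IsEdge P x (Y (τ j)) ∧ T (Y (τ j)) = τ j := fun j hj => by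
    obtain ⟨p, hp, h1⟩ := hτp j hj
    rw [← h1, hTY p hp]; exact ⟨hp, rfl⟩
  have hTy₀ : T y₀ = 0 := by
    have h1 := hTe y₀ hy₀
    have h2 := hTf y₀ hy₀
    rw [hf] at h2
    have h3 : Real.sin (T y₀) = 0 := (mul_eq_zero.1 h2.symm).resolve_left hR0.ne'
    have h4 : 0 < Real.cos (T y₀) := by
      rw [h1] at he; exact pos_of_mul_pos_right he hR0.le
    have h5 := hT0 y₀ hy₀
    have h6 := hT1 y₀ hy₀
    rcases eq_or_lt_of_le h5 with h7 | h7
    · exact h7.symm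
    exfalso
    rcases lt_trichotomy (T y₀) Real.pi with h8 | h8 | h8
    · exact (Real.sin_pos_of_pos_of_lt_pi h7 h8).ne' h3
    · rw [h8, Real.cos_pi] at h4; linarith
    · have := Real.sin_neg_of_neg_of_neg_pi_lt (x := T y₀ - 2 * Real.pi) (by linarith) (by linarith)
      rw [Real.sin_sub_two_pi] at this; linarith
  have hs0 : 0 < s := by
    obtain ⟨j, hj, -⟩ := hpτ y₀ hy₀; omega
  have hτ00 : τ 0 = 0 := by
    obtain ⟨j, hj, h1⟩ := hpτ y₀ hy₀
    rw [hTy₀] at h1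
    rcases Nat.eq_zero_or_pos j with h2 | h2
    · rw [← h2]; exact h1
    · have := hτmono 0 j h2 hj
      linarith [hτ0 0 hs0]
  have hYy₀ : Y 0 = y₀ := by rw [← hTY y₀ hy₀, hTy₀]
  have hs3 : 3 ≤ s := by
    by_contra hlt
    obtain ⟨p, hp, h1, h2⟩ := exists_third_edge B.poly B.full (B.memV hx) (Y (τ 0)) (Y (τ 1))
    obtain ⟨j, hj, h3⟩ := hpτ p hp
    rw [← hTY p hp, ← h3] at h1 h2
    have hj2 : j < 2 := by omega
    interval_cases j
    · exact h1 rfl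
    · exact h2 rfl
  have hgap : ∀ j < s, ∃ h, Cor P x (Y (τ j)) (Y (τ (j + 1))) h ∧
      vertexAngle a b c h = τ (j + 1) - τ j := by
    intro j hj
    have hle2 : τ (j + 1) ≤ 2 * Real.pi := by
      rcases Nat.lt_or_ge (j + 1) s with h1 | h1
      · exact (hτ2 _ h1).le
      · rw [show j + 1 = s by omega, hτs]
    have hlt : τ j < τ (j + 1) := by
      rcases Nat.lt_or_ge (j + 1) s with h1 | h1
      · exact hτmono _ _ (Nat.lt_succ_self j) h1
      · rw [show j + 1 = s by omega, hτs]; exact hτ2 j hj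
    have hlt2 : τ (j + 1) - τ j < 2 * Real.pi := by
      rcases Nat.lt_or_ge (j + 1) s with h1 | h1
      · linarith [hτ2 _ h1, hτ0 j hj]
      · have := hτmono 0 j (by omega) hj
        linarith [hτ0 0 hs0]
    have hedge2 : IsEdge P x (Y (τ (j + 1))) := by
      rcases Nat.lt_or_ge (j + 1) s with h1 | h1
      · exact (hτY _ h1).1
      · rw [show j + 1 = s by omega, hτs]
        have : Y (2 * Real.pi) = Y 0 := by simp [hY]
        rw [this, hYy₀]; exact hy₀
    set δ := (τ (j + 1) - τ j) / 2 with hδ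
    set M := (τ (j + 1) + τ j) / 2 with hM
    have t1 : τ j = M - δ := by rw [hδ, hM]; ring
    have t2 : τ (j + 1) = M + δ := by rw [hδ, hM]; ring
    obtain ⟨h, hC, hA'⟩ := B.cor_of_gap (y := Y (τ j)) (z := Y (τ (j + 1))) hx hR (F.rotate M)
      (δ := δ) (by linarith) (by linarith) (hτY j hj).1 hedge2
      (by
        have hs := Real.sin_sq_add_cos_sq M
        rw [t1, hY]; simp only; rw [Real.cos_sub, Real.sin_sub]
        module)
      (by
        rw [t2, hY]; simp only; rw [Real.cos_add, Real.sin_add]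
        module)
      (by
        intro p hp
        rw [inner_add_left, real_inner_smul_left, real_inner_smul_left, hTe p hp, hTf p hp]
        obtain ⟨i, hi, h1⟩ := hpτ p hp
        rw [← h1]
        have e1 : Real.cos M * (R * Real.cos (τ i)) + Real.sin M * (R * Real.sin (τ i)) =
            R * Real.cos (|τ i - M|) := by
          rw [Real.cos_abs, Real.cos_sub]; ring
        rw [e1]
        apply mul_le_mul_of_nonneg_left _ hR0.le
        have b1 := hτ0 i hi
        have b2 := hτ2 i hi
        have b0 := hτ0 j hj
        have hout : δ ≤ |τ i - M| := by
          rcases Nat.lt_or_ge j i with h2 | h2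
          · have : τ (j + 1) ≤ τ i := by
              rcases Nat.eq_or_lt_of_le (Nat.succ_le_of_lt h2) with h3 | h3
              · rw [← h3]
              · exact (hτmono _ _ h3 hi).le
            exact (by linarith : δ ≤ τ i - M).trans (le_abs_self _)
          · have : τ i ≤ τ j := by
              rcases Nat.eq_or_lt_of_le h2 with h3 | h3
              · rw [h3]
              · exact (hτmono _ _ h3 hj).le
            exact (by linarith : δ ≤ -(τ i - M)).trans (neg_le_abs _)
        have hin : |τ i - M| ≤ 2 * Real.pi - δ := abs_le.2 ⟨by linarith, by linarith⟩
        rcases le_or_gt |τ i - M| Real.pi with h3 | h3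
        · exact Real.cos_le_cos_of_nonneg_of_le_pi (by linarith) h3 hout
        · rw [← Real.cos_two_pi_sub]
          exact Real.cos_le_cos_of_nonneg_of_le_pi (by linarith) (by linarith) (by linarith))
    exact ⟨h, hC, by rw [hA']; ring⟩
  choose! h hC hh using hgap
  refine ⟨s, fun j => Y (τ j), h, hs3, by simp only [hτ00, hYy₀], ?_, fun j hj => (hτY j hj).1, ?_,
    ?_, hC, ?_⟩
  · have : Y (2 * Real.pi) = Y 0 := by simp [hY]
    simp only [hτs, this, hYy₀]
  · intro p hp
    obtain ⟨j, hj, h1⟩ := hpτ p hp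
    exact ⟨j, hj, by simp only [h1, hTY p hp]⟩
  · intro i hi j hj hij
    have : τ i = τ j := by
      rw [← (hτY i hi).2, ← (hτY j hj).2]; exact congrArg T hij
    rcases lt_trichotomy i j with h1 | h1 | h1
    · exact absurd this (hτmono i j h1 hj).ne
    · exact h1
    · exact absurd this (hτmono j i h1 hi).ne'
  · rw [Finset.sum_congr rfl fun j hj => hh j (Finset.mem_range.1 hj), Finset.sum_range_sub, hτs,
      hτ00, sub_zero]

end Bip

lemma vertexAngle_ge_pi {a b c h : ℝ} (hca : c < a) (hh : h ≤ 0) :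
    Real.pi ≤ vertexAngle a b c h := by
  have h1 : (a - c) * h / Real.sqrt ((a * b - c ^ 2) * (a - h ^ 2)) ≤ 0 :=
    div_nonpos_of_nonpos_of_nonneg (mul_nonpos_of_nonneg_of_nonpos (by linarith) hh)
      (Real.sqrt_nonneg _)
  have h2 := Real.arccos_le_arccos h1
  rw [Real.arccos_zero] at h2
  rw [vertexAngle]; linarith

lemma vertexAngle_pos {a b c h : ℝ} (hca : c < a) (hcb : c < b) (hh : 0 < h) (hc : h ^ 2 ≤ c) :
    0 < a ∧ 0 < b ∧ 0 < a - h ^ 2 ∧ 0 < a * b - c ^ 2 := by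
  have h0 : 0 < h ^ 2 := by positivity
  exact ⟨by linarith, by linarith, by linarith, by nlinarith⟩

/-- The cosine of half the vertex angle. -/
def vertexCos (a b c h : ℝ) : ℝ := (a - c) * h / Real.sqrt ((a * b - c ^ 2) * (a - h ^ 2))

lemma vertexCos_sq {a b c h : ℝ} (hca : c < a) (hcb : c < b) (hh : 0 < h) (hc : h ^ 2 ≤ c) :
    vertexCos a b c h ^ 2 = (a - c) ^ 2 * h ^ 2 / ((a * b - c ^ 2) * (a - h ^ 2)) := by
  obtain ⟨-, -, h1, h2⟩ := vertexAngle_pos hca hcb hh hc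
  rw [vertexCos, div_pow, Real.sq_sqrt (mul_pos h2 h1).le, mul_pow]

lemma vertexCos_pos {a b c h : ℝ} (hca : c < a) (hcb : c < b) (hh : 0 < h) (hc : h ^ 2 ≤ c) :
    0 < vertexCos a b c h := by
  obtain ⟨-, -, h1, h2⟩ := vertexAngle_pos hca hcb hh hc
  exact div_pos (mul_pos (by linarith) hh) (Real.sqrt_pos.2 (mul_pos h2 h1))

lemma vertexCos_sq_le {a b c h : ℝ} (hca : c < a) (hcb : c < b) (hh : 0 < h) (hc : h ^ 2 ≤ c) :
    vertexCos a b c h ^ 2 ≤ (a - c) * c / (a * b - c ^ 2) := by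
  obtain ⟨h0, -, h1, h2⟩ := vertexAngle_pos hca hcb hh hc
  rw [vertexCos_sq hca hcb hh hc, div_le_div_iff₀ (mul_pos h2 h1) h2]
  have : 0 ≤ (a - c) * (a * b - c ^ 2) * (a * (c - h ^ 2)) :=
    mul_nonneg (mul_nonneg (by linarith) h2.le) (mul_nonneg h0.le (by linarith))
  nlinarith

lemma vertexCos_lt_one {a b c h : ℝ} (hca : c < a) (hcb : c < b) (hh : 0 < h) (hc : h ^ 2 ≤ c) :
    vertexCos a b c h < 1 := by
  obtain ⟨h0, -, h1, h2⟩ := vertexAngle_pos hca hcb hh hc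
  have h3 := vertexCos_sq_le hca hcb hh hc
  have h4 : (a - c) * c / (a * b - c ^ 2) < 1 := by
    rw [div_lt_one h2]; nlinarith
  have h5 := vertexCos_pos hca hcb hh hc
  nlinarith

lemma vertexAngle_eq (a b c h : ℝ) : vertexAngle a b c h = 2 * Real.arccos (vertexCos a b c h) :=
  rfl

lemma vertexAngle_lt_pi {a b c h : ℝ} (hca : c < a) (hcb : c < b) (hh : 0 < h) (hc : h ^ 2 ≤ c) :
    vertexAngle a b c h < Real.pi := by
  have := Real.arccos_lt_pi_div_two.2 (vertexCos_pos hca hcb hh hc)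
  rw [vertexAngle_eq]; linarith

lemma vertexAngle_gt_pi_div_two {a b c h : ℝ} (hca : c < a) (hab : a < b) (hh : 0 < h)
    (hc : h ^ 2 ≤ c) : Real.pi / 2 < vertexAngle a b c h := by
  have hcb := hca.trans hab
  obtain ⟨h0, -, h1, h2⟩ := vertexAngle_pos hca hcb hh hc
  have h3 := vertexCos_sq_le hca hcb hh hc
  have h4 : (a - c) * c / (a * b - c ^ 2) < 1 / 2 := by
    rw [div_lt_div_iff₀ h2 two_pos]; nlinarith
  have h5 := vertexCos_pos hca hcb hh hc
  have h6 : vertexCos a b c h < Real.cos (Real.pi / 4) := by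
    rw [Real.cos_pi_div_four]
    have h7 : (Real.sqrt 2 / 2) ^ 2 = 1 / 2 := by
      rw [div_pow, Real.sq_sqrt (by norm_num)]; norm_num
    exact lt_of_pow_lt_pow_left₀ 2 (by positivity) (by linarith)
  have h8 := Real.strictAntiOn_arccos ⟨by linarith, (vertexCos_lt_one hca hcb hh hc).le⟩
    ⟨Real.neg_one_le_cos _, Real.cos_le_one _⟩ h6
  rw [Real.arccos_cos (by positivity) (by linarith [Real.pi_pos])] at h8
  rw [vertexAngle_eq]; linarith

lemma vertexAngle_lt_of_cos {a b a' b' c h h' : ℝ} (hca : c < a) (hcb : c < b) (hca' : c < a')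
    (hcb' : c < b') (hh : 0 < h) (hc : h ^ 2 ≤ c) (hh' : 0 < h') (hc' : h' ^ 2 ≤ c)
    (hlt : vertexCos a b c h ^ 2 < vertexCos a' b' c h' ^ 2) :
    vertexAngle a' b' c h' < vertexAngle a b c h := by
  have p := vertexCos_pos hca hcb hh hc
  have p' := vertexCos_pos hca' hcb' hh' hc'
  have h1 := lt_of_pow_lt_pow_left₀ 2 p'.le hlt
  have := Real.strictAntiOn_arccos ⟨by linarith, (vertexCos_lt_one hca hcb hh hc).le⟩
    ⟨by linarith, (vertexCos_lt_one hca' hcb' hh' hc').le⟩ h1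
  rw [vertexAngle_eq, vertexAngle_eq]; linarith

lemma vertexAngle_anti {a b c h h' : ℝ} (hca : c < a) (hcb : c < b) (hh : 0 < h)
    (hlt : h < h') (hc' : h' ^ 2 ≤ c) : vertexAngle a b c h' < vertexAngle a b c h := by
  have hs : h ^ 2 < h' ^ 2 := by nlinarith
  have hc : h ^ 2 ≤ c := by linarith
  have hh' : 0 < h' := hh.trans hlt
  refine vertexAngle_lt_of_cos hca hcb hca hcb hh hc hh' hc' ?_
  obtain ⟨h0, -, h1, h2⟩ := vertexAngle_pos hca hcb hh hc
  obtain ⟨-, -, h1', -⟩ := vertexAngle_pos hca hcb hh' hc'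
  rw [vertexCos_sq hca hcb hh hc, vertexCos_sq hca hcb hh' hc',
    div_lt_div_iff₀ (mul_pos h2 h1) (mul_pos h2 h1')]
  have : 0 < (a - c) ^ 2 * (a * b - c ^ 2) * (a * (h' ^ 2 - h ^ 2)) := by
    have : 0 < a - c := by linarith
    have : 0 < h' ^ 2 - h ^ 2 := by linarith
    positivity
  nlinarith

lemma vertexAngle_swap_lt {a b c h : ℝ} (hca : c < a) (hab : a < b) (hh : 0 < h)
    (hc : h ^ 2 ≤ c) : vertexAngle b a c h < vertexAngle a b c h := by
  have hcb := hca.trans hab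
  refine vertexAngle_lt_of_cos hca hcb hcb hca hh hc hh hc ?_
  obtain ⟨h0, -, h1, h2⟩ := vertexAngle_pos hca hcb hh hc
  obtain ⟨-, -, h1', h2'⟩ := vertexAngle_pos hcb hca hh hc
  rw [vertexCos_sq hca hcb hh hc, vertexCos_sq hcb hca hh hc,
    div_lt_div_iff₀ (mul_pos h2 h1) (mul_pos h2' h1'), mul_comm b a]
  have e : (a - c) ^ 2 * (b - h ^ 2) < (b - c) ^ 2 * (a - h ^ 2) := by
    have : (b - c) ^ 2 * (a - h ^ 2) - (a - c) ^ 2 * (b - h ^ 2) =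
        (b - a) * ((a - c) * (b - c) + (c - h ^ 2) * (a - c + (b - c))) := by ring
    have : 0 < (b - a) * ((a - c) * (b - c) + (c - h ^ 2) * (a - c + (b - c))) := by
      apply mul_pos (by linarith)
      have := mul_pos (sub_pos.2 hca) (sub_pos.2 hcb)
      have := mul_nonneg (sub_nonneg.2 hc) (by linarith : 0 ≤ a - c + (b - c))
      linarith
    linarith
  have := mul_pos (mul_pos (sub_pos.2 e) h2) (pow_pos hh 2)
  nlinarith

lemma one_sub_vertexCos_sq {a b c h : ℝ} (hca : c < a) (hcb : c < b) (hh : 0 < h)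
    (hc : h ^ 2 ≤ c) : 1 - vertexCos a b c h ^ 2 =
      a * ((a - h ^ 2) * (b - h ^ 2) - (c - h ^ 2) ^ 2) / ((a * b - c ^ 2) * (a - h ^ 2)) := by
  obtain ⟨h0, -, h1, h2⟩ := vertexAngle_pos hca hcb hh hc
  rw [vertexCos_sq hca hcb hh hc]
  field_simp
  ring

/-- The angle excess of the spherical triangle spanned by an edge and a facet normal. -/
lemma vertexAngle_add_gt {a b c h θ : ℝ} (hca : c < a) (hcb : c < b) (hh : 0 < h)
    (hc : h ^ 2 ≤ c) (hθ : 0 < θ)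
    (hcos : c - h ^ 2 = Real.sqrt ((a - h ^ 2) * (b - h ^ 2)) * Real.cos θ) :
    2 * Real.pi - 2 * θ < vertexAngle a b c h + vertexAngle b a c h := by
  obtain ⟨h0, h0', h1, h2⟩ := vertexAngle_pos hca hcb hh hc
  obtain ⟨-, -, h1', h2'⟩ := vertexAngle_pos hcb hca hh hc
  set D := a * b - c ^ 2 with hD
  have hDba : b * a - c ^ 2 = D := by rw [hD]; ring
  have hc0 : 0 < c := lt_of_lt_of_le (by positivity) hc
  set S2 := (a - h ^ 2) * (b - h ^ 2) - (c - h ^ 2) ^ 2 with hS2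
  have hS2pos : 0 < S2 := by
    have : S2 = (a - c) * (b - c) + (c - h ^ 2) * (a - c + (b - c)) := by rw [hS2]; ring
    rw [this]
    have := mul_pos (sub_pos.2 hca) (sub_pos.2 hcb)
    have := mul_nonneg (sub_nonneg.2 hc) (by linarith : 0 ≤ a - c + (b - c))
    linarith
  set ρ := Real.sqrt ((a - h ^ 2) * (b - h ^ 2)) with hρ
  have hρ0 : 0 < ρ := Real.sqrt_pos.2 (mul_pos h1 h1')
  have hρ2 : ρ ^ 2 = (a - h ^ 2) * (b - h ^ 2) := Real.sq_sqrt (mul_pos h1 h1').le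
  set C1 := vertexCos a b c h with hC1
  set C2 := vertexCos b a c h with hC2
  have p1 := vertexCos_pos hca hcb hh hc
  have p2 := vertexCos_pos hcb hca hh hc
  have l1 := vertexCos_lt_one hca hcb hh hc
  have l2 := vertexCos_lt_one hcb hca hh hc
  rw [← hC1] at p1 l1
  rw [← hC2] at p2 l2
  have hprod : C1 * C2 = (a - c) * (b - c) * h ^ 2 / (D * ρ) := by
    rw [hC1, hC2, vertexCos, vertexCos, hDba, div_mul_div_comm, ← Real.sqrt_mul (mul_pos h2 h1).le,
      show D * (a - h ^ 2) * (D * (b - h ^ 2)) = (D * ρ) ^ 2 by rw [mul_pow, hρ2]; ring,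
      Real.sqrt_sq (mul_pos h2 hρ0).le]
    congr 1; ring
  have hsum : Real.cos θ + C1 * C2 = c * S2 / (D * ρ) := by
    have : Real.cos θ = (c - h ^ 2) / ρ := by rw [hcos]; field_simp
    have hD0 : D ≠ 0 := h2.ne'
    rw [this, hprod, hS2]
    field_simp
    rw [hD]
    ring
  have hsin : (Real.sin (Real.arccos C1) * Real.sin (Real.arccos C2)) ^ 2 =
      a * b * S2 ^ 2 / (D * ρ) ^ 2 := by
    rw [mul_pow, Real.sin_arccos, Real.sin_arccos, Real.sq_sqrt (by nlinarith),
      Real.sq_sqrt (by nlinarith), hC1, hC2, one_sub_vertexCos_sq hca hcb hh hc,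
      one_sub_vertexCos_sq hcb hca hh hc, hDba, ← hD, ← hS2,
      show (b - h ^ 2) * (a - h ^ 2) - (c - h ^ 2) ^ 2 = S2 by rw [hS2]; ring, mul_pow D ρ, hρ2]
    field_simp
  have a1 : 0 < Real.arccos C1 := Real.arccos_pos.2 l1
  have a2 : 0 < Real.arccos C2 := Real.arccos_pos.2 l2
  have b1 : Real.arccos C1 < Real.pi / 2 := Real.arccos_lt_pi_div_two.2 p1
  have b2 : Real.arccos C2 < Real.pi / 2 := Real.arccos_lt_pi_div_two.2 p2
  have s1 := Real.sin_pos_of_pos_of_lt_pi a1 (by linarith)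
  have s2 := Real.sin_pos_of_pos_of_lt_pi a2 (by linarith)
  have hlt : Real.cos θ + C1 * C2 < Real.sin (Real.arccos C1) * Real.sin (Real.arccos C2) := by
    refine lt_of_pow_lt_pow_left₀ 2 (mul_pos s1 s2).le ?_
    rw [hsin, hsum, div_pow, mul_pow]
    apply div_lt_div_of_pos_right _ (by positivity)
    apply mul_lt_mul_of_pos_right _ (by positivity)
    linarith
  have hcosadd : Real.cos θ < Real.cos (Real.pi - (Real.arccos C1 + Real.arccos C2)) := by
    rw [Real.cos_pi_sub, Real.cos_add, Real.cos_arccos (by linarith) l1.le,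
      Real.cos_arccos (by linarith) l2.le]
    linarith
  have : Real.pi - (Real.arccos C1 + Real.arccos C2) < θ := by
    by_contra! hcon
    have := Real.cos_le_cos_of_nonneg_of_le_pi hθ.le (by linarith) hcon
    linarith
  rw [vertexAngle_eq, vertexAngle_eq, ← hC1, ← hC2]
  linarith

/-- The combinatorial and metric data of the corners of a strictly bipartite polyhedron.
`C x y z h` says that the edges `xy` and `xz` bound a facet of height `h`, where `z` follows `y`
in the cyclic order around `x`. The functions `A` and `D` give the angles at vertices in `V`
and in `W`. -/
structure CornerSystem (C : Euc 3 → Euc 3 → Euc 3 → ℝ → Prop) (V W : Set (Euc 3))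
    (A D : ℝ → ℝ) (K : ℝ → ℕ → Prop) (r : ℝ) : Prop where
  mem : ∀ {x y z h}, C x y z h → x ∈ V ∨ x ∈ W
  memV : ∀ {x y z h}, C x y z h → x ∈ V → y ∈ W ∧ z ∈ W
  memW : ∀ {x y z h}, C x y z h → x ∈ W → y ∈ V ∧ z ∈ V
  next : ∀ {x y z h}, C x y z h → ∃ u, C y u x h
  prev : ∀ {x y z h}, C x y z h → ∃ u, C z x u h
  rhombus : ∀ {x y z}, C x y z r →
    C y (y + z - x) x r ∧ C (y + z - x) z y r ∧ C z x (y + z - x) r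
  right : ∀ {x y z z' h h'}, C x y z h → C x y z' h' → z = z' ∧ h = h'
  left : ∀ {x y y' z h h'}, C x y z h → C x y' z h' → y = y' ∧ h = h'
  le : ∀ {x y z h}, C x y z h → h ≤ r
  starV : ∀ {x y z h}, x ∈ V → C x y z h →
    ∃ w h' h'', C x z w h' ∧ C x w y h'' ∧ A h + A h' + A h'' = 2 * Real.pi
  starW : ∀ {v p x q h h'}, v ∈ W → C v p x h → C v x q h' →
    (∃ z, C v q p z ∧ D h + D h' + D z = 2 * Real.pi) ∨
    ∃ n t n' t', C v q n t ∧ C v n' p t' ∧ D h + D h' + D t + D r ≤ 2 * Real.pi ∧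
      D h + D h' + D t' + D r ≤ 2 * Real.pi
  antiA : ∀ {x y z x' y' z' h h'}, C x y z h → C x' y' z' h' → h < h' → A h' < A h
  antiD : ∀ {x y z x' y' z' h h'}, C x y z h → C x' y' z' h' → h < h' → D h' < D h
  D_lt : ∀ {x y z h}, C x y z h → D h < A h
  A_lt : ∀ {x y z h}, C x y z h → A h < Real.pi
  excess_r : ∀ {x y z}, C x y z r → Real.pi < A r + D r
  excess : ∀ {x y z h}, C x y z h → h < r → ∃ k : ℕ, 3 ≤ k ∧ K h k ∧
    2 * Real.pi - 2 * (Real.pi / k) < A h + D h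

namespace CornerSystem

variable {C : Euc 3 → Euc 3 → Euc 3 → ℝ → Prop} {V W : Set (Euc 3)}
    {A D : ℝ → ℝ} {K : ℝ → ℕ → Prop} {r : ℝ}

lemma mirror (S : CornerSystem C V W A D K r) :
    CornerSystem (fun x y z h => C x z y h) V W A D K r where
  mem h := S.mem h
  memV h hx := (S.memV h hx).symm
  memW h hx := (S.memW h hx).symm
  next h := S.prev h
  prev h := S.next h
  rhombus := fun {x y z} h => by
    have := S.rhombus h
    rw [add_comm z y] at this
    exact ⟨this.2.2, this.2.1, this.1⟩
  right h h' := S.left h h'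
  left h h' := S.right h h'
  le h := S.le h
  starV hx h := by
    obtain ⟨w, h1, h2, c1, c2, e⟩ := S.starV hx h
    exact ⟨w, h2, h1, c2, c1, by linarith⟩
  starW hv h h' := by
    obtain ⟨z, c, e⟩ | ⟨n, t, n', t', c, c', e, e'⟩ := S.starW hv h' h
    · exact Or.inl ⟨z, c, by linarith⟩
    · exact Or.inr ⟨n', t', n, t, c', c, by linarith, by linarith⟩
  antiA h h' := S.antiA h h'
  antiD h h' := S.antiD h h'
  D_lt h := S.D_lt h
  A_lt h := S.A_lt h
  excess_r h := S.excess_r h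
  excess h := S.excess h

lemma excess_gt (S : CornerSystem C V W A D K r) {x y z : Euc 3} {h : ℝ} (c : C x y z h)
    (hr : h < r) : 4 * Real.pi / 3 < A h + D h := by
  obtain ⟨k, hk, -, h1⟩ := S.excess c hr
  have : Real.pi / k ≤ Real.pi / 3 := by
    apply div_le_div_of_nonneg_left Real.pi_pos.le (by norm_num); exact_mod_cast hk
  linarith

lemma A_gt (S : CornerSystem C V W A D K r) {x y z : Euc 3} {h : ℝ} (c : C x y z h)
    (hr : h < r) : 2 * Real.pi / 3 < A h := by
  linarith [S.excess_gt c hr, S.D_lt c]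

lemma A_le (S : CornerSystem C V W A D K r) {x y z x' y' z' : Euc 3} {h h' : ℝ} (c : C x y z h)
    (c' : C x' y' z' h') (hh : h ≤ h') : A h' ≤ A h := by
  obtain hh | rfl := hh.lt_or_eq
  · exact (S.antiA c c' hh).le
  · exact le_rfl

lemma D_le (S : CornerSystem C V W A D K r) {x y z x' y' z' : Euc 3} {h h' : ℝ} (c : C x y z h)
    (c' : C x' y' z' h') (hh : h ≤ h') : D h' ≤ D h := by
  obtain hh | rfl := hh.lt_or_eq
  · exact (S.antiD c c' hh).le
  · exact le_rfl

lemma A_inj (S : CornerSystem C V W A D K r) {x y z x' y' z' : Euc 3} {h h' : ℝ} (c : C x y z h)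
    (c' : C x' y' z' h') (hh : A h = A h') : h = h' := by
  obtain hh' | hh' | hh' := lt_trichotomy h h'
  · linarith [S.antiA c c' hh']
  · exact hh'
  · linarith [S.antiA c' c hh']

/-- The two remaining corners at a vertex in `V` next to a pair of consecutive corners. -/
lemma third (S : CornerSystem C V W A D K r) {x y z w : Euc 3} {h h' : ℝ} (hx : x ∈ V)
    (c : C x y z h) (c' : C x z w h') :
    ∃ t, C x w y t ∧ A h + A h' + A t = 2 * Real.pi := by
  obtain ⟨w', h1, h2, c1, c2, e⟩ := S.starV hx c
  obtain ⟨rfl, rfl⟩ := S.right c' c1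
  exact ⟨h2, c2, e⟩

/-- If a vertex in `V` has exactly one rhombic corner, then the opposite vertex of that rhombus
has a further rhombic corner. -/
lemma rhombic_neighbour (S : CornerSystem C V W A D K r) {x y₀ y₁ y₂ : Euc 3} {j m : ℝ}
    (hx : x ∈ V) (c0 : C x y₀ y₁ r) (c1 : C x y₁ y₂ j) (c2 : C x y₂ y₀ m) (hj : j < r)
    (hm : m < r) (hsum : A r + A j + A m = 2 * Real.pi) :
    ∃ t, C (y₀ + y₁ - x) t y₁ r := by
  obtain ⟨d0, d1, d2⟩ := S.rhombus c0
  set u := y₀ + y₁ - x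
  have hy₁ := (S.memV c0 hx).2
  obtain ⟨a', e1⟩ := S.next c1
  have ha' := (S.memW e1 hy₁).1
  have gr := S.excess_r c0
  have gj := S.excess_gt c1 hj
  have lm := S.A_gt c2 hm
  obtain ⟨z, cz, hz⟩ | ⟨n, t, -, -, ct, -, ht, -⟩ := S.starW hy₁ e1 d2
  · exfalso
    obtain ⟨p, f1⟩ := S.next e1
    obtain ⟨q, f2⟩ := S.prev cz
    obtain ⟨h'', f3, hs⟩ := S.third ha' f1 f2
    have hzm : z < m := by
      by_contra! hcon
      linarith [S.D_le c2 cz hcon, S.D_lt c2, S.D_lt c0, S.D_lt c1]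
    linarith [S.antiA cz c2 hzm, S.A_le f3 c0 (S.le f3)]
  · obtain htr | rfl := (S.le ct).lt_or_eq
    · exfalso
      obtain htj | htj := le_or_gt t j
      · linarith [S.D_le ct c1 htj]
      · linarith [S.antiA c1 ct htj, S.excess_gt ct htr]
    · exact ⟨_, (S.rhombus ct).1⟩

lemma not_one_rhombic (S : CornerSystem C V W A D K r) {x y₀ y₁ y₂ : Euc 3} {j m : ℝ}
    (hx : x ∈ V) (c0 : C x y₀ y₁ r) (c1 : C x y₁ y₂ j) (c2 : C x y₂ y₀ m) (hj : j < r)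
    (hm : m < r) (hsum : A r + A j + A m = 2 * Real.pi) : False := by
  obtain ⟨t, ct⟩ := S.rhombic_neighbour hx c0 c1 c2 hj hm hsum
  obtain ⟨t', ct'⟩ := S.mirror.rhombic_neighbour hx c0 c2 c1 hm hj (by linarith)
  rw [add_comm y₁ y₀] at ct'
  obtain ⟨d0, d1, d2⟩ := S.rhombus c0
  have hu : y₀ + y₁ - x ∈ V := by
    obtain hu | hu := S.mem d1
    · exact hu
    · exact (S.memW d2 (S.memV c0 hx).2).2
  obtain ⟨s, cs, hs⟩ := S.third hu d1 ct'
  obtain ⟨-, rfl⟩ := S.left cs ct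
  linarith [S.A_gt c1 hj, S.A_gt c2 hm]

/-- At a vertex in `V` at most one corner is not rhombic. -/
lemma rhombic_of_lt (S : CornerSystem C V W A D K r) {x y z w : Euc 3} {h h' h'' : ℝ}
    (hx : x ∈ V) (c : C x y z h) (c' : C x z w h') (c'' : C x w y h'')
    (hs : A h + A h' + A h'' = 2 * Real.pi) (hr : h < r) : h' = r ∧ h'' = r := by
  obtain h1 | h1 := (S.le c').lt_or_eq <;> obtain h2 | h2 := (S.le c'').lt_or_eq
  · linarith [S.A_gt c hr, S.A_gt c' h1, S.A_gt c'' h2]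
  · subst h2
    exact (S.not_one_rhombic hx c'' c c' hr h1 (by linarith)).elim
  · subst h1
    exact (S.not_one_rhombic hx c' c'' c h2 hr (by linarith)).elim
  · exact ⟨h1, h2⟩

lemma exists_corner_mem (S : CornerSystem C V W A D K r) {x y z : Euc 3} {h : ℝ}
    (c : C x y z h) : ∃ x' y' z', x' ∈ V ∧ C x' y' z' h := by
  obtain hx | hx := S.mem c
  · exact ⟨x, y, z, hx, c⟩
  · obtain ⟨u, cu⟩ := S.next c
    exact ⟨_, _, _, (S.memW c hx).1, cu⟩

lemma exists_corner_mem' (S : CornerSystem C V W A D K r) {x y z : Euc 3} {h : ℝ}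
    (c : C x y z h) : ∃ x' y' z', x' ∈ W ∧ C x' y' z' h := by
  obtain hx | hx := S.mem c
  · obtain ⟨u, cu⟩ := S.next c
    exact ⟨_, _, _, (S.memV c hx).1, cu⟩
  · exact ⟨x, y, z, hx, c⟩

section Mixed

variable {m : ℝ} {x₀ y₀ z₀ : Euc 3}

lemma mixed_sum (S : CornerSystem C V W A D K r) {x y z : Euc 3} (c : C x y z m) (hm : m < r) :
    2 * A r + A m = 2 * Real.pi ∧ ∃ x y z, C x y z r := by
  obtain ⟨x, y, z, hx, c⟩ := S.exists_corner_mem c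
  obtain ⟨w, h', h'', c', c'', hs⟩ := S.starV hx c
  obtain ⟨rfl, rfl⟩ := S.rhombic_of_lt hx c c' c'' hs hm
  exact ⟨by linarith, _, _, _, c'⟩

lemma eq_or_eq (S : CornerSystem C V W A D K r) (c₀ : C x₀ y₀ z₀ m) (hm : m < r)
    {x y z : Euc 3} {h : ℝ} (c : C x y z h) : h = r ∨ h = m := by
  obtain h1 | h1 := (S.le c).lt_or_eq
  · have e1 := (S.mixed_sum c h1).1
    have e2 := (S.mixed_sum c₀ hm).1
    exact Or.inr (S.A_inj c c₀ (by linarith))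
  · exact Or.inl h1

/-- In a mixed corner system the angles at a vertex in `V` determine the third corner. -/
lemma third_of_rr (S : CornerSystem C V W A D K r) (c₀ : C x₀ y₀ z₀ m) (hm : m < r)
    {x y z w : Euc 3} (hx : x ∈ V) (c : C x y z r) (c' : C x z w r) : C x w y m := by
  obtain ⟨t, ct, hs⟩ := S.third hx c c'
  have e2 := (S.mixed_sum c₀ hm).1
  have := S.A_inj ct c₀ (by linarith)
  exact this ▸ ct

lemma third_of_rm (S : CornerSystem C V W A D K r) (c₀ : C x₀ y₀ z₀ m) (hm : m < r)
    {x y z w : Euc 3} (hx : x ∈ V) (c : C x y z r) (c' : C x z w m) : C x w y r := by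
  obtain ⟨t, ct, hs⟩ := S.third hx c c'
  have e2 := (S.mixed_sum c₀ hm).1
  have := S.A_inj ct c (by linarith)
  exact this ▸ ct

lemma not_adjacent (S : CornerSystem C V W A D K r) (hm : m < r)
    {v p x q : Euc 3} (hv : v ∈ W) (c : C v p x m) (c' : C v x q m) : False := by
  obtain ⟨u, cu⟩ := S.prev c
  obtain ⟨u', cu'⟩ := S.next c'
  have hx := (S.memW c hv).2
  obtain ⟨t, ct, hs⟩ := S.third hx cu' cu
  obtain ⟨e, y, z, w, cr⟩ := S.mixed_sum c hm
  linarith [S.antiA c cr hm, S.A_le ct cr (S.le ct)]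

/-- Three consecutive rhombic corners at a vertex in `W` force two non-rhombic corners at the
opposite vertex of the middle rhombus. -/
lemma opposite_of_rrr (S : CornerSystem C V W A D K r) (c₀ : C x₀ y₀ z₀ m) (hm : m < r)
    {v n1 n2 n3 n4 : Euc 3} (hv : v ∈ W) (c1 : C v n1 n2 r) (c2 : C v n2 n3 r)
    (c3 : C v n3 n4 r) :
    ∃ u q q', u ∈ W ∧ C u q n3 m ∧ C u n3 n2 r ∧ C u n2 q' m := by
  obtain ⟨d0, d1, d2⟩ := S.rhombus c2
  set u := n2 + n3 - v
  have h2 := (S.memW c2 hv).1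
  have h3 := (S.memW c2 hv).2
  obtain ⟨w, e1⟩ := S.next c3
  obtain ⟨w', e2⟩ := S.prev c1
  obtain ⟨q, f1⟩ := S.next (S.third_of_rr c₀ hm h3 e1 d2)
  obtain ⟨q', f2⟩ := S.prev (S.third_of_rr c₀ hm h2 d0 e2)
  exact ⟨u, q, q', (S.memV d0 h2).1, f1, d1, f2⟩

/-- A rhombic corner at a vertex in `W` between two non-rhombic ones forces three consecutive
rhombic corners at the opposite vertex. -/
lemma opposite_of_mrm (S : CornerSystem C V W A D K r) (c₀ : C x₀ y₀ z₀ m) (hm : m < r)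
    {v n1 n2 n3 n4 : Euc 3} (hv : v ∈ W) (c1 : C v n1 n2 m) (c2 : C v n2 n3 r)
    (c3 : C v n3 n4 m) :
    ∃ u q q', u ∈ W ∧ C u q n3 r ∧ C u n3 n2 r ∧ C u n2 q' r := by
  obtain ⟨d0, d1, d2⟩ := S.rhombus c2
  set u := n2 + n3 - v
  have h2 := (S.memW c2 hv).1
  have h3 := (S.memW c2 hv).2
  obtain ⟨w, e1⟩ := S.next c3
  obtain ⟨w', e2⟩ := S.prev c1
  obtain ⟨q', f2⟩ := S.prev (S.third_of_rm c₀ hm h2 d0 e2)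
  obtain ⟨q, f1⟩ := S.next (S.mirror.third_of_rm c₀ hm h3 d2 e1)
  exact ⟨u, q, q', (S.memV d0 h2).1, f1, d1, f2⟩

end Mixed

/-- Every vertex in `W` has a cyclic sequence of corners with total angle `2π`. -/
def HasCycles (C : Euc 3 → Euc 3 → Euc 3 → ℝ → Prop) (W : Set (Euc 3)) (D : ℝ → ℝ) : Prop :=
  ∀ {v p q h}, v ∈ W → C v p q h → ∃ (s : ℕ) (y : ℕ → Euc 3) (h : ℕ → ℝ), 3 ≤ s ∧ y 0 = p ∧
    y s = p ∧ (∀ j < s, C v (y j) (y (j + 1)) (h j)) ∧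
    ∑ j ∈ Finset.range s, D (h j) = 2 * Real.pi

section Mixed

variable {m : ℝ} {x₀ y₀ z₀ : Euc 3}

lemma not_adjacent_cycle (S : CornerSystem C V W A D K r) (hm : m < r)
    {v : Euc 3} {s : ℕ} {y : ℕ → Euc 3} {h : ℕ → ℝ} (hv : v ∈ W) (hy : y s = y 0)
    (hc : ∀ j < s, C v (y j) (y (j + 1)) (h j)) {i k : ℕ} (hi : i < s) (hk : k < s)
    (hik : k = i + 1 ∨ (i + 1 = s ∧ k = 0)) (him : h i = m) : h k = r := by
  have c₀ := hc i hi
  rw [him] at c₀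
  refine (S.eq_or_eq c₀ hm (hc k hk)).resolve_right fun hkm => ?_
  have c₁ := hc k hk
  rw [hkm] at c₁
  have e : y (i + 1) = y k := by
    obtain rfl | ⟨rfl, rfl⟩ := hik
    · rfl
    · exact hy
  rw [e] at c₀
  exact S.not_adjacent hm hv c₀ c₁

lemma not_adjacent_cycle' (S : CornerSystem C V W A D K r) (hm : m < r)
    {v : Euc 3} {s : ℕ} {y : ℕ → Euc 3} {h : ℕ → ℝ} (hv : v ∈ W) (hy : y s = y 0)
    (hc : ∀ j < s, C v (y j) (y (j + 1)) (h j)) {i k : ℕ} (hi : i < s) (hk : k < s)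
    (hik : k = i + 1 ∨ (i + 1 = s ∧ k = 0)) (hkm : h k = m) : h i = r := by
  have c₀ := hc k hk
  rw [hkm] at c₀
  refine (S.eq_or_eq c₀ hm (hc i hi)).resolve_right fun him => ?_
  have := S.not_adjacent_cycle hm hv hy hc hi hk hik him
  linarith

lemma four_le (S : CornerSystem C V W A D K r) (hm : m < r)
    {v : Euc 3} {s i : ℕ} {y : ℕ → Euc 3} {h : ℕ → ℝ} (hv : v ∈ W) (hs : 3 ≤ s)
    (hy : y s = y 0) (hc : ∀ j < s, C v (y j) (y (j + 1)) (h j))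
    (hsum : ∑ j ∈ Finset.range s, D (h j) = 2 * Real.pi) (hi : i < s) (him : h i = m) :
    4 ≤ s := by
  by_contra! hcon
  obtain rfl : s = 3 := by omega
  have c₀ := hc i hi
  rw [him] at c₀
  obtain ⟨e, x, y', z, cr⟩ := S.mixed_sum c₀ hm
  simp only [Finset.sum_range_succ, Finset.sum_range_zero, zero_add] at hsum
  have l := S.D_lt c₀
  have l' := S.D_lt cr
  have H : ∀ {i k : ℕ}, i < 3 → k < 3 → (k = i + 1 ∨ (i + 1 = 3 ∧ k = 0)) → h i = m → h k = r :=
    fun hi hk hik him => S.not_adjacent_cycle hm hv hy hc hi hk hik him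
  have H' : ∀ {i k : ℕ}, i < 3 → k < 3 → (k = i + 1 ∨ (i + 1 = 3 ∧ k = 0)) → h k = m → h i = r :=
    fun hi hk hik him => S.not_adjacent_cycle' hm hv hy hc hi hk hik him
  interval_cases i
  · rw [him, H (i := 0) (k := 1) (by simp) (by simp) (by simp) him,
      H' (i := 2) (k := 0) (by simp) (by simp) (by simp) him] at hsum
    linarith
  · rw [him, H (i := 1) (k := 2) (by simp) (by simp) (by simp) him,
      H' (i := 0) (k := 1) (by simp) (by simp) (by simp) him] at hsum
    linarith
  · rw [him, H (i := 2) (k := 0) (by simp) (by simp) (by simp) him,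
      H' (i := 1) (k := 2) (by simp) (by simp) (by simp) him] at hsum
    linarith

/-- Two non-rhombic corners at the same vertex in `W`. -/
lemma two_mixed (S : CornerSystem C V W A D K r) (hm : m < r)
    {v : Euc 3} {s i k : ℕ} {y : ℕ → Euc 3} {h : ℕ → ℝ} (hv : v ∈ W) (hs : 4 ≤ s)
    (hy : y s = y 0) (hc : ∀ j < s, C v (y j) (y (j + 1)) (h j))
    (hsum : ∑ j ∈ Finset.range s, D (h j) = 2 * Real.pi) (hi : i < s) (hk : k < s) (hik : i ≠ k)
    (him : h i = m) (hkm : h k = m) :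
    s = 4 ∧ (k = i + 2 ∨ i = k + 2) ∧ D m + D r = Real.pi ∧ D r < Real.pi / 2 ∧
      Real.pi / 3 < D r ∧ K m 3 := by
  have c₀ := hc i hi
  rw [him] at c₀
  obtain ⟨e, x, y', z, cr⟩ := S.mixed_sum c₀ hm
  have hrm := S.antiD c₀ cr hm
  have hle : s * D r + 2 * (D m - D r) ≤ 2 * Real.pi := by
    have h1 : ∑ j ∈ ({i, k} : Finset ℕ), (D (h j) - D r) ≤
        ∑ j ∈ Finset.range s, (D (h j) - D r) := by
      apply Finset.sum_le_sum_of_subset_of_nonneg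
      · intro j hj
        simp only [Finset.mem_insert, Finset.mem_singleton] at hj
        rw [Finset.mem_range]; omega
      · intro j hj _
        have hj := hc j (Finset.mem_range.1 hj)
        linarith [S.D_le hj cr (S.le hj)]
    rw [Finset.sum_pair hik, him, hkm, Finset.sum_sub_distrib, hsum] at h1
    simp at h1
    linarith
  have gr := S.excess_r cr
  have lA := S.A_lt c₀
  obtain ⟨k', hk', hK, hex⟩ := S.excess c₀ hm
  have hs' : (4 : ℝ) ≤ s := by exact_mod_cast hs
  have hDr : 0 < D r := by linarith [S.antiA c₀ cr hm]
  have hle4 : D m + D r ≤ Real.pi := by nlinarith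
  have hk3 : k' = 3 := by
    by_contra hne
    have : (4 : ℝ) ≤ k' := by exact_mod_cast (by omega : 4 ≤ k')
    have : Real.pi / k' ≤ Real.pi / 4 :=
      div_le_div_of_nonneg_left Real.pi_pos.le (by norm_num) this
    linarith
  subst hk3
  push_cast at hex
  have hDr3 : Real.pi / 3 < D r := by linarith [S.A_gt c₀ hm]
  have hs4 : s = 4 := by
    by_contra hne
    have : (5 : ℝ) ≤ s := by exact_mod_cast (by omega : 5 ≤ s)
    nlinarith
  subst hs4
  have H : ∀ {i k : ℕ}, i < 4 → k < 4 → (k = i + 1 ∨ (i + 1 = 4 ∧ k = 0)) → h i = m → h k = r :=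
    fun hi hk hik him => S.not_adjacent_cycle hm hv hy hc hi hk hik him
  have hki : k = i + 2 ∨ i = k + 2 := by
    by_contra! hcon
    obtain hcase | hcase : (k = i + 1 ∨ (i + 1 = 4 ∧ k = 0)) ∨
        (i = k + 1 ∨ (k + 1 = 4 ∧ i = 0)) := by
      omega
    · linarith [H hi hk hcase him]
    · linarith [H hk hi hcase hkm]
  have H4 : D (h 0) + D (h 1) + D (h 2) + D (h 3) = 2 * (D m + D r) := by
    obtain ⟨h0, h2⟩ | ⟨h1, h3⟩ : (h 0 = m ∧ h 2 = m) ∨ (h 1 = m ∧ h 3 = m) := by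
      obtain rfl | rfl := hki
      · obtain rfl | rfl : i = 0 ∨ i = 1 := by omega
        · exact Or.inl ⟨him, hkm⟩
        · exact Or.inr ⟨him, hkm⟩
      · obtain rfl | rfl : k = 0 ∨ k = 1 := by omega
        · exact Or.inl ⟨hkm, him⟩
        · exact Or.inr ⟨hkm, him⟩
    · rw [h0, h2, H (i := 0) (k := 1) (by simp) (by simp) (by simp) h0,
        H (i := 2) (k := 3) (by simp) (by simp) (by simp) h2]
      ring
    · rw [h1, h3, H (i := 1) (k := 2) (by simp) (by simp) (by simp) h1,
        H (i := 3) (k := 0) (by simp) (by simp) (by simp) h3]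
      ring
  simp only [Finset.sum_range_succ, Finset.sum_range_zero, zero_add] at hsum
  exact ⟨rfl, hki, by linarith, by linarith, hDr3, hK⟩

/-- Three consecutive rhombic corners at a vertex in `W` determine the angles. -/
lemma five_of_rrr (S : CornerSystem C V W A D K r) (hcyc : HasCycles C W D) (c₀ : C x₀ y₀ z₀ m)
    (hm : m < r) (h1 : D m + D r = Real.pi) (h2 : D r < Real.pi / 2) (h3 : Real.pi / 3 < D r)
    {v n1 n2 n3 n4 : Euc 3} (hv : v ∈ W) (c1 : C v n1 n2 r) (c2 : C v n2 n3 r)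
    (c3 : C v n3 n4 r) : 5 * D r = 2 * Real.pi := by
  obtain ⟨s, y, h, hs, hy0, hys, hc, hsum⟩ := hcyc hv c2
  have pi0 := Real.pi_pos
  have e0 : h 0 = r := by
    have := hc 0 (by omega)
    rw [hy0] at this
    exact (S.right this c2).2
  have f0 : y 1 = n3 := by
    have := hc 0 (by omega)
    rw [hy0] at this
    exact (S.right this c2).1
  have e1 : h 1 = r := by
    have := hc 1 (by omega)
    rw [f0] at this
    exact (S.right this c3).2
  have e2 : h (s - 1) = r := by
    have := hc (s - 1) (by omega)
    rw [Nat.sub_add_cancel (by omega), hys] at this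
    exact (S.left this c1).2
  by_cases hall : ∀ j < s, h j = r
  · rw [Finset.sum_congr rfl fun j hj => by rw [hall j (Finset.mem_range.1 hj)]] at hsum
    simp only [Finset.sum_const, Finset.card_range, nsmul_eq_mul] at hsum
    have l1 : 4 < s := by
      by_contra! hcon
      have : (s : ℝ) ≤ 4 := by exact_mod_cast hcon
      nlinarith
    have l2 : s < 6 := by
      by_contra! hcon
      have : (6 : ℝ) ≤ s := by exact_mod_cast hcon
      nlinarith
    obtain rfl : s = 5 := by omega
    exact_mod_cast hsum
  · exfalso
    push Not at hall
    obtain ⟨i, hi, hir⟩ := hall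
    have him := (S.eq_or_eq c₀ hm (hc i hi)).resolve_left hir
    have i0 : i ≠ 0 := by rintro rfl; exact hir e0
    have i1 : i ≠ 1 := by rintro rfl; exact hir e1
    have i2 : i ≠ s - 1 := by rintro rfl; exact hir e2
    have hle : s * D r + (D m - D r) ≤ 2 * Real.pi := by
      have h1 : ∑ j ∈ ({i} : Finset ℕ), (D (h j) - D r) ≤
          ∑ j ∈ Finset.range s, (D (h j) - D r) := by
        apply Finset.sum_le_sum_of_subset_of_nonneg
        · intro j hj
          simp only [Finset.mem_singleton] at hj
          rw [Finset.mem_range]; omega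
        · intro j hj _
          have hj := hc j (Finset.mem_range.1 hj)
          linarith [S.D_le hj c1 (S.le hj)]
      rw [Finset.sum_singleton, him, Finset.sum_sub_distrib, hsum] at h1
      simp at h1
      linarith
    have l1 : s < 5 := by
      by_contra! hcon
      have : (5 : ℝ) ≤ s := by exact_mod_cast hcon
      nlinarith
    obtain rfl : s = 4 := by omega
    obtain rfl : i = 2 := by omega
    simp only [Finset.sum_range_succ, Finset.sum_range_zero, zero_add] at hsum
    norm_num at e2
    rw [e0, e1, e2, him] at hsum
    linarith

/-- The angles of a corner system with a non-rhombic facet. -/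
theorem angles_of_mixed (S : CornerSystem C V W A D K r) (hcyc : HasCycles C W D)
    (c₀ : C x₀ y₀ z₀ m) (hm : m < r) :
    5 * D r = 2 * Real.pi ∧ D m + D r = Real.pi ∧ 2 * A r + A m = 2 * Real.pi ∧ K m 3 := by
  obtain ⟨v, p, q, hv, c⟩ := S.exists_corner_mem' c₀
  have key : ∃ v n1 n2 n3 n4, v ∈ W ∧ C v n1 n2 m ∧ C v n2 n3 r ∧ C v n3 n4 m ∧
      D m + D r = Real.pi ∧ D r < Real.pi / 2 ∧ Real.pi / 3 < D r ∧ K m 3 := by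
    obtain ⟨s, y, h, hs, hy0, hys, hc, hsum⟩ := hcyc hv c
    have hy : y s = y 0 := by rw [hy0, hys]
    have e0 : h 0 = m := by
      have := hc 0 (by omega)
      rw [hy0] at this
      exact (S.right this c).2
    have hs4 := S.four_le hm hv hs hy hc hsum (by omega) e0
    by_cases hall : ∀ j < s, j ≠ 0 → h j = r
    · have c1 := hc 1 (by omega)
      have c2 := hc 2 (by omega)
      have c3 := hc 3 (by omega)
      rw [hall 1 (by omega) (by omega)] at c1
      rw [hall 2 (by omega) (by omega)] at c2
      rw [hall 3 (by omega) (by omega)] at c3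
      obtain ⟨u, q1, q2, hu, d1, d2, d3⟩ := S.opposite_of_rrr c₀ hm hv c1 c2 c3
      obtain ⟨s', y', h', hs', hy0', hys', hc', hsum'⟩ := hcyc hu d2
      have hy' : y' s' = y' 0 := by rw [hy0', hys']
      have f0 := hc' 0 (by omega)
      rw [hy0'] at f0
      have f1 := hc' 1 (by omega)
      rw [(S.right f0 d2).1] at f1
      have g1 := (S.right f1 d3).2
      have f2 := hc' (s' - 1) (by omega)
      rw [Nat.sub_add_cancel (by omega), hys'] at f2
      have g2 := (S.left f2 d1).2
      have hs4' := S.four_le hm hu hs' hy' hc' hsum' (by omega) g1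
      obtain ⟨-, -, h1, h2, h3, h4⟩ := S.two_mixed hm hu hs4' hy' hc' hsum' (i := 1) (k := s' - 1)
        (by omega) (by omega) (by omega) g1 g2
      exact ⟨u, _, _, _, _, hu, d1, d2, d3, h1, h2, h3, h4⟩
    · push Not at hall
      obtain ⟨i, hi, hi0, hir⟩ := hall
      have him := (S.eq_or_eq c₀ hm (hc i hi)).resolve_left hir
      obtain ⟨rfl, hi2, h1, h2, h3, h4⟩ := S.two_mixed hm hv hs4 hy hc hsum (i := 0) (k := i)
        (by omega) (by omega) (by omega) e0 him
      obtain rfl : i = 2 := by omega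
      have c1 := hc 1 (by omega)
      rw [S.not_adjacent_cycle hm hv hy hc (i := 0) (k := 1) (by omega) (by omega) (by omega) e0]
        at c1
      exact ⟨v, _, _, _, _, hv, e0 ▸ hc 0 (by omega), c1, him ▸ hc 2 (by omega), h1, h2, h3, h4⟩
  obtain ⟨v, n1, n2, n3, n4, hv, c1, c2, c3, h1, h2, h3, h4⟩ := key
  obtain ⟨u, q1, q2, hu, d1, d2, d3⟩ := S.opposite_of_mrm c₀ hm hv c1 c2 c3
  exact ⟨S.five_of_rrr hcyc c₀ hm h1 h2 h3 hu d1 d2 d3, h1, (S.mixed_sum c₀ hm).1, h4⟩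

end Mixed
end CornerSystem

namespace Bip

variable {P V W : Set (Euc 3)} {a b c : ℝ}

lemma cor_mem (B : Bip P V W a b c) {x y z : Euc 3} {h : ℝ} (C : Cor P x y z h) :
    x ∈ V ∨ x ∈ W := by
  obtain ⟨n, C⟩ := C
  obtain h | h := B.edge _ _ C.exy
  · exact Or.inl h.1
  · exact Or.inr h.1

lemma cor_mem_of_mem (B : Bip P V W a b c) {x y z : Euc 3} {h : ℝ} (C : Cor P x y z h)
    (hx : x ∈ V) : y ∈ W ∧ z ∈ W := by
  obtain ⟨n, C⟩ := C
  exact ⟨B.corner_yW hx C, B.corner_zW hx C⟩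

lemma cor_sq_le (B : Bip P V W a b c) (hab : a < b) {x y z : Euc 3} {h : ℝ} (hx : x ∈ V)
    (C : Cor P x y z h) : h ^ 2 ≤ c := by
  obtain ⟨k, hk, e⟩ := B.cor_angle hab hx C
  have hk' : (2 : ℝ) ≤ k := by exact_mod_cast hk
  have : 0 ≤ Real.cos (Real.pi / k) := by
    apply Real.cos_nonneg_of_mem_Icc
    have : Real.pi / k ≤ Real.pi / 2 :=
      div_le_div_of_nonneg_left Real.pi_pos.le (by norm_num) hk'
    have : 0 ≤ Real.pi / k := by positivity
    constructor <;> linarith [Real.pi_pos]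
  have := mul_nonneg (Real.sqrt_nonneg ((a - h ^ 2) * (b - h ^ 2))) this
  linarith

lemma cor_angle_gt (B : Bip P V W a b c) (hab : a < b) {x y z : Euc 3} {h : ℝ} (hx : x ∈ V)
    (C : Cor P x y z h) : Real.pi / 2 < vertexAngle a b c h := by
  obtain hh | hh := le_or_gt h 0
  · linarith [vertexAngle_ge_pi (b := b) B.ca hh, Real.pi_pos]
  · exact vertexAngle_gt_pi_div_two B.ca hab hh (B.cor_sq_le hab hx C)

lemma vertex_three (B : Bip P V W a b c) (hab : a < b) {x y z : Euc 3} {h : ℝ} (hx : x ∈ V)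
    (C : Cor P x y z h) : 0 < h ∧ ∃ w h' h'', Cor P x z w h' ∧ Cor P x w y h'' ∧
      (∀ m, IsEdge P x m → m = y ∨ m = z ∨ m = w) ∧
      vertexAngle a b c h + vertexAngle a b c h' + vertexAngle a b c h'' = 2 * Real.pi := by
  have hy : IsEdge P x y := C.choose_spec.exy
  obtain ⟨s, u, g, hs, u0, us, -, hall, -, hc, hsum⟩ := B.vertex_cycle hx hy
  have hs3 : s = 3 := by
    by_contra hne
    have h4 : (4 : ℝ) ≤ s := by exact_mod_cast (by omega : 4 ≤ s)
    have : ∑ j ∈ Finset.range s, Real.pi / 2 < ∑ j ∈ Finset.range s, vertexAngle a b c (g j) :=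
      Finset.sum_lt_sum_of_nonempty (by simp; omega)
        fun j hj => B.cor_angle_gt hab hx (hc j (Finset.mem_range.1 hj))
    simp only [Finset.sum_const, Finset.card_range, nsmul_eq_mul] at this
    nlinarith [Real.pi_pos]
  subst hs3
  have c0 := hc 0 (by omega)
  have c1 := hc 1 (by omega)
  have c2 := hc 2 (by omega)
  norm_num at c0 c1 c2
  rw [us] at c2
  rw [u0] at c0
  obtain ⟨e1, e2⟩ := B.cor_unique_right hx C c0
  rw [← e1] at c1
  simp only [Finset.sum_range_succ, Finset.sum_range_zero, zero_add] at hsum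
  rw [← e2] at hsum
  refine ⟨?_, u 2, g 1, g 2, c1, c2, fun m hm => ?_, hsum⟩
  · by_contra! hh
    linarith [vertexAngle_ge_pi (b := b) B.ca hh, B.cor_angle_gt hab hx c1,
      B.cor_angle_gt hab hx c2]
  · obtain ⟨j, hj, rfl⟩ := hall m hm
    interval_cases j
    · exact Or.inl u0
    · exact Or.inr (Or.inl e1.symm)
    · exact Or.inr (Or.inr rfl)

lemma exists_cor_mem (B : Bip P V W a b c) {x y z : Euc 3} {h : ℝ} (C : Cor P x y z h) :
    ∃ x' y' z', x' ∈ V ∧ Cor P x' y' z' h := by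
  obtain hx | hx := B.cor_mem C
  · exact ⟨x, y, z, hx, C⟩
  · obtain ⟨u, C'⟩ := B.symm.cor_next hx C
    exact ⟨_, _, _, (B.symm.cor_mem_of_mem C hx).1, C'⟩

lemma cor_height (B : Bip P V W a b c) (hab : a < b) {x y z : Euc 3} {h : ℝ}
    (C : Cor P x y z h) : 0 < h ∧ h ^ 2 ≤ c := by
  obtain ⟨x, y, z, hx, C⟩ := B.exists_cor_mem C
  exact ⟨(B.vertex_three hab hx C).1, B.cor_sq_le hab hx C⟩

lemma hasCycles (B : Bip P V W a b c) :
    CornerSystem.HasCycles (Cor P) W (fun h => vertexAngle b a c h) := by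
  intro v p q h hv C
  obtain ⟨s, u, g, hs, u0, us, -, -, -, hc, hsum⟩ :=
    B.symm.vertex_cycle hv C.choose_spec.exy
  exact ⟨s, u, g, hs, u0, us, hc, hsum⟩

lemma cornerSystem (B : Bip P V W a b c) (hab : a < b) :
    CornerSystem (Cor P) V W (fun h => vertexAngle a b c h) (fun h => vertexAngle b a c h)
      (fun h k => c - h ^ 2 = Real.sqrt ((a - h ^ 2) * (b - h ^ 2)) * Real.cos (Real.pi / k))
      (Real.sqrt c) where
  mem C := B.cor_mem C
  memV C hx := B.cor_mem_of_mem C hx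
  memW C hx := B.symm.cor_mem_of_mem C hx
  next C := (B.cor_mem C).elim (fun hx => B.cor_next hx C) fun hx => B.symm.cor_next hx C
  prev C := (B.cor_mem C).elim (fun hx => B.cor_prev hx C) fun hx => B.symm.cor_prev hx C
  rhombus C := by
    have hc : Real.sqrt c ^ 2 = c := by
      obtain ⟨h1, h2⟩ := B.cor_height hab C
      exact Real.sq_sqrt (le_trans (sq_nonneg _) h2)
    exact (B.cor_mem C).elim (fun hx => (B.cor_rhombus hx C hc).2)
      fun hx => (B.symm.cor_rhombus hx C hc).2
  right C C' := (B.cor_mem C).elim (fun hx => B.cor_unique_right hx C C')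
    fun hx => B.symm.cor_unique_right hx C C'
  left C C' := (B.cor_mem C).elim (fun hx => B.cor_unique_left hx C C')
    fun hx => B.symm.cor_unique_left hx C C'
  le C := Real.le_sqrt_of_sq_le (B.cor_height hab C).2
  starV hx C := by
    obtain ⟨-, w, h', h'', c1, c2, -, e⟩ := B.vertex_three hab hx C
    exact ⟨w, h', h'', c1, c2, e⟩
  starW := by
    intro v p x q h h' hv C C'
    obtain ⟨s, u, g, hs, u0, us, hc, hsum⟩ := B.hasCycles hv C'
    have c0 := hc 0 (by omega)
    rw [u0] at c0
    obtain ⟨e0, f0⟩ := B.symm.cor_unique_right hv c0 C'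
    have c1 := hc 1 (by omega)
    rw [e0] at c1
    have c2 := hc (s - 1) (by omega)
    rw [Nat.sub_add_cancel (by omega), us] at c2
    obtain ⟨e2, f2⟩ := B.symm.cor_unique_left hv c2 C
    obtain rfl | hs4 := hs.eq_or_lt
    · left
      refine ⟨g 1, ?_, ?_⟩
      · norm_num at e2
        norm_num [e2] at c1
        exact c1
      · simp only [Finset.sum_range_succ, Finset.sum_range_zero, zero_add] at hsum
        norm_num at f2
        rw [f0, f2] at hsum
        linarith
    · right
      have c3 := hc (s - 2) (by omega)
      rw [show s - 2 + 1 = s - 1 by omega, e2] at c3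
      have hpos : ∀ j < s, 0 < vertexAngle b a c (g j) := fun j hj => by
        obtain ⟨h1, h2⟩ := B.cor_height hab (hc j hj)
        rw [vertexAngle_eq]
        have := Real.arccos_pos.2 (vertexCos_lt_one B.cb B.ca h1 h2)
        linarith
      have hge : ∀ j < s, vertexAngle b a c (Real.sqrt c) ≤ vertexAngle b a c (g j) :=
        fun j hj => by
          obtain ⟨h1, h2⟩ := B.cor_height hab (hc j hj)
          obtain e | e := (Real.le_sqrt_of_sq_le h2).lt_or_eq
          · exact (vertexAngle_anti B.cb B.ca h1 e
              (Real.sq_sqrt (le_trans (sq_nonneg _) h2)).le).le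
          · rw [e]
      have key : ∀ i k, i < s → k < s → i ≠ 0 → i ≠ s - 1 → k ≠ 0 → k ≠ s - 1 → i ≠ k →
          vertexAngle b a c h + vertexAngle b a c h' + vertexAngle b a c (g i) +
            vertexAngle b a c (Real.sqrt c) ≤ 2 * Real.pi := by
        intro i k hi hk i0 i1 k0 k1 hik
        have h1 : ∑ j ∈ ({s - 1, 0, i, k} : Finset ℕ), vertexAngle b a c (g j) ≤
            ∑ j ∈ Finset.range s, vertexAngle b a c (g j) := by
          apply Finset.sum_le_sum_of_subset_of_nonneg
          · intro j hj
            simp only [Finset.mem_insert, Finset.mem_singleton] at hj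
            rw [Finset.mem_range]; omega
          · exact fun j hj _ => (hpos j (Finset.mem_range.1 hj)).le
        rw [Finset.sum_insert (by simp; omega), Finset.sum_insert (by simp; omega),
          Finset.sum_pair hik, hsum, f0, f2] at h1
        linarith [hge k hk]
      exact ⟨u 2, g 1, u (s - 2), g (s - 2), c1, c3,
        key 1 2 (by omega) (by omega) (by omega) (by omega) (by omega) (by omega) (by omega),
        key (s - 2) 1 (by omega) (by omega) (by omega) (by omega) (by omega) (by omega) (by omega)⟩
  antiA C C' hlt := vertexAngle_anti B.ca B.cb (B.cor_height hab C).1 hlt (B.cor_height hab C').2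
  antiD C C' hlt := vertexAngle_anti B.cb B.ca (B.cor_height hab C).1 hlt (B.cor_height hab C').2
  D_lt C := vertexAngle_swap_lt B.ca hab (B.cor_height hab C).1 (B.cor_height hab C).2
  A_lt C := vertexAngle_lt_pi B.ca B.cb (B.cor_height hab C).1 (B.cor_height hab C).2
  excess_r C := by
    obtain ⟨h1, h2⟩ := B.cor_height hab C
    have h3 : Real.sqrt c ^ 2 = c := Real.sq_sqrt (le_trans (sq_nonneg _) h2)
    have := vertexAngle_add_gt (θ := Real.pi / 2) B.ca B.cb h1 h2 (by positivity)
      (by rw [h3, Real.cos_pi_div_two]; ring)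
    linarith
  excess := by
    intro x y z h C hlt
    obtain ⟨h1, h2⟩ := B.cor_height hab C
    obtain ⟨x, y, z, hx, C⟩ := B.exists_cor_mem C
    obtain ⟨k, hk, e⟩ := B.cor_angle hab hx C
    have hk3 : 3 ≤ k := by
      by_contra hcon
      obtain rfl : k = 2 := by omega
      push_cast at e
      rw [Real.cos_pi_div_two, mul_zero] at e
      have := Real.lt_sqrt h1.le |>.1 hlt
      linarith
    exact ⟨k, hk3, e, vertexAngle_add_gt B.ca B.cb h1 h2 (by positivity) e⟩

end Bip

/-- An auxiliary system of equations without solution. -/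
lemma no_mixed_solution {s α β e : ℝ} (hs : s ^ 2 = 5) (hs0 : 0 < s) (hα : 0 < α) (hβ : 0 < β)
    (h1 : 8 * β = (3 + s) * (α * β + α + β))
    (h2 : 8 * (β ^ 2 * (1 - e)) = (5 - s) * ((α * β + α + β) * (β + e)))
    (h3 : α ^ 2 * (1 - e) * (α * β + α + β) = (β + α * β - α) ^ 2 * (α + e))
    (h4 : 4 * e ^ 2 = (α + e) * (β + e)) : False := by
  set τ := 5 - 2 * s with hτ
  have hs1 : 2.23606 < s := by nlinarith
  have hs2 : s < 2.23607 := by nlinarith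
  have hτ2 : τ ^ 2 = 10 * τ - 5 := by rw [hτ]; nlinarith
  have hN : 0 < α * β + α + β := by positivity
  have e1 : α * (β + 1) = τ * β := by
    have : (3 + s) * (α * (β + 1) - τ * β) = 0 := by rw [hτ]; linear_combination -h1 + 2 * β * hs
    have h0 : (3 + s) ≠ 0 := by positivity
    linarith [(mul_eq_zero.1 this).resolve_left h0]
  have e2 : e * (β + τ) = β * (1 - τ) := by
    have h5 : (α * β + α + β) * ((3 + s) * (β * (1 - e))) =
        (α * β + α + β) * ((5 - s) * (β + e)) := by
      linear_combination h2 - β * (1 - e) * h1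
    have h6 := mul_left_cancel₀ hN.ne' h5
    have : (3 + s) * (e * (β + τ) - β * (1 - τ)) = 0 := by
      rw [hτ]; linear_combination -h6 - 2 * (e + β) * hs
    have h0 : (3 + s) ≠ 0 := by positivity
    linarith [(mul_eq_zero.1 this).resolve_left h0]
  have hτ0 : 0 < τ := by rw [hτ]; linarith
  have ea : α = τ * β / (β + 1) := by field_simp; linarith
  have ee : e = β * (1 - τ) / (β + τ) := by field_simp; linarith
  have hb : β = 23 * τ - 12 := by
    have f1 : α * (β + 1) * (β + τ) = τ * β * (β + τ) := by rw [e1]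
    have f2 : e * (β + τ) * (β + 1) = β * (1 - τ) * (β + 1) := by rw [e2]
    have f3 : (α + e) * (β + 1) * (β + τ) = β * (β + 1 - τ + τ ^ 2) := by
      linear_combination f1 + f2
    have f4 : (β + e) * (β + τ) = β * (β + 1) := by linear_combination e2
    have f5 : e ^ 2 * (β + τ) ^ 2 = β ^ 2 * (1 - τ) ^ 2 := by
      rw [← mul_pow, e2]; ring
    have f6 : β ^ 2 * (β + 1) * (β + 1 - τ + τ ^ 2 - 4 * (1 - τ) ^ 2) = 0 := by
      linear_combination 4 * (β + 1) * f5 - (β + 1) * (β + τ) ^ 2 * h4 -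
        (β * (β + 1)) * f3 - (α + e) * (β + 1) * (β + τ) * f4
    have h0 : β ^ 2 * (β + 1) ≠ 0 := by positivity
    linarith [(mul_eq_zero.1 f6).resolve_left h0]
  have b1 : 0.1405 < β := by rw [hb, hτ]; linarith
  have b2 : β < 0.1414 := by rw [hb, hτ]; linarith
  have t1 : 0.5278 < τ := by rw [hτ]; linarith
  have t2 : τ < 0.5279 := by rw [hτ]; linarith
  have q1 : τ * β < 0.5279 * 0.1414 := mul_lt_mul'' t2 b2 hτ0.le hβ.le
  have q2 : 0.5278 * 0.1405 < τ * β := mul_lt_mul'' t1 b1 (by norm_num) (by norm_num)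
  have a2 : α < 0.0655 := by
    rw [ea, div_lt_iff₀ (by linarith)]; linarith
  have a1 : 0.064 < α := by
    rw [ea, lt_div_iff₀ (by linarith)]; linarith
  have g1 : 0.098 < e := by
    rw [ee, lt_div_iff₀ (by linarith)]; linarith
  have g2 : e < 0.1005 := by
    rw [ee, div_lt_iff₀ (by linarith)]; linarith
  have q3 : α * β < 0.0655 * 0.1414 := mul_lt_mul'' a2 b2 hα.le hβ.le
  have q4 : 0.064 * 0.1405 < α * β := mul_lt_mul'' a1 b1 (by norm_num) (by norm_num)
  have q5 : α ^ 2 < 0.0655 ^ 2 := pow_lt_pow_left₀ a2 hα.le (by norm_num)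
  have q6 : α ^ 2 * (1 - e) < 0.0655 ^ 2 * 0.902 :=
    mul_lt_mul'' q5 (by linarith) (by positivity) (by linarith)
  have p1 : α ^ 2 * (1 - e) * (α * β + α + β) < 0.0655 ^ 2 * 0.902 * 0.2163 :=
    mul_lt_mul'' q6 (by linarith) (mul_nonneg (by positivity) (by linarith)) hN.le
  have q7 : 0.0839 ^ 2 < (β + α * β - α) ^ 2 :=
    pow_lt_pow_left₀ (by linarith) (by norm_num) (by norm_num)
  have p2 : 0.0839 ^ 2 * 0.162 < (β + α * β - α) ^ 2 * (α + e) :=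
    mul_lt_mul'' q7 (by linarith) (by norm_num) (by norm_num)
  norm_num at p1 p2
  linarith

lemma no_mixed_heights {s a b c H : ℝ} (hs : s ^ 2 = 5) (hs0 : 0 < s) (hc : 0 < c)
    (hca : c < a) (hcb : c < b) (hH : H < c)
    (v1 : (b - c) ^ 2 * c / ((a * b - c ^ 2) * (b - c)) = ((1 + s) / 4) ^ 2)
    (v2 : (b - c) ^ 2 * H / ((a * b - c ^ 2) * (b - H)) = 1 - ((1 + s) / 4) ^ 2)
    (v4 : (1 - 2 * ((a - c) ^ 2 * c / ((a * b - c ^ 2) * (a - c)))) ^ 2 =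
      (a - c) ^ 2 * H / ((a * b - c ^ 2) * (a - H)))
    (u4 : 4 * (c - H) ^ 2 = (a - H) * (b - H)) : False := by
  obtain ⟨α, hα⟩ : ∃ α, a = c * (1 + α) := ⟨a / c - 1, by field_simp; ring⟩
  obtain ⟨β, hβ⟩ : ∃ β, b = c * (1 + β) := ⟨b / c - 1, by field_simp; ring⟩
  obtain ⟨e, he⟩ : ∃ e, H = c * (1 - e) := ⟨1 - H / c, by field_simp; ring⟩
  have hα0 : 0 < α := by nlinarith
  have hβ0 : 0 < β := by nlinarith
  have he0 : 0 < e := by nlinarith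
  have hNe : a * b - c ^ 2 = c ^ 2 * (α * β + α + β) := by rw [hα, hβ]; ring
  have k1 : a - c = c * α := by rw [hα]; ring
  have k2 : b - c = c * β := by rw [hβ]; ring
  have k3 : a - H = c * (α + e) := by rw [hα, he]; ring
  have k4 : b - H = c * (β + e) := by rw [hβ, he]; ring
  have k5 : c - H = c * e := by rw [he]; ring
  have hn : 0 < α * β + α + β := by positivity
  have hae : 0 < α + e := by positivity
  have hbe : 0 < β + e := by positivity
  rw [hNe, k2] at v1
  rw [hNe, k2, k4, he] at v2
  rw [hNe, k1, k3, he] at v4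
  rw [k3, k4, k5] at u4
  have w1 : 8 * β = (3 + s) * (α * β + α + β) := by
    have e1 : (c * β) ^ 2 * c / (c ^ 2 * (α * β + α + β) * (c * β)) = β / (α * β + α + β) := by
      field_simp
    rw [e1, div_eq_iff hn.ne'] at v1
    linear_combination 8 * v1 + (α * β + α + β) / 2 * hs
  have w2 : 8 * (β ^ 2 * (1 - e)) = (5 - s) * ((α * β + α + β) * (β + e)) := by
    have e1 : (c * β) ^ 2 * (c * (1 - e)) / (c ^ 2 * (α * β + α + β) * (c * (β + e))) =
        β ^ 2 * (1 - e) / ((α * β + α + β) * (β + e)) := by field_simp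
    rw [e1, div_eq_iff (mul_pos hn hbe).ne'] at v2
    linear_combination 8 * v2 - (α * β + α + β) * (β + e) / 2 * hs
  have w3 : α ^ 2 * (1 - e) * (α * β + α + β) = (β + α * β - α) ^ 2 * (α + e) := by
    have e1 : (c * α) ^ 2 * (c * (1 - e)) / (c ^ 2 * (α * β + α + β) * (c * (α + e))) =
        α ^ 2 * (1 - e) / ((α * β + α + β) * (α + e)) := by field_simp
    have e2 : 1 - 2 * ((c * α) ^ 2 * c / (c ^ 2 * (α * β + α + β) * (c * α))) =
        (β + α * β - α) / (α * β + α + β) := by field_simp; ring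
    rw [e1, e2, div_pow, div_eq_div_iff (by positivity) (by positivity)] at v4
    have h0 : α * β + α + β ≠ 0 := hn.ne'
    apply mul_left_cancel₀ h0
    linear_combination -v4
  have w4 : 4 * e ^ 2 = (α + e) * (β + e) := by
    have : c ^ 2 * (4 * e ^ 2) = c ^ 2 * ((α + e) * (β + e)) := by linear_combination u4
    exact mul_left_cancel₀ (by positivity) this
  exact no_mixed_solution hs hs0 hα0 hβ0 w1 w2 w3 w4

namespace Bip

variable {P V W : Set (Euc 3)} {a b c : ℝ}

/-- All facets of a strictly bipartite polyhedron are rhombi. -/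
theorem cor_sq_eq (B : Bip P V W a b c) (hab : a < b) {x y z : Euc 3} {m : ℝ}
    (C : Cor P x y z m) : m = Real.sqrt c := by
  obtain ⟨hm, hmc⟩ := B.cor_height hab C
  by_contra hne
  have hlt := lt_of_le_of_ne (Real.le_sqrt_of_sq_le hmc) hne
  have hmc' := (Real.lt_sqrt hm.le).1 hlt
  obtain ⟨h1, h2, h3, h4⟩ := (B.cornerSystem hab).angles_of_mixed B.hasCycles C hlt
  have hm2 : 0 < m ^ 2 := by positivity
  have hc : 0 < c := hm2.trans hmc'
  have hca := B.ca
  have hcb := B.cb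
  have hr : 0 < Real.sqrt c := Real.sqrt_pos.2 hc
  have hrc : Real.sqrt c ^ 2 = c := Real.sq_sqrt hc.le
  obtain ⟨ha, hb, ham, hD⟩ := vertexAngle_pos hca hcb hm hmc
  obtain ⟨-, -, hbm, -⟩ := vertexAngle_pos hcb hca hm hmc
  have hN : 0 < a * b - c ^ 2 := hD
  have hba : b * a - c ^ 2 = a * b - c ^ 2 := by ring
  -- translate the angles into cosines
  have u1 : vertexCos b a c (Real.sqrt c) = (1 + Real.sqrt 5) / 4 := by
    have := vertexCos_lt_one hcb hca hr hrc.le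
    have := vertexCos_pos hcb hca hr hrc.le
    rw [← Real.cos_arccos (by linarith : -1 ≤ vertexCos b a c (Real.sqrt c)) (by linarith),
      ← Real.cos_pi_div_five]
    rw [vertexAngle_eq] at h1
    congr 1; linarith
  have u2 : vertexCos b a c m ^ 2 = 1 - ((1 + Real.sqrt 5) / 4) ^ 2 := by
    have := vertexCos_lt_one hcb hca hm hmc
    have := vertexCos_pos hcb hca hm hmc
    rw [← Real.cos_arccos (by linarith : -1 ≤ vertexCos b a c m) (by linarith),
      ← Real.cos_pi_div_five, ← Real.sin_sq, ← Real.cos_pi_div_two_sub]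
    congr 2
    rw [vertexAngle_eq, vertexAngle_eq] at h2
    rw [vertexAngle_eq] at h1
    linarith
  have u3 : vertexCos a b c m = 1 - 2 * vertexCos a b c (Real.sqrt c) ^ 2 := by
    have := vertexCos_lt_one hca hcb hm hmc
    have := vertexCos_pos hca hcb hm hmc
    have := vertexCos_lt_one hca hcb hr hrc.le
    have := vertexCos_pos hca hcb hr hrc.le
    have e := Real.cos_arccos (by linarith : -1 ≤ vertexCos a b c m) (by linarith)
    have e' := Real.cos_arccos (by linarith : -1 ≤ vertexCos a b c (Real.sqrt c)) (by linarith)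
    rw [vertexAngle_eq, vertexAngle_eq] at h3
    rw [← e, show Real.arccos (vertexCos a b c m) =
      Real.pi - 2 * Real.arccos (vertexCos a b c (Real.sqrt c)) by linarith, Real.cos_pi_sub,
      Real.cos_two_mul, e']
    ring
  have u4 : 4 * (c - m ^ 2) ^ 2 = (a - m ^ 2) * (b - m ^ 2) := by
    push_cast at h4
    rw [h4, Real.cos_pi_div_three, mul_pow, Real.sq_sqrt (mul_pos ham hbm).le]
    ring
  have v1 := vertexCos_sq hcb hca hr hrc.le
  have v2 := vertexCos_sq hcb hca hm hmc
  have v3 := vertexCos_sq hca hcb hr hrc.le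
  have v4 := vertexCos_sq hca hcb hm hmc
  have h5 : Real.sqrt 5 ^ 2 = 5 := Real.sq_sqrt (by norm_num)
  have hs0 : 0 < Real.sqrt 5 := by positivity
  set s := Real.sqrt 5
  rw [u1, hrc, hba] at v1
  rw [u2, hba] at v2
  rw [hrc] at v3
  rw [u3, v3] at v4
  exact no_mixed_heights h5 hs0 hc hca hcb (by linarith) v1.symm v2.symm v4 u4

end Bip

/-- The triples obtained from `(x₀, y₀, z₀)` by passing from a vertex and two of its neighbours to
the third neighbour or to the opposite vertex of the rhombus spanned by them. -/
inductive CornerOrbit (κ : ℝ) (x₀ y₀ z₀ : Euc 3) : Euc 3 → Euc 3 → Euc 3 → Prop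
  | base : CornerOrbit κ x₀ y₀ z₀ x₀ y₀ z₀
  | swap {x y z : Euc 3} : CornerOrbit κ x₀ y₀ z₀ x y z → CornerOrbit κ x₀ y₀ z₀ x z y
  | third {x y z : Euc 3} : CornerOrbit κ x₀ y₀ z₀ x y z →
      CornerOrbit κ x₀ y₀ z₀ x z (κ • x - y - z)
  | flip {x y z : Euc 3} : CornerOrbit κ x₀ y₀ z₀ x y z →
      CornerOrbit κ x₀ y₀ z₀ (y + z - x) y z

/-- The points occurring in a corner orbit. -/
def orbitPoints (κ : ℝ) (x₀ y₀ z₀ : Euc 3) : Set (Euc 3) :=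
  {p | ∃ q t, CornerOrbit κ x₀ y₀ z₀ p q t ∨ CornerOrbit κ x₀ y₀ z₀ q p t}

namespace CornerOrbit

variable {κ : ℝ} {x₀ y₀ z₀ x y z : Euc 3}

lemma map (S : Euc 3 →ₗ[ℝ] Euc 3) (h : CornerOrbit κ x₀ y₀ z₀ x y z) :
    CornerOrbit κ (S x₀) (S y₀) (S z₀) (S x) (S y) (S z) := by
  induction h with
  | base => exact .base
  | swap _ ih => exact ih.swap
  | third _ ih => simpa using ih.third
  | flip _ ih => simpa using ih.flip

lemma exists_of_map (S : Euc 3 →ₗ[ℝ] Euc 3) {x' y' z' : Euc 3}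
    (h : CornerOrbit κ (S x₀) (S y₀) (S z₀) x' y' z') :
    ∃ x y z, CornerOrbit κ x₀ y₀ z₀ x y z ∧ S x = x' ∧ S y = y' ∧ S z = z' := by
  induction h with
  | base => exact ⟨_, _, _, .base, rfl, rfl, rfl⟩
  | swap _ ih =>
    obtain ⟨x, y, z, h, rfl, rfl, rfl⟩ := ih
    exact ⟨_, _, _, h.swap, rfl, rfl, rfl⟩
  | third _ ih =>
    obtain ⟨x, y, z, h, rfl, rfl, rfl⟩ := ih
    exact ⟨_, _, _, h.third, rfl, rfl, by simp⟩
  | flip _ ih =>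
    obtain ⟨x, y, z, h, rfl, rfl, rfl⟩ := ih
    exact ⟨_, _, _, h.flip, by simp, rfl, rfl⟩

lemma trans {x' y' z' : Euc 3} (h : CornerOrbit κ x₀ y₀ z₀ x y z)
    (h' : CornerOrbit κ x y z x' y' z') : CornerOrbit κ x₀ y₀ z₀ x' y' z' := by
  induction h' with
  | base => exact h
  | swap _ ih => exact ih.swap
  | third _ ih => exact ih.third
  | flip _ ih => exact ih.flip

end CornerOrbit

lemma orbitPoints_map (κ : ℝ) (x₀ y₀ z₀ : Euc 3) (S : Euc 3 →ₗ[ℝ] Euc 3) :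
    orbitPoints κ (S x₀) (S y₀) (S z₀) = S '' orbitPoints κ x₀ y₀ z₀ := by
  ext p
  constructor
  · rintro ⟨q, t, h | h⟩
    · obtain ⟨x, y, z, h₁, rfl, rfl, rfl⟩ := h.exists_of_map
      exact ⟨x, ⟨y, z, Or.inl h₁⟩, rfl⟩
    · obtain ⟨x, y, z, h₁, rfl, rfl, rfl⟩ := h.exists_of_map
      exact ⟨y, ⟨x, z, Or.inr h₁⟩, rfl⟩
  · rintro ⟨p, ⟨q, t, h | h⟩, rfl⟩
    · exact ⟨S q, S t, Or.inl (h.map S)⟩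
    · exact ⟨S q, S t, Or.inr (h.map S)⟩

/-- Points of the orbit stay in the orbit under a linear map moving the base triple inside the
orbit. -/
lemma map_mem_orbitPoints {κ : ℝ} {x₀ y₀ z₀ p : Euc 3} (S : Euc 3 →ₗ[ℝ] Euc 3)
    (hS : CornerOrbit κ x₀ y₀ z₀ (S x₀) (S y₀) (S z₀)) (hp : p ∈ orbitPoints κ x₀ y₀ z₀) :
    S p ∈ orbitPoints κ x₀ y₀ z₀ := by
  obtain ⟨q, t, h | h⟩ := hp
  · exact ⟨S q, S t, Or.inl (hS.trans (h.map S))⟩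
  · exact ⟨S q, S t, Or.inr (hS.trans (h.map S))⟩

namespace Bip

variable {P V W : Set (Euc 3)} {a b c : ℝ}

lemma rhombic_relation (B : Bip P V W a b c) (hab : a < b) {x y z : Euc 3} (hx : x ∈ V)
    (C : Cor P x y z (Real.sqrt c)) :
    0 < c ∧ 3 * vertexAngle a b c (Real.sqrt c) = 2 * Real.pi ∧
      a * b - c ^ 2 = 4 * (c * (a - c)) := by
  obtain ⟨hr, hrc⟩ := B.cor_height hab C
  have hc : 0 < c := by linarith [pow_pos hr 2]
  obtain ⟨-, w, h', h'', c1, c2, -, e⟩ := B.vertex_three hab hx C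
  rw [B.cor_sq_eq hab c1, B.cor_sq_eq hab c2] at e
  have e' : 3 * vertexAngle a b c (Real.sqrt c) = 2 * Real.pi := by linarith
  refine ⟨hc, e', ?_⟩
  have := vertexCos_lt_one B.ca B.cb hr hrc
  have := vertexCos_pos B.ca B.cb hr hrc
  have u := Real.cos_arccos (by linarith : -1 ≤ vertexCos a b c (Real.sqrt c)) (by linarith)
  rw [vertexAngle_eq] at e'
  rw [show Real.arccos (vertexCos a b c (Real.sqrt c)) = Real.pi / 3 by linarith,
    Real.cos_pi_div_three] at u
  have v := vertexCos_sq B.ca B.cb hr hrc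
  obtain ⟨-, -, h1, h2⟩ := vertexAngle_pos B.ca B.cb hr hrc
  rw [← u, Real.sq_sqrt hc.le] at v
  have h3 : (a - c) ≠ 0 := by linarith [B.ca]
  field_simp at v
  linarith

lemma inner_of_rhombus (B : Bip P V W a b c) {x y z : Euc 3} (hx : x ∈ V) (hc : 0 < c)
    (C : Cor P x y z (Real.sqrt c)) : ⟪y, z⟫ = 2 * c - b ∧ ⟪x, y⟫ = c ∧ ⟪x, z⟫ = c := by
  have hu := B.sqV _ (B.cor_rhombus hx C (Real.sq_sqrt hc.le)).1
  obtain ⟨hy, hz⟩ := B.cor_mem_of_mem C hx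
  obtain ⟨n, C⟩ := C
  have h1 := B.inner_edge _ _ C.exy
  have h2 := B.inner_edge _ _ C.exz
  have e1 := real_inner_comm x y
  have e2 := real_inner_comm x z
  have e3 := real_inner_comm y z
  simp only [inner_sub_left, inner_sub_right, inner_add_left, inner_add_right, B.sqV x hx,
    B.sqW y hy, B.sqW z hz] at hu
  exact ⟨by linarith, h1, h2⟩

/-- The third neighbour of a vertex in `V`. -/
lemma third_eq (B : Bip P V W a b c) (hab : a < b) {x y z w : Euc 3} (hx : x ∈ V)
    (C : Cor P x y z (Real.sqrt c)) (C1 : Cor P x z w (Real.sqrt c))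
    (C2 : Cor P x w y (Real.sqrt c)) : w = (3 * c / a) • x - y - z := by
  obtain ⟨hc, -, hrel⟩ := B.rhombic_relation hab hx C
  obtain ⟨i1, i2, i3⟩ := B.inner_of_rhombus hx hc C
  obtain ⟨j1, j2, j3⟩ := B.inner_of_rhombus hx hc C1
  obtain ⟨k1, k2, k3⟩ := B.inner_of_rhombus hx hc C2
  have hy := (B.cor_mem_of_mem C hx)
  have hw := (B.cor_mem_of_mem C2 hx)
  have ha := B.pos hx
  have e1 : ⟪y, x⟫ = c := (real_inner_comm _ _).trans i2
  have e2 : ⟪z, x⟫ = c := (real_inner_comm _ _).trans i3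
  have e3 : ⟪w, x⟫ = c := (real_inner_comm _ _).trans j3
  have e4 : ⟪z, y⟫ = 2 * c - b := (real_inner_comm _ _).trans i1
  have e5 : ⟪w, z⟫ = 2 * c - b := (real_inner_comm _ _).trans j1
  have e6 : ⟪y, w⟫ = 2 * c - b := (real_inner_comm _ _).trans k1
  rw [← sub_eq_zero, ← inner_self_eq_zero (𝕜 := ℝ)]
  simp only [inner_sub_left, inner_sub_right, real_inner_smul_left, real_inner_smul_right,
    i1, i2, i3, j1, j3, k1, e1, e2, e3, e4, e5, e6, B.sqV x hx,
    B.sqW y hy.1, B.sqW z hy.2, B.sqW w hw.1]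
  field_simp
  linarith

lemma orbit_corner (B : Bip P V W a b c) (hab : a < b) {x₀ y₀ z₀ x y z : Euc 3} (hx : x₀ ∈ V)
    (C : Cor P x₀ y₀ z₀ (Real.sqrt c)) (h : CornerOrbit (3 * c / a) x₀ y₀ z₀ x y z) :
    x ∈ V ∧ (Cor P x y z (Real.sqrt c) ∨ Cor P x z y (Real.sqrt c)) := by
  have hc := (B.rhombic_relation hab hx C).1
  have hr : Real.sqrt c ^ 2 = c := Real.sq_sqrt hc.le
  induction h with
  | base => exact ⟨hx, Or.inl C⟩
  | swap _ ih => exact ⟨ih.1, ih.2.symm⟩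
  | third _ ih =>
    refine ⟨ih.1, ?_⟩
    obtain C | C := ih.2
    · obtain ⟨-, w, h', h'', c1, c2, -, e⟩ := B.vertex_three hab ih.1 C
      rw [B.cor_sq_eq hab c1] at c1
      rw [B.cor_sq_eq hab c2] at c2
      rw [← B.third_eq hab ih.1 C c1 c2]
      exact Or.inl c1
    · obtain ⟨-, w, h', h'', c1, c2, -, e⟩ := B.vertex_three hab ih.1 C
      rw [B.cor_sq_eq hab c1] at c1
      rw [B.cor_sq_eq hab c2] at c2
      rw [sub_right_comm, ← B.third_eq hab ih.1 C c1 c2]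
      exact Or.inr c2
  | flip _ ih =>
    obtain C | C := ih.2
    · have := B.cor_rhombus ih.1 C hr
      exact ⟨this.1, Or.inr this.2.2.1⟩
    · have := B.cor_rhombus ih.1 C hr
      rw [add_comm] at this
      exact ⟨this.1, Or.inl this.2.2.1⟩

lemma orbit_edge_W (B : Bip P V W a b c) (hab : a < b) {x₀ y₀ z₀ x y z m : Euc 3} (hx : x₀ ∈ V)
    (C : Cor P x₀ y₀ z₀ (Real.sqrt c)) (h : CornerOrbit (3 * c / a) x₀ y₀ z₀ x y z)
    (hm : IsEdge P y m) : ∃ t, CornerOrbit (3 * c / a) x₀ y₀ z₀ m y t := by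
  have hc := (B.rhombic_relation hab hx C).1
  have hr : Real.sqrt c ^ 2 = c := Real.sq_sqrt hc.le
  have hxy : x ∈ V ∧ IsEdge P y x := by
    obtain ⟨h1, C | C⟩ := B.orbit_corner hab hx C h
    · exact ⟨h1, C.choose_spec.exy.symm⟩
    · exact ⟨h1, C.choose_spec.exz.symm⟩
  have hy : y ∈ W := B.edgeV hxy.1 hxy.2.symm
  obtain ⟨s, u, g, hs, u0, us, -, hall, -, hcor, -⟩ := B.symm.vertex_cycle hy hxy.2
  obtain ⟨j, hj, rfl⟩ := hall m hm
  have key : ∀ i < s, ∃ t, CornerOrbit (3 * c / a) x₀ y₀ z₀ (u i) y t := by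
    intro i
    induction i with
    | zero => intro _; exact ⟨z, u0 ▸ h⟩
    | succ i ih =>
      intro hi
      obtain ⟨t, ht⟩ := ih (by omega)
      have hci := hcor i (by omega)
      rw [B.cor_sq_eq hab hci] at hci
      have key : ∀ t, CornerOrbit (3 * c / a) x₀ y₀ z₀ (u i) y t →
          Cor P (u i) t y (Real.sqrt c) →
          ∃ t, CornerOrbit (3 * c / a) x₀ y₀ z₀ (u (i + 1)) y t := by
        intro t ht Ct
        have hui := (B.orbit_corner hab hx C ht).1
        have := (B.cor_rhombus hui Ct hr).2.2.2
        rw [← (B.symm.cor_unique_right hy this hci).1, add_comm]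
        exact ⟨t, ht.flip⟩
      obtain ⟨hui, Ct | Ct⟩ := B.orbit_corner hab hx C ht
      · obtain ⟨-, w, h', h'', c1, c2, -, e⟩ := B.vertex_three hab hui Ct
        rw [B.cor_sq_eq hab c1] at c1
        rw [B.cor_sq_eq hab c2] at c2
        refine key w ?_ c2
        rw [B.third_eq hab hui Ct c1 c2, sub_right_comm]
        exact ht.swap.third
      · exact key t ht Ct
  exact key j hj

/-- A strictly bipartite polyhedron is determined by one corner. -/
theorem eq_convexHull_orbitPoints (B : Bip P V W a b c) (hab : a < b) {x₀ y₀ z₀ : Euc 3}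
    (hx : x₀ ∈ V) (C : Cor P x₀ y₀ z₀ (Real.sqrt c)) :
    P = convexHull ℝ (orbitPoints (3 * c / a) x₀ y₀ z₀) := by
  have hsub : orbitPoints (3 * c / a) x₀ y₀ z₀ ⊆ P.extremePoints ℝ := by
    rintro p ⟨q, t, h | h⟩
    · exact B.memV (B.orbit_corner hab hx C h).1
    · obtain ⟨h1, C | C⟩ := B.orbit_corner hab hx C h
      · exact B.memW (B.cor_mem_of_mem C h1).1
      · exact B.memW (B.cor_mem_of_mem C h1).2
  have hsup : P.extremePoints ℝ ⊆ orbitPoints (3 * c / a) x₀ y₀ z₀ := by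
    refine extremePoints_subset_of_edge_closed B.poly hsub ⟨x₀, y₀, z₀, Or.inl .base⟩ ?_
    rintro p ⟨q, t, h | h⟩ m hm
    · obtain ⟨hp, C | C⟩ := B.orbit_corner hab hx C h
      · obtain ⟨-, w, h', h'', c1, c2, hw, e⟩ := B.vertex_three hab hp C
        rw [B.cor_sq_eq hab c1] at c1
        rw [B.cor_sq_eq hab c2] at c2
        obtain rfl | rfl | rfl := hw m hm
        · exact ⟨p, t, Or.inr h⟩
        · exact ⟨p, q, Or.inr h.swap⟩
        · rw [B.third_eq hab hp C c1 c2]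
          exact ⟨p, _, Or.inr h.third.swap⟩
      · obtain ⟨-, w, h', h'', c1, c2, hw, e⟩ := B.vertex_three hab hp C
        rw [B.cor_sq_eq hab c1] at c1
        rw [B.cor_sq_eq hab c2] at c2
        obtain rfl | rfl | rfl := hw m hm
        · exact ⟨p, q, Or.inr h.swap⟩
        · exact ⟨p, t, Or.inr h⟩
        · rw [B.third_eq hab hp C c1 c2, sub_right_comm]
          exact ⟨p, _, Or.inr h.third.swap⟩
    · obtain ⟨t', ht⟩ := B.orbit_edge_W hab hx C h hm
      exact ⟨p, t', Or.inl ht⟩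
  rw [subset_antisymm hsub hsup]
  exact B.poly.convexHull_extremePoints.symm

end Bip

lemma goldenR_sq : goldenR ^ 2 = goldenR + 1 := by
  have h : Real.sqrt 5 ^ 2 = 5 := Real.sq_sqrt (by norm_num)
  rw [goldenR]
  linear_combination h / 4

lemma goldenR_pos : 0 < goldenR := by
  rw [goldenR]
  positivity

namespace Bip

variable {P V W : Set (Euc 3)} {a b c : ℝ}

/-- The shape of a strictly bipartite polyhedron is given by a parameter `k`, which is one of two
numbers. -/
theorem rhombic_cases (B : Bip P V W a b c) (hab : a < b) {x y z : Euc 3} (hx : x ∈ V)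
    (C : Cor P x y z (Real.sqrt c)) :
    ∃ k : ℝ, (k = 2 ∨ k = goldenR + 1) ∧ k * a = 3 * c ∧ b - c = k * (a - c) := by
  obtain ⟨hc, hA, hrel⟩ := B.rhombic_relation hab hx C
  obtain ⟨hr, hrc⟩ := B.cor_height hab C
  have S := B.cornerSystem hab
  have hca := B.ca
  have hcb := B.cb
  obtain ⟨u, C'⟩ := S.next C
  have hy := (B.cor_mem_of_mem C hx).1
  obtain ⟨s, f, g, hs, -, -, hf, hsum⟩ := B.hasCycles hy C'
  rw [Finset.sum_congr rfl fun j hj => by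
    rw [B.cor_sq_eq hab (hf j (Finset.mem_range.1 hj))], Finset.sum_const, Finset.card_range,
    nsmul_eq_mul] at hsum
  beta_reduce at hsum
  have e1 := S.excess_r C
  have e2 := S.D_lt C
  have hpi := Real.pi_pos
  have hs4 : 3 < s := by
    rw [← Nat.cast_lt (α := ℝ)]
    push_cast
    by_contra hcon
    nlinarith [mul_le_mul_of_nonneg_right (not_lt.1 hcon)
      (by linarith : 0 ≤ vertexAngle b a c (Real.sqrt c))]
  have hs5 : s < 6 := by
    rw [← Nat.cast_lt (α := ℝ)]
    push_cast
    by_contra hcon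
    nlinarith [mul_le_mul_of_nonneg_right (not_lt.1 hcon)
      (by linarith : 0 ≤ vertexAngle b a c (Real.sqrt c))]
  have hs0 : (s : ℝ) ≠ 0 := by positivity
  have := vertexCos_lt_one hcb hca hr hrc
  have := vertexCos_pos hcb hca hr hrc
  have e3 := Real.cos_arccos (by linarith : -1 ≤ vertexCos b a c (Real.sqrt c)) (by linarith)
  rw [vertexAngle_eq] at hsum
  rw [show Real.arccos (vertexCos b a c (Real.sqrt c)) = Real.pi / s by
    field_simp; linarith] at e3
  have e4 := vertexCos_sq hcb hca hr hrc
  obtain ⟨-, -, h1, h2⟩ := vertexAngle_pos hcb hca hr hrc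
  rw [← e3, Real.sq_sqrt hc.le, mul_comm b a, hrel] at e4
  have h3 : a - c ≠ 0 := by linarith
  have h4 : b - c ≠ 0 := by linarith
  have e5 : b - c = 4 * Real.cos (Real.pi / s) ^ 2 * (a - c) := by
    rw [e4]
    field_simp
  have e6 : 4 * Real.cos (Real.pi / s) ^ 2 * a = 3 * c := by
    apply mul_right_cancel₀ h3
    linear_combination hrel - a * e5
  refine ⟨4 * Real.cos (Real.pi / s) ^ 2, ?_, e6, e5⟩
  obtain rfl | rfl : s = 4 ∨ s = 5 := by omega
  · left
    push_cast
    rw [Real.cos_pi_div_four, div_pow, Real.sq_sqrt (by norm_num)]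
    norm_num
  · right
    push_cast
    rw [Real.cos_pi_div_five, ← goldenR_sq, goldenR]
    ring

end Bip

lemma pt3_add (a b c a' b' c' : ℝ) :
    pt3 a b c + pt3 a' b' c' = pt3 (a + a') (b + b') (c + c') := by
  ext i; fin_cases i <;> simp [pt3]

lemma pt3_sub (a b c a' b' c' : ℝ) :
    pt3 a b c - pt3 a' b' c' = pt3 (a - a') (b - b') (c - c') := by
  ext i; fin_cases i <;> simp [pt3]

lemma smul_pt3 (k a b c : ℝ) : k • pt3 a b c = pt3 (k * a) (k * b) (k * c) := by
  ext i; fin_cases i <;> simp [pt3]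

lemma inner_pt3 (a b c a' b' c' : ℝ) :
    ⟪pt3 a b c, pt3 a' b' c'⟫ = a * a' + b * b' + c * c' := by
  simp [pt3, PiLp.inner_apply, Fin.sum_univ_three]
  ring

/-- The cyclic permutation of the coordinates. -/
def cycMap : Euc 3 →ₗ[ℝ] Euc 3 where
  toFun x := pt3 (x 2) (x 0) (x 1)
  map_add' x y := by simp [pt3_add]
  map_smul' k x := by simp [smul_pt3]

/-- The change of sign of the first coordinate. -/
def negMap : Euc 3 →ₗ[ℝ] Euc 3 where
  toFun x := pt3 (-x 0) (x 1) (x 2)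
  map_add' x y := by simp [pt3_add, add_comm]
  map_smul' k x := by simp [smul_pt3]

lemma cycMap_pt3 (a b c : ℝ) : cycMap (pt3 a b c) = pt3 c a b := by
  simp [cycMap, pt3]

lemma negMap_pt3 (a b c : ℝ) : negMap (pt3 a b c) = pt3 (-a) b c := by
  simp [negMap, pt3]

/-- The triples obtained from a family of triples by exchanging the last two entries, by cyclic
permutations of the coordinates and by sign changes. -/
inductive SymClosure (R : Euc 3 → Euc 3 → Euc 3 → Prop) : Euc 3 → Euc 3 → Euc 3 → Prop
  | base {x y z : Euc 3} : R x y z → SymClosure R x y z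
  | swap {x y z : Euc 3} : SymClosure R x y z → SymClosure R x z y
  | cyc {x y z : Euc 3} : SymClosure R x y z → SymClosure R (cycMap x) (cycMap y) (cycMap z)
  | neg {x y z : Euc 3} : SymClosure R x y z → SymClosure R (negMap x) (negMap y) (negMap z)

namespace SymClosure

variable {R : Euc 3 → Euc 3 → Euc 3 → Prop} {κ : ℝ} {x y z : Euc 3}

lemma third_flip (hR : ∀ x y z, R x y z → SymClosure R x z (κ • x - y - z) ∧
    SymClosure R x y (κ • x - y - z) ∧ SymClosure R (y + z - x) y z)
    (h : SymClosure R x y z) : SymClosure R x z (κ • x - y - z) ∧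
    SymClosure R x y (κ • x - y - z) ∧ SymClosure R (y + z - x) y z := by
  induction h with
  | base h => exact hR _ _ _ h
  | swap h ih =>
    rw [sub_right_comm, add_comm] at ih
    exact ⟨ih.2.1, ih.1, ih.2.2.swap⟩
  | cyc h ih => simpa using (⟨ih.1.cyc, ih.2.1.cyc, ih.2.2.cyc⟩ : _ ∧ _ ∧ _)
  | neg h ih => simpa using (⟨ih.1.neg, ih.2.1.neg, ih.2.2.neg⟩ : _ ∧ _ ∧ _)

lemma of_orbit (hR : ∀ x y z, R x y z → SymClosure R x z (κ • x - y - z) ∧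
    SymClosure R x y (κ • x - y - z) ∧ SymClosure R (y + z - x) y z)
    {x₀ y₀ z₀ : Euc 3} (h₀ : R x₀ y₀ z₀) (h : CornerOrbit κ x₀ y₀ z₀ x y z) :
    SymClosure R x y z := by
  induction h with
  | base => exact base h₀
  | swap _ ih => exact ih.swap
  | third _ ih => exact (third_flip hR ih).1
  | flip _ ih => exact (third_flip hR ih).2.2

lemma mem {M : Set (Euc 3)} (hR : ∀ x y z, R x y z → x ∈ M ∧ y ∈ M ∧ z ∈ M)
    (hc : ∀ x ∈ M, cycMap x ∈ M) (hn : ∀ x ∈ M, negMap x ∈ M) (h : SymClosure R x y z) :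
    x ∈ M ∧ y ∈ M ∧ z ∈ M := by
  induction h with
  | base h => exact hR _ _ _ h
  | swap _ ih => exact ⟨ih.1, ih.2.2, ih.2.1⟩
  | cyc _ ih => exact ⟨hc _ ih.1, hc _ ih.2.1, hc _ ih.2.2⟩
  | neg _ ih => exact ⟨hn _ ih.1, hn _ ih.2.1, hn _ ih.2.2⟩

lemma orbitPoints_subset {M : Set (Euc 3)} (hR : ∀ x y z, R x y z →
      SymClosure R x z (κ • x - y - z) ∧ SymClosure R x y (κ • x - y - z) ∧
      SymClosure R (y + z - x) y z)
    (hM : ∀ x y z, R x y z → x ∈ M ∧ y ∈ M ∧ z ∈ M)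
    (hc : ∀ x ∈ M, cycMap x ∈ M) (hn : ∀ x ∈ M, negMap x ∈ M)
    {x₀ y₀ z₀ : Euc 3} (h₀ : R x₀ y₀ z₀) : orbitPoints κ x₀ y₀ z₀ ⊆ M := by
  rintro p ⟨q, t, h | h⟩
  · exact ((of_orbit hR h₀ h).mem hM hc hn).1
  · exact ((of_orbit hR h₀ h).mem hM hc hn).2.1

end SymClosure

/-- The fourteen vertices of the rhombic dodecahedron. -/
def dodecaVerts : Set (Euc 3) :=
  {pt3 1 1 1, pt3 1 1 (-1), pt3 1 (-1) 1, pt3 1 (-1) (-1),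
    pt3 (-1) 1 1, pt3 (-1) 1 (-1), pt3 (-1) (-1) 1, pt3 (-1) (-1) (-1),
    pt3 2 0 0, pt3 (-2) 0 0, pt3 0 2 0, pt3 0 (-2) 0, pt3 0 0 2, pt3 0 0 (-2)}

lemma cycMap_mem_dodecaVerts {x : Euc 3} (hx : x ∈ dodecaVerts) : cycMap x ∈ dodecaVerts := by
  rcases hx with rfl | rfl | rfl | rfl | rfl | rfl | rfl | rfl | rfl | rfl | rfl | rfl | rfl |
    rfl <;> simp [cycMap_pt3, dodecaVerts]

lemma negMap_mem_dodecaVerts {x : Euc 3} (hx : x ∈ dodecaVerts) : negMap x ∈ dodecaVerts := by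
  rcases hx with rfl | rfl | rfl | rfl | rfl | rfl | rfl | rfl | rfl | rfl | rfl | rfl | rfl |
    rfl <;> simp [negMap_pt3, dodecaVerts]

lemma mem_iterate {M : Set (Euc 3)} (hc : ∀ x ∈ M, cycMap x ∈ M) (hn : ∀ x ∈ M, negMap x ∈ M)
    {a b c : ℝ} (h : pt3 a b c ∈ M) :
    pt3 c a b ∈ M ∧ pt3 b c a ∈ M ∧ pt3 (-a) b c ∈ M ∧ pt3 a (-b) c ∈ M ∧ pt3 a b (-c) ∈ M := by
  have h1 := hc _ h
  have h2 := hc _ h1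
  have h3 := hn _ h
  have h4 := hc _ (hn _ h2)
  have h5 := hc _ (hc _ (hn _ h1))
  simp only [cycMap_pt3, negMap_pt3] at h1 h2 h3 h4 h5
  exact ⟨h1, h2, h3, h4, h5⟩

lemma orbitPoints_dodeca : orbitPoints 2 (pt3 1 1 1) (pt3 0 2 0) (pt3 0 0 2) = dodecaVerts := by
  have e1 : (2 : ℝ) • pt3 1 1 1 - pt3 0 2 0 - pt3 0 0 2 = pt3 2 0 0 := by
    simp only [smul_pt3, pt3_sub]; norm_num
  have e2 : pt3 0 2 0 + pt3 0 0 2 - pt3 1 1 1 = pt3 (-1) 1 1 := by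
    simp only [pt3_add, pt3_sub]; norm_num
  apply subset_antisymm
  · apply SymClosure.orbitPoints_subset
      (R := fun x y z => x = pt3 1 1 1 ∧ y = pt3 0 2 0 ∧ z = pt3 0 0 2)
    · rintro x y z ⟨rfl, rfl, rfl⟩
      rw [e1, e2]
      have h := SymClosure.base (R := fun x y z => x = pt3 1 1 1 ∧ y = pt3 0 2 0 ∧ z = pt3 0 0 2)
        ⟨rfl, rfl, rfl⟩
      have h1 := h.cyc
      have h2 := h1.cyc
      have h3 := h.neg
      simp only [cycMap_pt3, negMap_pt3, neg_zero] at h1 h2 h3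
      exact ⟨h1, h2.swap, h3⟩
    · rintro x y z ⟨rfl, rfl, rfl⟩
      simp [dodecaVerts]
    · exact fun x => cycMap_mem_dodecaVerts
    · exact fun x => negMap_mem_dodecaVerts
    · exact ⟨rfl, rfl, rfl⟩
  · have hc : ∀ x ∈ orbitPoints 2 (pt3 1 1 1) (pt3 0 2 0) (pt3 0 0 2),
        cycMap x ∈ orbitPoints 2 (pt3 1 1 1) (pt3 0 2 0) (pt3 0 0 2) := by
      refine fun x => map_mem_orbitPoints cycMap ?_
      have := (CornerOrbit.base (κ := 2) (x₀ := pt3 1 1 1) (y₀ := pt3 0 2 0)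
        (z₀ := pt3 0 0 2)).third
      rw [e1] at this
      simpa only [cycMap_pt3] using this
    have hn : ∀ x ∈ orbitPoints 2 (pt3 1 1 1) (pt3 0 2 0) (pt3 0 0 2),
        negMap x ∈ orbitPoints 2 (pt3 1 1 1) (pt3 0 2 0) (pt3 0 0 2) := by
      refine fun x => map_mem_orbitPoints negMap ?_
      have := (CornerOrbit.base (κ := 2) (x₀ := pt3 1 1 1) (y₀ := pt3 0 2 0)
        (z₀ := pt3 0 0 2)).flip
      rw [e2] at this
      simpa only [negMap_pt3, neg_zero] using this
    have p1 : pt3 1 1 1 ∈ orbitPoints 2 (pt3 1 1 1) (pt3 0 2 0) (pt3 0 0 2) :=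
      ⟨_, _, Or.inl .base⟩
    have p2 : pt3 0 2 0 ∈ orbitPoints 2 (pt3 1 1 1) (pt3 0 2 0) (pt3 0 0 2) :=
      ⟨_, _, Or.inr .base⟩
    have I := fun a b c h => mem_iterate hc hn (a := a) (b := b) (c := c) h
    obtain ⟨-, -, q1, q2, q3⟩ := I _ _ _ p1
    obtain ⟨-, -, -, q4, q5⟩ := I _ _ _ q1
    obtain ⟨-, -, -, -, q6⟩ := I _ _ _ q2
    obtain ⟨-, -, -, -, q7⟩ := I _ _ _ q4
    obtain ⟨s1, s2, -, s3, -⟩ := I _ _ _ p2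
    obtain ⟨s4, s5, -, -, -⟩ := I _ _ _ s3
    rintro x (rfl | rfl | rfl | rfl | rfl | rfl | rfl | rfl | rfl | rfl | rfl | rfl | rfl |
      rfl) <;> assumption

lemma cycMap_mem_cycSigns {a b : ℝ} {x : Euc 3} (hx : x ∈ cycSigns a b) :
    cycMap x ∈ cycSigns a b := by
  obtain ⟨s, t, hs, ht, rfl | rfl | rfl⟩ := hx
  · exact ⟨s, t, hs, ht, by simp [cycMap_pt3]⟩
  · exact ⟨s, t, hs, ht, by simp [cycMap_pt3]⟩
  · exact ⟨s, t, hs, ht, by simp [cycMap_pt3]⟩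

lemma negMap_mem_cycSigns {a b : ℝ} {x : Euc 3} (hx : x ∈ cycSigns a b) :
    negMap x ∈ cycSigns a b := by
  obtain ⟨s, t, hs, ht, rfl | rfl | rfl⟩ := hx
  · exact ⟨s, t, hs, ht, by simp [negMap_pt3]⟩
  · exact ⟨s, -t, hs, by obtain rfl | rfl := ht <;> simp, by simp [negMap_pt3]⟩
  · exact ⟨-s, t, by obtain rfl | rfl := hs <;> simp, ht, by simp [negMap_pt3]⟩

lemma cycMap_mem_cubeVerts {x : Euc 3} (hx : x ∈ cubeVerts) : cycMap x ∈ cubeVerts := by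
  obtain ⟨s, t, u, hs, ht, hu, rfl⟩ := hx
  exact ⟨u, s, t, hu, hs, ht, by simp [cycMap_pt3]⟩

lemma negMap_mem_cubeVerts {x : Euc 3} (hx : x ∈ cubeVerts) : negMap x ∈ cubeVerts := by
  obtain ⟨s, t, u, hs, ht, hu, rfl⟩ := hx
  exact ⟨-s, t, u, by obtain rfl | rfl := hs <;> simp, ht, hu, by simp [negMap_pt3]⟩

section Signs

variable {M : Set (Euc 3)} {a b c : ℝ}

lemma signs_mem (hc : ∀ x ∈ M, cycMap x ∈ M) (hn : ∀ x ∈ M, negMap x ∈ M)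
    (h : pt3 a b c ∈ M) {s t u : ℝ} (hs : s = 1 ∨ s = -1) (ht : t = 1 ∨ t = -1)
    (hu : u = 1 ∨ u = -1) : pt3 (s * a) (t * b) (u * c) ∈ M := by
  have h1 : pt3 (s * a) b c ∈ M := by
    obtain rfl | rfl := hs
    · simpa using h
    · simpa using (mem_iterate hc hn h).2.2.1
  have h2 : pt3 (s * a) (t * b) c ∈ M := by
    obtain rfl | rfl := ht
    · simpa using h1
    · simpa using (mem_iterate hc hn h1).2.2.2.1
  obtain rfl | rfl := hu
  · simpa using h2
  · simpa using (mem_iterate hc hn h2).2.2.2.2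

lemma cycSigns_subset (hc : ∀ x ∈ M, cycMap x ∈ M) (hn : ∀ x ∈ M, negMap x ∈ M)
    (h : pt3 0 a b ∈ M) : cycSigns a b ⊆ M := by
  rintro x ⟨s, t, hs, ht, hx⟩
  have h0 := signs_mem hc hn h (Or.inl rfl : (1 : ℝ) = 1 ∨ _) hs ht
  rw [mul_zero] at h0
  obtain ⟨h1, h2, -⟩ := mem_iterate hc hn h0
  obtain rfl | rfl | rfl := hx <;> assumption

lemma cubeVerts_subset (hc : ∀ x ∈ M, cycMap x ∈ M) (hn : ∀ x ∈ M, negMap x ∈ M)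
    (h : pt3 1 1 1 ∈ M) : cubeVerts ⊆ M := by
  rintro x ⟨s, t, u, hs, ht, hu, rfl⟩
  simpa using signs_mem hc hn h hs ht hu

end Signs

/-- One triple for each kind of corner of the rhombic triacontahedron, up to symmetries of the
coordinates. -/
def TriacontaCorner (g : ℝ) (x y z : Euc 3) : Prop :=
  (x = pt3 0 (g - 1) g ∧ y = pt3 1 0 g ∧ z = pt3 (-1) 0 g) ∨
  (x = pt3 0 (g - 1) g ∧ y = pt3 1 0 g ∧ z = pt3 0 g 1) ∨
  (x = pt3 1 1 1 ∧ y = pt3 1 0 g ∧ z = pt3 0 g 1)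

lemma TriacontaCorner.third_flip {g : ℝ} (hg : g ^ 2 = g + 1) (x y z : Euc 3)
    (h : TriacontaCorner g x y z) :
    SymClosure (TriacontaCorner g) x z ((g + 1) • x - y - z) ∧
    SymClosure (TriacontaCorner g) x y ((g + 1) • x - y - z) ∧
    SymClosure (TriacontaCorner g) (y + z - x) y z := by
  have b1 := SymClosure.base (R := TriacontaCorner g) (Or.inl ⟨rfl, rfl, rfl⟩)
  have b2 := SymClosure.base (R := TriacontaCorner g) (Or.inr (Or.inl ⟨rfl, rfl, rfl⟩))
  have b3 := SymClosure.base (R := TriacontaCorner g) (Or.inr (Or.inr ⟨rfl, rfl, rfl⟩))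
  obtain ⟨rfl, rfl, rfl⟩ | ⟨rfl, rfl, rfl⟩ | ⟨rfl, rfl, rfl⟩ := h
  · have e1 : (g + 1) • pt3 0 (g - 1) g - pt3 1 0 g - pt3 (-1) 0 g = pt3 0 g 1 := by
      simp only [smul_pt3, pt3_sub]
      congr 1 <;> grind
    have e2 : pt3 1 0 g + pt3 (-1) 0 g - pt3 0 (g - 1) g = pt3 0 (-(g - 1)) g := by
      simp only [pt3_add, pt3_sub]
      congr 1 <;> ring
    have h1 := b2.neg
    have h2 := b1.cyc.cyc.neg.cyc
    simp only [cycMap_pt3, negMap_pt3, neg_zero] at h1 h2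
    rw [e1, e2]
    exact ⟨h1, b2, h2⟩
  · have e1 : (g + 1) • pt3 0 (g - 1) g - pt3 1 0 g - pt3 0 g 1 = pt3 (-1) 0 g := by
      simp only [smul_pt3, pt3_sub]
      congr 1 <;> grind
    have e2 : pt3 1 0 g + pt3 0 g 1 - pt3 0 (g - 1) g = pt3 1 1 1 := by
      simp only [pt3_add, pt3_sub]
      congr 1 <;> ring
    have h1 := b2.neg.swap
    simp only [negMap_pt3, neg_zero] at h1
    rw [e1, e2]
    exact ⟨h1, b1, b3⟩
  · have e1 : (g + 1) • pt3 1 1 1 - pt3 1 0 g - pt3 0 g 1 = pt3 g 1 0 := by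
      simp only [smul_pt3, pt3_sub]
      congr 1 <;> ring
    have e2 : pt3 1 0 g + pt3 0 g 1 - pt3 1 1 1 = pt3 0 (g - 1) g := by
      simp only [pt3_add, pt3_sub]
      congr 1 <;> ring
    have h1 := b3.cyc.swap
    have h2 := b3.cyc.cyc
    simp only [cycMap_pt3] at h1 h2
    rw [e1, e2]
    exact ⟨h2, h1, b2⟩

lemma orbitPoints_triaconta {g : ℝ} (hg : g ^ 2 = g + 1) :
    orbitPoints (g + 1) (pt3 0 (g - 1) g) (pt3 1 0 g) (pt3 (-1) 0 g) =
      cubeVerts ∪ cycSigns (g - 1) g ∪ cycSigns g 1 := by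
  set O := orbitPoints (g + 1) (pt3 0 (g - 1) g) (pt3 1 0 g) (pt3 (-1) 0 g) with hO
  have m1 : pt3 0 (g - 1) g ∈ cycSigns (g - 1) g :=
    ⟨1, 1, Or.inl rfl, Or.inl rfl, by simp⟩
  have m2 : pt3 1 0 g ∈ cycSigns g 1 := ⟨1, 1, Or.inl rfl, Or.inl rfl, by simp⟩
  have m3 : pt3 (-1) 0 g ∈ cycSigns g 1 := ⟨1, -1, Or.inl rfl, Or.inr rfl, by simp⟩
  have m4 : pt3 0 g 1 ∈ cycSigns g 1 := ⟨1, 1, Or.inl rfl, Or.inl rfl, by simp⟩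
  have m5 : pt3 1 1 1 ∈ cubeVerts :=
    ⟨1, 1, 1, Or.inl rfl, Or.inl rfl, Or.inl rfl, rfl⟩
  apply subset_antisymm
  · apply SymClosure.orbitPoints_subset (R := TriacontaCorner g)
    · exact TriacontaCorner.third_flip hg
    · rintro x y z (⟨rfl, rfl, rfl⟩ | ⟨rfl, rfl, rfl⟩ | ⟨rfl, rfl, rfl⟩)
      · exact ⟨Or.inl (Or.inr m1), Or.inr m2, Or.inr m3⟩
      · exact ⟨Or.inl (Or.inr m1), Or.inr m2, Or.inr m4⟩
      · exact ⟨Or.inl (Or.inl m5), Or.inr m2, Or.inr m4⟩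
    · rintro x ((hx | hx) | hx)
      · exact Or.inl (Or.inl (cycMap_mem_cubeVerts hx))
      · exact Or.inl (Or.inr (cycMap_mem_cycSigns hx))
      · exact Or.inr (cycMap_mem_cycSigns hx)
    · rintro x ((hx | hx) | hx)
      · exact Or.inl (Or.inl (negMap_mem_cubeVerts hx))
      · exact Or.inl (Or.inr (negMap_mem_cycSigns hx))
      · exact Or.inr (negMap_mem_cycSigns hx)
    · exact Or.inl ⟨rfl, rfl, rfl⟩
  · have o1 := CornerOrbit.base (κ := g + 1) (x₀ := pt3 0 (g - 1) g) (y₀ := pt3 1 0 g)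
      (z₀ := pt3 (-1) 0 g)
    have o2 := o1.swap.third
    rw [show (g + 1) • pt3 0 (g - 1) g - pt3 (-1) 0 g - pt3 1 0 g = pt3 0 g 1 by
      simp only [smul_pt3, pt3_sub]
      congr 1 <;> grind] at o2
    have o3 := o2.flip
    rw [show pt3 1 0 g + pt3 0 g 1 - pt3 0 (g - 1) g = pt3 1 1 1 by
      simp only [pt3_add, pt3_sub]
      congr 1 <;> ring] at o3
    have o4 := o3.swap.third
    rw [show (g + 1) • pt3 1 1 1 - pt3 0 g 1 - pt3 1 0 g = pt3 g 1 0 by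
      simp only [smul_pt3, pt3_sub]
      congr 1 <;> ring] at o4
    have o5 := o4.flip
    rw [show pt3 1 0 g + pt3 g 1 0 - pt3 1 1 1 = pt3 g 0 (g - 1) by
      simp only [pt3_add, pt3_sub]
      congr 1 <;> ring] at o5
    have o6 := o5.third
    rw [show (g + 1) • pt3 g 0 (g - 1) - pt3 1 0 g - pt3 g 1 0 = pt3 g (-1) 0 by
      simp only [smul_pt3, pt3_sub]
      congr 1 <;> grind] at o6
    have hc : ∀ x ∈ O, cycMap x ∈ O := by
      refine fun x => map_mem_orbitPoints cycMap ?_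
      simpa only [cycMap_pt3] using o6
    have hn : ∀ x ∈ O, negMap x ∈ O := by
      refine fun x => map_mem_orbitPoints negMap ?_
      simpa only [negMap_pt3, neg_zero, neg_neg] using o1.swap
    refine union_subset (union_subset ?_ ?_) ?_
    · exact cubeVerts_subset hc hn ⟨_, _, Or.inl o3⟩
    · exact cycSigns_subset hc hn ⟨_, _, Or.inl o1⟩
    · exact cycSigns_subset hc hn ⟨_, _, Or.inr o3.swap⟩

lemma linearIndependent_of_gram {x y z : Euc 3} {a b c : ℝ} (hc : 0 < c) (hca : c < a)
    (hcb : c < b) (xx : ⟪x, x⟫ = a) (xy : ⟪x, y⟫ = c) (xz : ⟪x, z⟫ = c) (yy : ⟪y, y⟫ = b)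
    (zz : ⟪z, z⟫ = b) (yz : ⟪y, z⟫ = 2 * c - b) : LinearIndependent ℝ ![x, y, z] := by
  have yx : ⟪y, x⟫ = c := (real_inner_comm _ _).trans xy
  have zx : ⟪z, x⟫ = c := (real_inner_comm _ _).trans xz
  have zy : ⟪z, y⟫ = 2 * c - b := (real_inner_comm _ _).trans yz
  rw [Fintype.linearIndependent_iff]
  intro f hf
  simp only [Fin.sum_univ_three, Matrix.cons_val] at hf
  have h1 := congrArg (fun v => ⟪x, v⟫) hf
  have h2 := congrArg (fun v => ⟪y, v⟫) hf
  have h3 := congrArg (fun v => ⟪z, v⟫) hf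
  simp only [inner_add_right, real_inner_smul_right, inner_zero_right, xx, xy, xz, yy, zz, yz,
    yx, zx, zy] at h1 h2 h3
  have e1 : f 1 = f 2 := by
    have : (f 1 - f 2) * (b - c) = 0 := by linear_combination (h2 - h3) / 2
    obtain h | h := mul_eq_zero.1 this <;> linarith
  rw [e1] at h1 h2
  have e2 : f 0 = -2 * f 2 := by
    have : (f 0 + 2 * f 2) * c = 0 := by linear_combination h2
    obtain h | h := mul_eq_zero.1 this <;> linarith
  rw [e2] at h1
  have e3 : f 2 = 0 := by
    have : f 2 * (a - c) = 0 := by linear_combination -h1 / 2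
    obtain h | h := mul_eq_zero.1 this <;> linarith
  rw [e3] at e1 e2
  intro i
  fin_cases i
  · simpa using e2
  · exact e1
  · exact e3

/-- Two triples of vectors with proportional Gram matrices are similar. -/
lemma exists_similarity {x y z x' y' z' : Euc 3} {a b c μ : ℝ} (hμ : 0 < μ) (hc : 0 < c)
    (hca : c < a) (hcb : c < b) (xx : ⟪x, x⟫ = a) (xy : ⟪x, y⟫ = c) (xz : ⟪x, z⟫ = c)
    (yy : ⟪y, y⟫ = b) (zz : ⟪z, z⟫ = b) (yz : ⟪y, z⟫ = 2 * c - b)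
    (xx' : ⟪x', x'⟫ = μ ^ 2 * a) (xy' : ⟪x', y'⟫ = μ ^ 2 * c) (xz' : ⟪x', z'⟫ = μ ^ 2 * c)
    (yy' : ⟪y', y'⟫ = μ ^ 2 * b) (zz' : ⟪z', z'⟫ = μ ^ 2 * b)
    (yz' : ⟪y', z'⟫ = μ ^ 2 * (2 * c - b)) :
    ∃ T : Euc 3 ≃ₗᵢ[ℝ] Euc 3, μ • T x = x' ∧ μ • T y = y' ∧ μ • T z = z' := by
  let B := basisOfLinearIndependentOfCardEqFinrank
    (linearIndependent_of_gram hc hca hcb xx xy xz yy zz yz) (by simp)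
  let S : Euc 3 →ₗ[ℝ] Euc 3 := B.constr ℝ ![μ⁻¹ • x', μ⁻¹ • y', μ⁻¹ • z']
  have hB : ∀ i, B i = ![x, y, z] i := fun i => by simp [B]
  have hS : ∀ i, S (![x, y, z] i) = ![μ⁻¹ • x', μ⁻¹ • y', μ⁻¹ • z'] i := fun i => by
    rw [← hB, Module.Basis.constr_basis]
  have hx : S x = μ⁻¹ • x' := hS 0
  have hy : S y = μ⁻¹ • y' := hS 1
  have hz : S z = μ⁻¹ • z' := hS 2
  have yx : ⟪y, x⟫ = c := (real_inner_comm _ _).trans xy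
  have zx : ⟪z, x⟫ = c := (real_inner_comm _ _).trans xz
  have zy : ⟪z, y⟫ = 2 * c - b := (real_inner_comm _ _).trans yz
  have yx' : ⟪y', x'⟫ = μ ^ 2 * c := (real_inner_comm _ _).trans xy'
  have zx' : ⟪z', x'⟫ = μ ^ 2 * c := (real_inner_comm _ _).trans xz'
  have zy' : ⟪z', y'⟫ = μ ^ 2 * (2 * c - b) := (real_inner_comm _ _).trans yz'
  have hform : (innerₗ (Euc 3)).compl₁₂ S S = innerₗ (Euc 3) := by
    refine LinearMap.ext_basis B B fun i j => ?_
    rw [hB, hB]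
    fin_cases i <;> fin_cases j <;>
      simp [LinearMap.compl₁₂_apply, hx, hy, hz, -inner_self_eq_norm_sq_to_K,
        xx, xy, xz, yy, zz, yz, yx, zx,
        zy, xx', xy', xz', yy', zz', yz', yx', zx', zy'] <;> field_simp
  have hinner : ∀ u v, ⟪S u, S v⟫ = ⟪u, v⟫ := fun u v =>
    congrArg (fun f => f u v) hform
  refine ⟨(S.isometryOfInner hinner).toLinearIsometryEquiv rfl, ?_, ?_, ?_⟩
  · change μ • S x = x'
    rw [hx, smul_inv_smul₀ hμ.ne']
  · change μ • S y = y'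
    rw [hy, smul_inv_smul₀ hμ.ne']
  · change μ • S z = z'
    rw [hz, smul_inv_smul₀ hμ.ne']

namespace Bip

variable {P V W : Set (Euc 3)} {a b c : ℝ}

lemma exists_rhombus (B : Bip P V W a b c) (hab : a < b) :
    ∃ x y z, x ∈ V ∧ Cor P x y z (Real.sqrt c) := by
  have hne : (P.extremePoints ℝ).Nonempty := by
    rw [Set.nonempty_iff_ne_empty]
    intro h
    have := B.poly.convexHull_extremePoints
    rw [h, convexHull_empty] at this
    have hf := B.full
    rw [FullDim, ← this, AffineSubspace.span_empty] at hf
    exact AffineSubspace.bot_ne_top ℝ (Euc 3) (Euc 3) hf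
  obtain ⟨p, hp⟩ := hne
  obtain ⟨n, hn, -⟩ := exists_third_edge B.poly B.full hp p p
  have key : ∃ x y, x ∈ V ∧ IsEdge P x y := by
    obtain ⟨h, -⟩ | ⟨-, h⟩ := B.edge _ _ hn
    · exact ⟨p, n, h, hn⟩
    · exact ⟨n, p, h, hn.symm⟩
  obtain ⟨x, y, hx, hxy⟩ := key
  obtain ⟨s, u, g, hs, -, -, -, -, -, hc, -⟩ := B.vertex_cycle hx hxy
  have C := hc 0 (by omega)
  rw [B.cor_sq_eq hab C] at C
  exact ⟨_, _, _, hx, C⟩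

/-- Identification of a strictly bipartite polyhedron with the polyhedron spanned by the orbit of
a corner with the same shape. -/
lemma eq_smul_image (B : Bip P V W a b c) {x y z x' y' z' : Euc 3} {k : ℝ} (hab : a < b)
    (hx : x ∈ V) (C : Cor P x y z (Real.sqrt c)) (ha : k * a = 3 * c)
    (hb : b - c = k * (a - c)) (hk0 : 0 < k) (xx : ⟪x', x'⟫ = 3) (xy : ⟪x', y'⟫ = k)
    (xz : ⟪x', z'⟫ = k) (yy : ⟪y', y'⟫ = 4 * k - k ^ 2) (zz : ⟪z', z'⟫ = 4 * k - k ^ 2)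
    (yz : ⟪y', z'⟫ = k ^ 2 - 2 * k) :
    ∃ (T : Euc 3 ≃ₗᵢ[ℝ] Euc 3) (μ : ℝ), 0 < μ ∧
      P = μ • (T '' convexHull ℝ (orbitPoints k x' y' z')) := by
  obtain ⟨hc, -, -⟩ := B.rhombic_relation hab hx C
  obtain ⟨i1, i2, i3⟩ := B.inner_of_rhombus hx hc C
  obtain ⟨hy, hz⟩ := B.cor_mem_of_mem C hx
  have hka : k < 3 := by
    by_contra h
    nlinarith [B.ca, mul_le_mul_of_nonneg_right (not_lt.1 h) (B.pos hx).le]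
  have hμ : 0 < Real.sqrt (c / k) := Real.sqrt_pos.2 (div_pos hc hk0)
  have hμ2 : Real.sqrt (c / k) ^ 2 = c / k := Real.sq_sqrt (div_pos hc hk0).le
  have ea : a = c / k * 3 := by field_simp; linarith
  have eb : b = c / k * (4 * k - k ^ 2) := by
    field_simp
    linear_combination hb + ha
  obtain ⟨T, hT1, hT2, hT3⟩ := exists_similarity hμ hk0 hka (by nlinarith : k < 4 * k - k ^ 2)
    xx xy xz yy zz (by rw [yz]; ring) (by rw [hμ2, B.sqV x hx, ea])
    (by rw [hμ2, i2]; field_simp) (by rw [hμ2, i3]; field_simp)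
    (by rw [hμ2, B.sqW y hy, eb]) (by rw [hμ2, B.sqW z hz, eb])
    (by rw [hμ2, i1, eb]; field_simp)
  refine ⟨T, _, hμ, ?_⟩
  set μ := Real.sqrt (c / k)
  have e := orbitPoints_map k x' y' z' (μ • T.toLinearEquiv.toLinearMap)
  have ek : 3 * c / a = k := by
    rw [div_eq_iff (B.pos hx).ne', ha]
  rw [B.eq_convexHull_orbitPoints hab hx C, ek, ← hT1, ← hT2, ← hT3]
  change convexHull ℝ (orbitPoints k ((μ • T.toLinearEquiv.toLinearMap) x')
    ((μ • T.toLinearEquiv.toLinearMap) y') ((μ • T.toLinearEquiv.toLinearMap) z')) = _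
  rw [e, ← LinearMap.image_convexHull, ← image_smul, image_image]
  rfl

end Bip

/-- Every full-dimensional strictly bipartite convex polytope in `ℝ³` is,
up to a linear isometry and positive scaling, the rhombic dodecahedron or the rhombic
triacontahedron. -/
theorem strictlyBipartite_polyhedron_classification
    (P : Set (Euc 3)) (hP : IsPolytope P) (hfull : FullDim P)
    (hbip : IsStrictlyBipartite P) :
    ∃ (T : Euc 3 ≃ₗᵢ[ℝ] Euc 3) (lam : ℝ), 0 < lam ∧
      (P = lam • (T '' rhombicDodecahedron) ∨
       P = lam • (T '' rhombicTriacontahedron)) := by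
  
  obtain ⟨V, W, r1, r2, l, h, hr⟩ := hbip
  have B := bip_of_isBipartiteWith hP hfull h hr
  have hr1 : 0 < r1 := h.2.2.2.2.2.1
  have hab : r1 ^ 2 < r2 ^ 2 := by nlinarith
  obtain ⟨x, y, z, hx, C⟩ := B.exists_rhombus hab
  obtain ⟨k, rfl | rfl, ha, hb⟩ := B.rhombic_cases hab hx C
  · obtain ⟨T, μ, hμ, e⟩ := B.eq_smul_image (x' := pt3 1 1 1) (y' := pt3 0 2 0)
      (z' := pt3 0 0 2) hab hx C ha hb two_pos (by rw [inner_pt3]; norm_num)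
      (by rw [inner_pt3]; norm_num) (by rw [inner_pt3]; norm_num) (by rw [inner_pt3]; norm_num)
      (by rw [inner_pt3]; norm_num) (by rw [inner_pt3]; norm_num)
    rw [orbitPoints_dodeca] at e
    exact ⟨T, μ, hμ, Or.inl e⟩
  · have hg := goldenR_sq
    have hg0 := goldenR_pos
    obtain ⟨T, μ, hμ, e⟩ := B.eq_smul_image (x' := pt3 0 (goldenR - 1) goldenR)
      (y' := pt3 1 0 goldenR) (z' := pt3 (-1) 0 goldenR) hab hx C ha hb (by linarith)
      (by rw [inner_pt3]; linear_combination 2 * hg) (by rw [inner_pt3]; linear_combination hg)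
      (by rw [inner_pt3]; linear_combination hg) (by rw [inner_pt3]; linear_combination 2 * hg)
      (by rw [inner_pt3]; linear_combination 2 * hg) (by rw [inner_pt3]; ring)
    rw [orbitPoints_triaconta hg, show goldenR - 1 = 1 / goldenR by
      field_simp; linear_combination hg] at e
    exact ⟨T, μ, hμ, Or.inr e⟩
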